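/- Let f : ℕ → ℂ be in the class F₀, let k ≥ 2 be a fixed integer and let N ≥ 1 be a fixed integer. Then Σ_{n₁,…,n_k ≤ x} f(lcm(n₁,…,n_k)) = k·x^k·log log x + E_{f,k}·x^k + k·x^k·Σ_{j=1}^{N} a_j/(log x)^j + O( x^k / (log x)^{N+1} ) as x → ∞, where E_{f,k} = k·C_f − Σ_{j=2}^{k} (−1)^j·binom(k,j)·D_{f,j}, with C_f = γ + Σ_p ( log(1 − 1/p) + (1 − 1/p)·Σ_{ν=1}^{∞} f(p^ν)/p^ν ), D_{f,j} = Σ_p (1 − 1/p^j)·Σ_{ν=1}^{∞} f(p^ν)/p^{νj}, and a_j = − ∫_1^∞ (t − ⌊t⌋)·(log t)^{j−1}/t² dt. -/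

import Mathlib

namespace LcmAux
open Complex Filter Topology

noncomputable def qz (n : ℕ) (s : ℂ) : ℂ :=
  ((n : ℂ) + 1) ^ (1 - s) - ((n : ℂ) + 2) ^ (1 - s) - (s - 1) * ((n : ℂ) + 2) ^ (-s)

lemma qz_eq (n : ℕ) (s : ℂ) :
    qz n s = (s - 1) * ∫ t : ℝ in ((n : ℝ) + 1)..((n : ℝ) + 2),
      ((t : ℂ) ^ (-s) - ((n : ℂ) + 2) ^ (-s)) := by
  by_cases hs : s = 1
  · subst hs; simp [qz]
  have h0 : (0 : ℝ) ∉ Set.uIcc ((n : ℝ) + 1) ((n : ℝ) + 2) := by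
    rw [Set.uIcc_of_le (by linarith)]
    intro h
    have := h.1
    have : (0 : ℝ) ≤ n := Nat.cast_nonneg n
    linarith
  have hne : -s ≠ -1 := fun h => hs (neg_injective h)
  rw [intervalIntegral.integral_sub]
  · rw [integral_cpow (Or.inr ⟨hne, h0⟩)]
    simp only [intervalIntegral.integral_const]
    have : s - 1 ≠ 0 := sub_ne_zero.2 hs
    have h3 : -s + 1 ≠ 0 := by
      intro h; apply this; linear_combination -h
    have h4 : (1 - s) = -s + 1 := by ring
    unfold qz
    rw [h4]
    push_cast
    have h5 : ((n : ℝ) + 2 - (n + 1)) = 1 := by ring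
    rw [h5, one_smul]
    field_simp
    ring
  · exact intervalIntegral.intervalIntegrable_cpow (Or.inr h0)
  · simp

lemma piece_bound (n : ℕ) (s : ℂ) (hs : 0 ≤ s.re) (t : ℝ) (ht : t ∈ Set.Icc ((n : ℝ) + 1) (n + 2)) :
    ‖(t : ℂ) ^ (-s) - ((n : ℂ) + 2) ^ (-s)‖ ≤ 2 * ((n : ℝ) + 1) ^ (-s.re) ∧
    ‖(t : ℂ) ^ (-s) - ((n : ℂ) + 2) ^ (-s)‖ ≤ ‖s‖ * ((n : ℝ) + 1) ^ (-s.re - 1) := by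
  have hn : (0 : ℝ) ≤ n := Nat.cast_nonneg n
  have ht0 : 0 < t := by have := ht.1; linarith
  have e2 : ((n : ℂ) + 2) = (((n : ℝ) + 2 : ℝ) : ℂ) := by push_cast; ring
  have hb : ∀ u ∈ Set.Icc ((n : ℝ) + 1) (n + 2), ∀ r : ℝ, r ≤ 0 → u ^ r ≤ ((n : ℝ) + 1) ^ r := by
    intro u hu r hr
    exact Real.rpow_le_rpow_of_nonpos (by linarith) hu.1 hr
  constructor
  · have h1 : ‖(t : ℂ) ^ (-s)‖ ≤ ((n : ℝ) + 1) ^ (-s.re) := by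
      rw [Complex.norm_cpow_eq_rpow_re_of_pos ht0]
      exact hb t ht _ (by simpa using hs)
    have h2 : ‖((n : ℂ) + 2) ^ (-s)‖ ≤ ((n : ℝ) + 1) ^ (-s.re) := by
      rw [e2, Complex.norm_cpow_eq_rpow_re_of_pos (by linarith)]
      exact hb _ ⟨by linarith, le_rfl⟩ _ (by simpa using hs)
    calc _ ≤ _ := norm_sub_le _ _
      _ ≤ _ := by linarith
  · rw [e2]
    have hd : ∀ u ∈ Set.Icc ((n : ℝ) + 1) (n + 2),
        HasDerivWithinAt (fun u : ℝ => (u : ℂ) ^ (-s)) ((-s) * (u : ℂ) ^ (-s - 1)) 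
          (Set.Icc ((n : ℝ) + 1) (n + 2)) u := by
      intro u hu
      have hu0 : 0 < u := by have := hu.1; linarith
      by_cases h0 : s = 0
      · subst h0; simpa using hasDerivWithinAt_const _ _ _
      exact (hasDerivAt_ofReal_cpow_const hu0.ne' (neg_ne_zero.2 h0)).hasDerivWithinAt
    have := Convex.norm_image_sub_le_of_norm_hasDerivWithin_le (C := ‖s‖ * ((n : ℝ) + 1) ^ (-s.re - 1)) hd ?_ (convex_Icc _ _) 
      (x := (n : ℝ) + 2) (y := t) ⟨by linarith, le_rfl⟩ ht
    · refine this.trans ?_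
      have h1 : ‖t - ((n : ℝ) + 2)‖ ≤ 1 := by
        rw [Real.norm_eq_abs, abs_le]; constructor <;> linarith [ht.1, ht.2]
      exact mul_le_of_le_one_right (by positivity) h1
    · intro u hu
      have hu0 : 0 < u := by have := hu.1; linarith
      rw [norm_mul, norm_neg, Complex.norm_cpow_eq_rpow_re_of_pos hu0]
      gcongr
      have : (-s - 1).re = -s.re - 1 := by simp
      rw [this]
      exact hb u hu _ (by linarith)

lemma qz_bound (ε : ℝ) (h0 : 0 < ε) (h1 : ε ≤ 1/2) (s : ℂ) (hs : 1 - ε ≤ s.re) (n : ℕ) :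
    ‖qz n s‖ ≤ 2 * ‖s - 1‖ * ‖s‖ ^ (2 * ε) * ((n : ℝ) + 1) ^ (-(1 + ε)) := by
  have hn : (0 : ℝ) ≤ n := Nat.cast_nonneg n
  have hm : (0 : ℝ) < n + 1 := by linarith
  rw [qz_eq, norm_mul]
  have hs0 : 0 < s.re := by linarith
  have hspos : 0 < ‖s‖ := norm_pos_iff.2 (by rintro rfl; simp at hs0)
  have key : ‖∫ t : ℝ in ((n : ℝ) + 1)..((n : ℝ) + 2),
      ((t : ℂ) ^ (-s) - ((n : ℂ) + 2) ^ (-s))‖ ≤ 2 * ‖s‖ ^ (2 * ε) * ((n : ℝ) + 1) ^ (-(1 + ε)) := by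
    have := intervalIntegral.norm_integral_le_of_norm_le_const (a := (n : ℝ) + 1) (b := (n : ℝ) + 2)
      (f := fun t : ℝ => ((t : ℂ) ^ (-s) - ((n : ℂ) + 2) ^ (-s))) 
      (C := 2 * ‖s‖ ^ (2 * ε) * ((n : ℝ) + 1) ^ (-(1 + ε))) ?_
    · have h5 : ((n : ℝ) + 2 - (n + 1)) = 1 := by ring
      rw [h5] at this; simpa using this
    · intro t ht
      rw [Set.uIoc_of_le (by linarith)] at ht
      obtain ⟨b1, b2⟩ := piece_bound n s hs0.le t ⟨ht.1.le, ht.2⟩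
      set y := ‖s‖ / ((n : ℝ) + 1) with hy
      have hy0 : 0 < y := by positivity
      have c1 : ‖(t : ℂ) ^ (-s) - ((n : ℂ) + 2) ^ (-s)‖ ≤ 2 * ((n : ℝ) + 1) ^ (-s.re) * y ^ (2 * ε) := by
        rcases le_total y 1 with hy1 | hy1
        · refine b2.trans ?_
          have : ((n : ℝ) + 1) ^ (-s.re - 1) = ((n : ℝ) + 1) ^ (-s.re) / (n + 1) := by
            rw [Real.rpow_sub hm, Real.rpow_one]
          rw [this]
          have h2 : y ≤ y ^ (2 * ε) := by
            conv_lhs => rw [← Real.rpow_one y]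
            exact Real.rpow_le_rpow_of_exponent_ge hy0 hy1 (by linarith)
          have h3 : ‖s‖ * (((n : ℝ) + 1) ^ (-s.re) / (n + 1)) = ((n : ℝ) + 1) ^ (-s.re) * y := by
            rw [hy]; ring
          rw [h3]
          have h4 : 0 < ((n : ℝ) + 1) ^ (-s.re) := by positivity
          nlinarith [mul_pos h4 hy0, mul_le_mul_of_nonneg_left h2 h4.le]
        · refine b1.trans ?_
          apply le_mul_of_one_le_right (by positivity)
          exact Real.one_le_rpow hy1 (by linarith)
      refine c1.trans ?_
      rw [hy, Real.div_rpow hspos.le hm.le]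
      have h6 : ((n : ℝ) + 1) ^ (-s.re) / ((n : ℝ) + 1) ^ (2 * ε) ≤ ((n : ℝ) + 1) ^ (-(1 + ε)) := by
        rw [← Real.rpow_sub hm]
        exact Real.rpow_le_rpow_of_exponent_le (by linarith) (by linarith)
      calc _ = 2 * ‖s‖ ^ (2 * ε) * (((n : ℝ) + 1) ^ (-s.re) / ((n : ℝ) + 1) ^ (2 * ε)) := by ring
        _ ≤ _ := by gcongr
  calc _ ≤ ‖s - 1‖ * (2 * ‖s‖ ^ (2 * ε) * ((n : ℝ) + 1) ^ (-(1 + ε))) := by gcongr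
    _ = _ := by ring

lemma summ_eps (ε : ℝ) (h0 : 0 < ε) : Summable fun n : ℕ => ((n : ℝ) + 1) ^ (-(1 + ε)) := by
  have := (Real.summable_nat_rpow (p := -(1 + ε))).2 (by linarith)
  have h2 := (summable_nat_add_iff 1).2 this
  simpa using h2

lemma qz_sum_gt (s : ℂ) (hs : 1 < s.re) : ∑' n, qz n s = s - riemannZeta₁ s := by
  have hs1 : s ≠ 1 := by rintro rfl; simp at hs
  have h1 : riemannZeta₁ s = (s - 1) * riemannZeta s := by
    rw [riemannZeta_eq_inv_sub_mul hs1]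
    have : s - 1 ≠ 0 := sub_ne_zero.2 hs1
    field_simp
  have hsum : Summable fun n : ℕ => 1 / ((n : ℂ) + 1) ^ s := by
    have := (summable_nat_add_iff 1).2 (Complex.summable_one_div_nat_cpow.2 hs)
    simpa using this
  have hz := zeta_eq_tsum_one_div_nat_add_one_cpow hs
  have hA : HasSum (fun n : ℕ => 1 / ((n : ℂ) + 1) ^ s) (riemannZeta s) := hz ▸ hsum.hasSum
  have hB : HasSum (fun n : ℕ => ((n : ℂ) + 2) ^ (-s)) (riemannZeta s - 1) := by
    have := (hasSum_nat_add_iff' 1).2 hA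
    simp only [Finset.range_one, Finset.sum_singleton, Nat.cast_zero, zero_add, one_cpow, div_one] at this
    have e : (fun n : ℕ => ((n : ℂ) + 2) ^ (-s)) = fun n : ℕ => 1 / (((n + 1 : ℕ) : ℂ) + 1) ^ s := by
      funext n
      rw [Complex.cpow_neg]; push_cast; rw [one_div]; congr 2; ring
    rw [e]; exact this
  have hC : Summable fun n => qz n s := by
    refine Summable.of_norm_bounded ((summ_eps (1/4) (by norm_num)).mul_left (2 * ‖s - 1‖ * ‖s‖ ^ (2 * (1/4 : ℝ)))) ?_
    intro n
    exact qz_bound (1/4) (by norm_num) (by norm_num) s (by linarith) n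
  have hD : HasSum (fun n => qz n s) (1 - (s - 1) * (riemannZeta s - 1)) := by
    rw [hC.hasSum_iff_tendsto_nat]
    have h3 := hB.tendsto_sum_nat
    have h4 : ∀ N : ℕ, ∑ n ∈ Finset.range N, qz n s = 1 - ((N : ℂ) + 1) ^ (1 - s) - 
        (s - 1) * ∑ n ∈ Finset.range N, ((n : ℂ) + 2) ^ (-s) := by
      intro N
      induction N with
      | zero => simp
      | succ N ih => 
        rw [Finset.sum_range_succ, ih, Finset.sum_range_succ]
        unfold qz
        push_cast
        ring_nf
    simp_rw [h4]
    have h5 : Tendsto (fun N : ℕ => ((N : ℂ) + 1) ^ (1 - s)) atTop (𝓝 0) := by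
      rw [tendsto_zero_iff_norm_tendsto_zero]
      have e : ∀ N : ℕ, ‖((N : ℂ) + 1) ^ (1 - s)‖ = (((N + 1 : ℕ) : ℝ)) ^ (-(s.re - 1)) := by
        intro N
        have : ((N : ℂ) + 1) = (((N + 1 : ℕ) : ℝ) : ℂ) := by push_cast; ring
        rw [this, Complex.norm_cpow_eq_rpow_re_of_pos (by positivity)]
        simp
      simp_rw [e]
      exact ((tendsto_rpow_neg_atTop (by linarith : 0 < s.re - 1)).comp tendsto_natCast_atTop_atTop).comp
        (tendsto_add_atTop_nat 1)
    have := (tendsto_const_nhds (x := (1 : ℂ))).sub h5 |>.sub (h3.const_mul (s - 1))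
    simpa using this
  rw [hD.tsum_eq, h1]; ring

lemma zeta1_eq (ε : ℝ) (h0 : 0 < ε) (h1 : ε ≤ 1/2) (s : ℂ) (hs : 1 - ε < s.re) :
    ∑' n, qz n s = s - riemannZeta₁ s := by
  set R := ‖s‖ + 3
  set U : Set ℂ := {z | 1 - ε < z.re} ∩ Metric.ball 0 R with hU
  have hUo : IsOpen U := (isOpen_lt continuous_const Complex.continuous_re).inter Metric.isOpen_ball
  have hUc : IsPreconnected U := by
    apply Convex.isPreconnected
    exact (convex_halfSpace_re_gt _).inter (convex_ball _ _)
  have hd : DifferentiableOn ℂ (fun w => ∑' n, qz n w) U := by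
    refine differentiableOn_tsum_of_summable_norm ((summ_eps ε h0).mul_left (2 * (R + 1) * R ^ (2 * ε))) ?_ hUo ?_
    · intro n
      have a1 : ((n : ℂ) + 1) ≠ 0 := by exact_mod_cast Nat.succ_ne_zero n
      have a2 : ((n : ℂ) + 2) ≠ 0 := by exact_mod_cast (by omega : n + 2 ≠ 0)
      unfold qz
      refine Differentiable.differentiableOn ?_
      intro z
      have b1 : DifferentiableAt ℂ (fun z : ℂ => ((n : ℂ) + 1) ^ (1 - z)) z := 
        DifferentiableAt.const_cpow (by fun_prop) (Or.inl a1)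
      have b2 : DifferentiableAt ℂ (fun z : ℂ => ((n : ℂ) + 2) ^ (1 - z)) z := 
        DifferentiableAt.const_cpow (by fun_prop) (Or.inl a2)
      have b3 : DifferentiableAt ℂ (fun z : ℂ => ((n : ℂ) + 2) ^ (- z)) z := 
        DifferentiableAt.const_cpow (by fun_prop) (Or.inl a2)
      fun_prop
    · intro n w hw
      refine (qz_bound ε h0 h1 w (le_of_lt hw.1) n).trans ?_
      have hwR : ‖w‖ ≤ R := by simpa using (Metric.mem_ball.1 hw.2).le
      have : ‖w - 1‖ ≤ R + 1 := (norm_sub_le _ _).trans (by simpa using hwR)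
      gcongr
  have he := (hd.analyticOnNhd hUo).eqOn_of_preconnected_of_eventuallyEq 
    (g := fun w => w - riemannZeta₁ w) ?_ hUc (z₀ := 2) ?_ ?_
  · exact he (x := s) ⟨hs, by simp [R]⟩
  · exact DifferentiableOn.analyticOnNhd (Differentiable.differentiableOn (by fun_prop)) hUo
  · refine ⟨by simp; linarith, ?_⟩
    simp [R]; linarith [norm_nonneg s]
  · filter_upwards [(isOpen_lt continuous_const Complex.continuous_re).mem_nhds (show (1 : ℝ) < (2 : ℂ).re by simp)] with w hw
    exact qz_sum_gt w hw

lemma zeta1_bound (ε : ℝ) (h0 : 0 < ε) (h1 : ε ≤ 1/2) : ∃ C > 0, ∀ s : ℂ, 1 - ε < s.re →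
    ‖riemannZeta₁ s - s‖ ≤ C * ‖s - 1‖ * ‖s‖ ^ (2 * ε) := by
  set S := ∑' n : ℕ, ((n : ℝ) + 1) ^ (-(1 + ε)) with hS
  have hSn : 0 ≤ S := tsum_nonneg fun n => by positivity
  refine ⟨2 * S + 1, by linarith, fun s hs => ?_⟩
  have := zeta1_eq ε h0 h1 s hs
  have h2 : ‖∑' n, qz n s‖ ≤ 2 * ‖s - 1‖ * ‖s‖ ^ (2 * ε) * S := by
    rw [hS, ← tsum_mul_left]
    exact tsum_of_norm_bounded ((summ_eps ε h0).mul_left _).hasSum (qz_bound ε h0 h1 s hs.le)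
  rw [this, norm_sub_rev] at h2
  refine h2.trans ?_
  have : 0 ≤ ‖s - 1‖ * ‖s‖ ^ (2 * ε) := by positivity
  nlinarith

end LcmAux


namespace LcmAux
open Complex Filter Topology

lemma im_ne_one {s : ℂ} (h : 0 < |s.im|) : s ≠ 1 := by
  rintro rfl; simp at h

lemma zeta_upper (e : ℝ) (h0 : 0 < e) (h1 : e ≤ 1/2) : ∃ B > 0, ∀ s : ℂ, 1 - e < s.re → s.re ≤ 4 →
    1/2 ≤ |s.im| → ‖riemannZeta s‖ ≤ B * |s.im| ^ (2 * e) := by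
  obtain ⟨C, hC, hb⟩ := zeta1_bound e h0 h1
  refine ⟨18 + 9 * C, by linarith, fun s h2 h3 h4 => ?_⟩
  have hT : 0 < |s.im| := by linarith
  have hs1 : s ≠ 1 := im_ne_one hT
  have hsub : 0 < ‖s - 1‖ := norm_pos_iff.2 (sub_ne_zero.2 hs1)
  have hge : |s.im| ≤ ‖s - 1‖ := by simpa using Complex.abs_im_le_norm (s - 1)
  have hle : ‖s‖ ≤ 9 * |s.im| := by
    have := Complex.norm_le_abs_re_add_abs_im s
    have : |s.re| ≤ 4 := abs_le.2 ⟨by linarith, h3⟩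
    linarith
  have hz : riemannZeta s = s / (s - 1) + (riemannZeta₁ s - s) / (s - 1) := by
    rw [riemannZeta_eq_inv_sub_mul hs1]; ring
  have hhalf : 1 ≤ 2 * |s.im| ^ (2 * e) := by
    have h5 : (1/2 : ℝ) ≤ (1/2 : ℝ) ^ (2 * e) := by
      conv_lhs => rw [← Real.rpow_one (1/2 : ℝ)]
      exact Real.rpow_le_rpow_of_exponent_ge (by norm_num) (by norm_num) (by linarith)
    have h6 : (1/2 : ℝ) ^ (2 * e) ≤ |s.im| ^ (2 * e) := Real.rpow_le_rpow (by norm_num) h4 (by linarith)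
    linarith
  have b1 : ‖s / (s - 1)‖ ≤ 9 := by
    rw [norm_div, div_le_iff₀ hsub]; linarith
  have b2 : ‖(riemannZeta₁ s - s) / (s - 1)‖ ≤ C * (9 * |s.im| ^ (2 * e)) := by
    rw [norm_div, div_le_iff₀ hsub]
    refine (hb s h2).trans ?_
    have : ‖s‖ ^ (2 * e) ≤ 9 * |s.im| ^ (2 * e) := by
      calc ‖s‖ ^ (2 * e) ≤ (9 * |s.im|) ^ (2 * e) := Real.rpow_le_rpow (norm_nonneg _) hle (by linarith)
        _ = 9 ^ (2 * e) * |s.im| ^ (2 * e) := Real.mul_rpow (by norm_num) hT.le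
        _ ≤ 9 ^ (1 : ℝ) * |s.im| ^ (2 * e) := by
          gcongr
          · norm_num
          · linarith
        _ = _ := by rw [Real.rpow_one]
    calc C * ‖s - 1‖ * ‖s‖ ^ (2 * e) ≤ C * ‖s - 1‖ * (9 * |s.im| ^ (2 * e)) := by gcongr
      _ = _ := by ring
  rw [hz]
  refine (norm_add_le _ _).trans ?_
  nlinarith

lemma two_rpow_le {T u a : ℝ} (hT : 0 < T) (hu0 : 0 ≤ u) (hu : u ≤ 2 * T) (ha : 0 ≤ a) (ha1 : a ≤ 5) :
    u ^ a ≤ 32 * T ^ a := by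
  calc u ^ a ≤ (2 * T) ^ a := Real.rpow_le_rpow hu0 hu ha
    _ = 2 ^ a * T ^ a := Real.mul_rpow (by norm_num) hT.le
    _ ≤ 2 ^ (5 : ℝ) * T ^ a := by gcongr; norm_num
    _ = _ := by norm_num

lemma zeta_deriv_upper (e : ℝ) (h0 : 0 < e) (h1 : e ≤ 1/2) : ∃ B > 0, ∀ s : ℂ, 1 - e/2 ≤ s.re → s.re ≤ 3 →
    1 ≤ |s.im| → ‖deriv riemannZeta s‖ ≤ B * |s.im| ^ (2 * e) := by
  obtain ⟨B, hB, hb⟩ := zeta_upper e h0 h1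
  refine ⟨32 * B / (e/4), by positivity, fun s h2 h3 h4 => ?_⟩
  have hT : 0 < |s.im| := by linarith
  have hre : ∀ z ∈ Metric.closedBall s (e/4), |z.re - s.re| ≤ e/4 ∧ |z.im - s.im| ≤ e/4 := by
    intro z hz
    have : ‖z - s‖ ≤ e/4 := by simpa [dist_eq_norm] using hz
    exact ⟨by simpa using (Complex.abs_re_le_norm (z - s)).trans this, 
      by simpa using (Complex.abs_im_le_norm (z - s)).trans this⟩
  have him : ∀ z ∈ Metric.closedBall s (e/4), 1/2 ≤ |z.im| ∧ |z.im| ≤ 2 * |s.im| := by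
    intro z hz
    have h5 := (hre z hz).2
    have h6 := abs_sub_abs_le_abs_sub s.im z.im
    have h7 := abs_sub_abs_le_abs_sub z.im s.im
    rw [abs_sub_comm] at h6
    constructor <;> linarith
  have key := Complex.norm_deriv_le_of_forall_mem_sphere_norm_le (c := s) (R := e/4) (f := riemannZeta)
    (C := 32 * B * |s.im| ^ (2 * e)) (by positivity) ?_ ?_
  · refine key.trans (le_of_eq ?_); ring
  · apply DifferentiableOn.diffContOnCl
    rw [closure_ball _ (by positivity)]
    intro z hz
    exact (differentiableAt_riemannZeta (im_ne_one (by linarith [(him z hz).1]))).differentiableWithinAt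
  · intro z hz
    have hz' := Metric.sphere_subset_closedBall hz
    have h5 := abs_le.1 (hre z hz').1
    refine (hb z (by linarith [h5.1]) (by linarith [h5.2]) (him z hz').1).trans ?_
    have := two_rpow_le hT (abs_nonneg _) (him z hz').2 (by linarith : 0 ≤ 2 * e) (by linarith)
    nlinarith

lemma zeta_one_upper : ∃ C > 0, ∀ η : ℝ, 0 < η → η ≤ 1 → ‖riemannZeta (1 + η)‖ ≤ C / η := by
  obtain ⟨C, hC, hb⟩ := zeta1_bound (1/2) (by norm_num) le_rfl
  refine ⟨2 + C * 2, by positivity, fun η h0 h1 => ?_⟩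
  have hne : (1 + η : ℂ) ≠ 1 := by simpa using h0.ne'
  have := hb (1 + η) (by simp; linarith)
  have hn : ‖(1 + η : ℂ)‖ = 1 + η := by
    have : (1 + η : ℂ) = ((1 + η : ℝ) : ℂ) := by push_cast; ring
    rw [this, Complex.norm_real, Real.norm_eq_abs, abs_of_pos (by linarith)]
  have h2 : ‖(1 + η : ℂ) - 1‖ = η := by simp [abs_of_pos h0]
  rw [h2, hn] at this
  have h3 : ‖riemannZeta₁ (1 + η)‖ ≤ 2 + C * 2 := by
    have h4 := norm_sub_norm_le (riemannZeta₁ (1 + η)) (1 + η)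
    rw [hn] at h4
    have h5 : C * η * (1 + η) ^ (2 * (1/2 : ℝ)) ≤ C * 2 := by
      norm_num
      have : C * η * (1 + η) ≤ C * 1 * (1 + 1) := by gcongr
      linarith
    linarith
  rw [riemannZeta_eq_inv_sub_mul hne, norm_mul, norm_inv, h2, div_eq_mul_inv, mul_comm]
  gcongr

lemma three_four_one {x : ℝ} (hx : 0 < x) (y : ℝ) :
    1 ≤ ‖riemannZeta (1 + x)‖ ^ 3 * ‖riemannZeta (1 + x + I * y)‖ ^ 4 * ‖riemannZeta (1 + x + 2 * I * y)‖ := by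
  have := DirichletCharacter.norm_LFunction_product_ge_one (N := 1) (1 : DirichletCharacter ℂ 1) hx y
  simp only [DirichletCharacter.LFunctionTrivChar, one_pow, DirichletCharacter.LFunction_modOne_eq] at this
  simpa [norm_mul, norm_pow] using this

lemma zeta_lower (e : ℝ) (h0 : 0 < e) (h1 : e ≤ 1/2) : ∃ κ > 0, κ ≤ e/2 ∧ ∃ b > 0, ∀ s : ℂ, 1 ≤ |s.im| →
    1 - κ * |s.im| ^ (-(10 * e)) ≤ s.re → s.re ≤ 2 → b * |s.im| ^ (-(8 * e)) ≤ ‖riemannZeta s‖ := by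
  obtain ⟨B1, hB1, hu⟩ := zeta_upper e h0 h1
  obtain ⟨B, hB, hd⟩ := zeta_deriv_upper e h0 h1
  obtain ⟨C, hC, hone⟩ := zeta_one_upper
  -- lower bound from 3-4-1
  have hlow : ∀ (η t : ℝ), 0 < η → η ≤ 1 → 1 ≤ |t| → 
      η ^ 3 ≤ C ^ 3 * (32 * B1) * |t| ^ (2 * e) * ‖riemannZeta (1 + η + I * t)‖ ^ 4 := by
    intro η t hη hη1 ht
    have h3 := three_four_one hη t
    have h4 := hone η hη hη1
    have h5 : ‖riemannZeta (1 + η + 2 * I * t)‖ ≤ 32 * B1 * |t| ^ (2 * e) := by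
      have him : (1 + η + 2 * I * t : ℂ).im = 2 * t := by simp
      have hre : (1 + η + 2 * I * t : ℂ).re = 1 + η := by simp
      have hab : |2 * t| = 2 * |t| := by rw [abs_mul, abs_two]
      have := hu (1 + η + 2 * I * t) (by rw [hre]; linarith) (by rw [hre]; linarith) 
        (by rw [him, hab]; linarith)
      rw [him] at this
      have h6 := two_rpow_le (T := |t|) (u := |2 * t|) (a := 2 * e) (by linarith) (abs_nonneg _) hab.le (by linarith) (by linarith)
      nlinarith
    have h7 : ‖riemannZeta (1 + η)‖ ^ 3 ≤ (C / η) ^ 3 := by gcongr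
    have h8 : 1 ≤ (C / η) ^ 3 * ‖riemannZeta (1 + η + I * t)‖ ^ 4 * (32 * B1 * |t| ^ (2 * e)) := by
      refine h3.trans ?_; gcongr
    have : (C / η) ^ 3 * ‖riemannZeta (1 + η + I * t)‖ ^ 4 * (32 * B1 * |t| ^ (2 * e)) = 
      (C ^ 3 * (32 * B1) * |t| ^ (2 * e) * ‖riemannZeta (1 + η + I * t)‖ ^ 4) / η ^ 3 := by
      field_simp
    rw [this, le_div_iff₀ (by positivity)] at h8
    linarith
  set c := C ^ 3 * (32 * B1) with hc
  have hcp : 0 < c := by positivity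
  set κ := min (e/2) (1 / (256 * B ^ 4 * c + 1)) with hκ
  have hκ0 : 0 < κ := by positivity
  have hκe : κ ≤ e/2 := min_le_left _ _
  have hκc : c * (4 * B * κ) ^ 4 < κ ^ 3 := by
    have : κ ≤ 1 / (256 * B ^ 4 * c + 1) := min_le_right _ _
    rw [le_div_iff₀ (by positivity)] at this
    have h3 : 0 < κ ^ 3 := by positivity
    have h4 : κ * (256 * B ^ 4 * c) < 1 := by linarith
    calc c * (4 * B * κ) ^ 4 = κ ^ 3 * (κ * (256 * B ^ 4 * c)) := by ring
      _ < κ ^ 3 * 1 := by gcongr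
      _ = _ := by ring
  have hlow2 : ∀ (η t : ℝ), 1 ≤ |t| → κ * |t| ^ (-(10 * e)) ≤ η → η ≤ 1 → 
      4 * B * κ * |t| ^ (-(8 * e)) ≤ ‖riemannZeta (1 + η + I * t)‖ := by
    intro η t ht hη hη1
    have hT : 0 < |t| := by linarith
    have hη0 : 0 < κ * |t| ^ (-(10 * e)) := by positivity
    have h3 := hlow η t (by linarith) hη1 ht
    by_contra! hcon
    have h4 : ‖riemannZeta (1 + η + I * t)‖ ^ 4 ≤ (4 * B * κ * |t| ^ (-(8 * e))) ^ 4 := by gcongr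
    have h5 : (κ * |t| ^ (-(10 * e))) ^ 3 ≤ η ^ 3 := by gcongr
    have h6 : (|t| ^ (-(10 * e))) ^ 3 = |t| ^ (-(30 * e)) := by
      rw [← Real.rpow_natCast, ← Real.rpow_mul hT.le]; congr 1; push_cast; ring
    have h7 : |t| ^ (2 * e) * (|t| ^ (-(8 * e))) ^ 4 = |t| ^ (-(30 * e)) := by
      rw [← Real.rpow_natCast, ← Real.rpow_mul hT.le, ← Real.rpow_add hT]; congr 1; push_cast; ring
    have h8 : c * |t| ^ (2 * e) * ‖riemannZeta (1 + η + I * t)‖ ^ 4 ≤ c * (4 * B * κ) ^ 4 * |t| ^ (-(30 * e)) := by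
      calc _ ≤ c * |t| ^ (2 * e) * (4 * B * κ * |t| ^ (-(8 * e))) ^ 4 := by gcongr
        _ = c * (4 * B * κ) ^ 4 * (|t| ^ (2 * e) * (|t| ^ (-(8 * e))) ^ 4) := by ring
        _ = _ := by rw [h7]
    have h9 : 0 < |t| ^ (-(30 * e)) := by positivity
    have h10 : c * (4 * B * κ) ^ 4 * |t| ^ (-(30 * e)) < κ ^ 3 * |t| ^ (-(30 * e)) := by gcongr
    rw [mul_pow, h6] at h5
    linarith
  refine ⟨κ, hκ0, hκe, 2 * B * κ, by positivity, fun s hs1 hs2 hs3 => ?_⟩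
  have hT : 0 < |s.im| := by linarith
  set η0 := κ * |s.im| ^ (-(10 * e)) with hη0
  have hη0p : 0 < η0 := by positivity
  have hTle : |s.im| ^ (-(10 * e)) ≤ 1 := Real.rpow_le_one_of_one_le_of_nonpos hs1 (by linarith)
  have hη0e : η0 ≤ e/2 := by nlinarith
  have hse : ∀ z : ℂ, z = 1 + ((z.re - 1 : ℝ) : ℂ) + I * (z.im : ℂ) := by
    intro z
    apply Complex.ext <;> simp
  have hTp : 0 < |s.im| ^ (-(8 * e)) := by positivity
  by_cases hcase : 1 + η0 ≤ s.re
  · have := hlow2 (s.re - 1) s.im hs1 (by linarith) (by linarith)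
    rw [← hse s] at this
    have : 2 * B * κ * |s.im| ^ (-(8 * e)) ≤ 4 * B * κ * |s.im| ^ (-(8 * e)) := by gcongr; norm_num
    linarith
  · push Not at hcase
    set w : ℂ := 1 + η0 + I * s.im with hw
    have hwre : w.re = 1 + η0 := by simp [hw]
    have hwim : w.im = s.im := by simp [hw]
    have hlw := hlow2 η0 s.im hs1 le_rfl (by linarith)
    have hseg : ∀ z ∈ segment ℝ s w, z.im = s.im ∧ s.re ≤ z.re ∧ z.re ≤ 1 + η0 := by
      rintro z ⟨a, b, ha, hb, hab, rfl⟩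
      simp only [add_re, add_im, real_smul, re_ofReal_mul, im_ofReal_mul, hwre, hwim]
      refine ⟨by rw [← add_mul, hab, one_mul], ?_, ?_⟩ <;> nlinarith
    have hmv := (convex_segment s w).norm_image_sub_le_of_norm_deriv_le (𝕜 := ℂ) (f := riemannZeta) 
      (C := B * |s.im| ^ (2 * e)) (x := w) (y := s) ?_ ?_ (right_mem_segment ℝ s w) (left_mem_segment ℝ s w)
    · have hdist : ‖s - w‖ ≤ 2 * η0 := by
        have : s - w = ((s.re - (1 + η0) : ℝ) : ℂ) := by
          apply Complex.ext <;> simp [hwre, hwim]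
        rw [this, Complex.norm_real, Real.norm_eq_abs, abs_le]; constructor <;> linarith
      have h3 : B * |s.im| ^ (2 * e) * ‖s - w‖ ≤ 2 * B * κ * |s.im| ^ (-(8 * e)) := by
        calc _ ≤ B * |s.im| ^ (2 * e) * (2 * η0) := by gcongr
          _ = 2 * B * κ * (|s.im| ^ (2 * e) * |s.im| ^ (-(10 * e))) := by rw [hη0]; ring
          _ = _ := by rw [← Real.rpow_add hT]; congr 2; ring
      have h4 := norm_sub_norm_le (riemannZeta w) (riemannZeta s)
      rw [norm_sub_rev] at h4
      linarith
    · intro z hz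
      exact differentiableAt_riemannZeta (im_ne_one (by rw [(hseg z hz).1]; exact hT))
    · intro z hz
      obtain ⟨z1, z2, z3⟩ := hseg z hz
      have := hd z (by linarith) (by linarith) (by rw [z1]; exact hs1)
      rwa [z1] at this

end LcmAux


namespace LcmAux
open Complex Filter Topology

noncomputable def F0 (s : ℂ) : ℂ := -(deriv riemannZeta₁ s / riemannZeta₁ s) - riemannZeta₀ s

noncomputable def GG (s : ℂ) : ℂ := F0 s / (s * (s + 1))

lemma zeta1_ne_zero {s : ℂ} (hs : 1 ≤ s.re) : riemannZeta₁ s ≠ 0 := by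
  by_cases h : s = 1
  · simp [h]
  · intro h0
    have := riemannZeta_eq_inv_sub_mul h
    rw [h0, mul_zero] at this
    exact riemannZeta_ne_zero_of_one_le_re hs this

lemma F0_eq {s : ℂ} (hs : s ≠ 1) (hz : riemannZeta s ≠ 0) :
    F0 s = -(deriv riemannZeta s / riemannZeta s) - riemannZeta s := by
  have h1 : s - 1 ≠ 0 := sub_ne_zero.2 hs
  have hz1 : riemannZeta₁ s ≠ 0 := by
    intro h0; apply hz; rw [riemannZeta_eq_inv_sub_mul hs, h0, mul_zero]
  have hder := deriv_riemannZeta_eq_neg_inv_sub_sq_mul_add hs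
  have h2 := riemannZeta_eq_inv_sub_mul hs
  have h3 : riemannZeta₀ s = riemannZeta s - (s - 1)⁻¹ := by
    rw [riemannZeta_eq_inv_sub_add hs]; ring
  unfold F0
  rw [h3, hder, h2]
  field_simp
  ring

def Udom : Set ℂ := {s | riemannZeta₁ s ≠ 0 ∧ s * (s + 1) ≠ 0}

lemma Udom_open : IsOpen Udom := by
  have h1 : Continuous riemannZeta₁ := differentiable_riemannZeta₁.continuous
  exact (isOpen_ne_fun h1 continuous_const).inter (isOpen_ne_fun (by fun_prop) continuous_const)

lemma mem_Udom {s : ℂ} (hs : 1 ≤ s.re) : s ∈ Udom := by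
  refine ⟨zeta1_ne_zero hs, mul_ne_zero ?_ ?_⟩
  · rintro rfl; simp at hs; linarith
  · intro h
    have := congrArg Complex.re h
    simp at this; linarith

lemma GG_diffAt {s : ℂ} (hs : s ∈ Udom) : DifferentiableAt ℂ GG s := by
  have hd : Differentiable ℂ (deriv riemannZeta₁) := by
    intro z
    exact ((differentiable_riemannZeta₁.analyticAt z).deriv).differentiableAt
  unfold GG F0
  have h1 := hs.1
  have h2 := hs.2
  fun_prop (disch := assumption)

lemma GG_analytic : AnalyticOnNhd ℂ GG Udom :=
  DifferentiableOn.analyticOnNhd (fun _ hs => (GG_diffAt hs).differentiableWithinAt) Udom_open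

lemma GG_deriv_high (n : ℕ) : ∃ C > 0, ∀ s : ℂ, 1 < s.re → s.re ≤ 3/2 → 3 ≤ |s.im| →
    ‖iteratedDeriv n GG s‖ ≤ C * |s.im| ^ (-(3/2 : ℝ)) := by
  set e : ℝ := 1 / (20 * (n + 1)) with he
  have hn : (0 : ℝ) ≤ n := Nat.cast_nonneg n
  have he0 : 0 < e := by positivity
  have he1 : e ≤ 1/20 := by
    rw [he]; apply one_div_le_one_div_of_le <;> linarith
  obtain ⟨B1, hB1, hu⟩ := zeta_upper e he0 (by linarith)
  obtain ⟨B, hB, hd⟩ := zeta_deriv_upper e he0 (by linarith)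
  obtain ⟨κ, hκ, hκe, b, hb, hl⟩ := zeta_lower e he0 (by linarith)
  set C1 := (32 * B * (32 / b) + 32 * B1) * 4 with hC1
  have hC1p : 0 < C1 := by positivity
  refine ⟨n.factorial * C1 / (κ / 4) ^ n, by positivity, fun s h1 h2 h3 => ?_⟩
  have hT : 0 < |s.im| := by linarith
  set T := |s.im| with hTd
  set r := κ / 4 * T ^ (-(10 * e)) with hr
  have hr0 : 0 < r := by positivity
  have hTle : T ^ (-(10 * e)) ≤ 1 := Real.rpow_le_one_of_one_le_of_nonpos (by linarith) (by linarith)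
  have hrκ : r ≤ κ / 4 := by rw [hr]; exact mul_le_of_le_one_right (by positivity) hTle
  have hre : ∀ z ∈ Metric.closedBall s r, |z.re - s.re| ≤ r ∧ |z.im - s.im| ≤ r := by
    intro z hz
    have : ‖z - s‖ ≤ r := by simpa [dist_eq_norm] using hz
    exact ⟨by simpa using (Complex.abs_re_le_norm (z - s)).trans this, 
      by simpa using (Complex.abs_im_le_norm (z - s)).trans this⟩
  have him : ∀ z ∈ Metric.closedBall s r, T/2 ≤ |z.im| ∧ |z.im| ≤ 2 * T := by
    intro z hz
    have h5 := (hre z hz).2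
    have h6 := abs_sub_abs_le_abs_sub s.im z.im
    have h7 := abs_sub_abs_le_abs_sub z.im s.im
    rw [abs_sub_comm] at h6
    constructor <;> linarith
  have hlow : ∀ z ∈ Metric.closedBall s r, b * |z.im| ^ (-(8 * e)) ≤ ‖riemannZeta z‖ := by
    intro z hz
    obtain ⟨i1, i2⟩ := him z hz
    have h5 := abs_le.1 (hre z hz).1
    refine hl z (by linarith) ?_ (by linarith)
    have : r ≤ κ * |z.im| ^ (-(10 * e)) := by
      have h6 : (2 * T) ^ (-(10 * e)) ≤ |z.im| ^ (-(10 * e)) :=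
        Real.rpow_le_rpow_of_nonpos (by linarith) i2 (by linarith)
      rw [Real.mul_rpow (by norm_num) hT.le] at h6
      have h7 : (1/4 : ℝ) ≤ 2 ^ (-(10 * e)) := by
        calc (1/4 : ℝ) = 2 ^ (-2 : ℝ) := by norm_num [Real.rpow_neg]
          _ ≤ _ := Real.rpow_le_rpow_of_exponent_le (by norm_num) (by linarith)
      have h8 : (1/4 : ℝ) * T ^ (-(10 * e)) ≤ |z.im| ^ (-(10 * e)) := by
        refine le_trans ?_ h6; gcongr
      rw [hr]
      nlinarith
    linarith
  have hne : ∀ z ∈ Metric.closedBall s r, riemannZeta z ≠ 0 := by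
    intro z hz h0
    have := hlow z hz
    rw [h0, norm_zero] at this
    have h5 : 0 < |z.im| := by linarith [(him z hz).1]
    have : 0 < b * |z.im| ^ (-(8 * e)) := by positivity
    linarith
  have hz1 : ∀ z ∈ Metric.closedBall s r, z ≠ 1 := fun z hz => im_ne_one (by linarith [(him z hz).1])
  have hU : ∀ z ∈ Metric.closedBall s r, z ∈ Udom := by
    intro z hz
    refine ⟨fun h0 => hne z hz (by rw [riemannZeta_eq_inv_sub_mul (hz1 z hz), h0, mul_zero]), ?_⟩
    have h5 : 0 < |z.im| := by linarith [(him z hz).1]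
    refine mul_ne_zero ?_ ?_ <;> intro h
    · rw [h] at h5; simp at h5
    · have := congrArg Complex.im h
      simp at this; rw [this] at h5; simp at h5
  have hG : ∀ z ∈ Metric.closedBall s r, ‖GG z‖ ≤ C1 * T ^ (10 * e - 2) := by
    intro z hz
    obtain ⟨i1, i2⟩ := him z hz
    have h5 := abs_le.1 (hre z hz).1
    have hzi : 0 < |z.im| := by linarith
    have p2 := two_rpow_le hT (abs_nonneg _) i2 (by linarith : 0 ≤ 2 * e) (by linarith)
    have p8 := two_rpow_le hT (abs_nonneg _) i2 (by linarith : 0 ≤ 8 * e) (by linarith)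
    have a1 : ‖riemannZeta z‖ ≤ B1 * (32 * T ^ (2 * e)) := 
      (hu z (by linarith) (by linarith) (by linarith)).trans (by gcongr)
    have a2 : ‖deriv riemannZeta z‖ ≤ B * (32 * T ^ (2 * e)) := 
      (hd z (by linarith) (by linarith) (by linarith)).trans (by gcongr)
    have a3 : ‖riemannZeta z‖⁻¹ ≤ 32 / b * T ^ (8 * e) := by
      have := hlow z hz
      have h6 : (b * |z.im| ^ (-(8 * e)))⁻¹ = |z.im| ^ (8 * e) / b := by
        rw [Real.rpow_neg hzi.le]; field_simp
      calc ‖riemannZeta z‖⁻¹ ≤ (b * |z.im| ^ (-(8 * e)))⁻¹ := inv_anti₀ (by positivity) this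
        _ = |z.im| ^ (8 * e) / b := h6
        _ ≤ 32 * T ^ (8 * e) / b := by gcongr
        _ = _ := by ring
    have a4 : ‖F0 z‖ ≤ (32 * B * (32 / b) + 32 * B1) * T ^ (10 * e) := by
      rw [F0_eq (hz1 z hz) (hne z hz)]
      refine (norm_sub_le _ _).trans ?_
      rw [norm_neg, norm_div, div_eq_mul_inv]
      have h7 : T ^ (2 * e) ≤ T ^ (10 * e) := Real.rpow_le_rpow_of_exponent_le (by linarith) (by linarith)
      have h8 : T ^ (2 * e) * T ^ (8 * e) = T ^ (10 * e) := by
        rw [← Real.rpow_add hT]; congr 1; ring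
      calc _ ≤ B * (32 * T ^ (2 * e)) * (32 / b * T ^ (8 * e)) + B1 * (32 * T ^ (10 * e)) := by
            gcongr
            exact a1.trans (by gcongr)
        _ = 32 * B * (32 / b) * (T ^ (2 * e) * T ^ (8 * e)) + 32 * B1 * T ^ (10 * e) := by ring
        _ = _ := by rw [h8]; ring
    have a5 : T ^ 2 / 4 ≤ ‖z * (z + 1)‖ := by
      rw [norm_mul]
      have q1 := Complex.abs_im_le_norm z
      have q2 : |z.im| ≤ ‖z + 1‖ := by simpa using Complex.abs_im_le_norm (z + 1)
      calc T ^ 2 / 4 = (T/2) * (T/2) := by ring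
        _ ≤ _ := by gcongr <;> linarith
    unfold GG
    rw [norm_div, div_le_iff₀ (by nlinarith)]
    have h9 : T ^ (10 * e - 2) * T ^ 2 = T ^ (10 * e) := by
      rw [← Real.rpow_natCast T 2, ← Real.rpow_add hT]; congr 1; push_cast; ring
    calc _ ≤ (32 * B * (32 / b) + 32 * B1) * T ^ (10 * e) := a4
      _ = C1 * T ^ (10 * e - 2) * (T ^ 2 / 4) := by rw [← h9, hC1]; ring
      _ ≤ _ := by gcongr
  have key := Complex.norm_iteratedDeriv_le_of_forall_mem_sphere_norm_le (f := GG) (c := s) (R := r) n 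
    (C := C1 * T ^ (10 * e - 2)) hr0 ?_ (fun z hz => hG z (Metric.sphere_subset_closedBall hz))
  · refine key.trans (le_of_eq ?_)
    rw [hr, mul_pow, ← Real.rpow_natCast (T ^ _), ← Real.rpow_mul hT.le]
    have h10 : T ^ (10 * e - 2) = T ^ (-(3/2 : ℝ)) * T ^ (-(10 * e) * n) := by
      rw [← Real.rpow_add hT]; congr 1
      rw [he]; field_simp; ring
    rw [h10]
    field_simp
  · apply DifferentiableOn.diffContOnCl
    rw [closure_ball _ hr0.ne']
    exact fun z hz => (GG_diffAt (hU z hz)).differentiableWithinAt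

lemma GG_deriv (n : ℕ) : ∃ C > 0, ∀ s : ℂ, 1 < s.re → s.re ≤ 3/2 → 
    ‖iteratedDeriv n GG s‖ ≤ C * (1 + |s.im|) ^ (-(3/2 : ℝ)) := by
  obtain ⟨C, hC, h⟩ := GG_deriv_high n
  set K : Set ℂ := Set.Icc 1 (3/2) ×ℂ Set.Icc (-3) 3
  have hK : IsCompact K := isCompact_Icc.reProdIm isCompact_Icc
  have hc : ContinuousOn (iteratedDeriv n GG) K := by
    have := (GG_analytic.iterated_deriv n).continuousOn
    rw [← iteratedDeriv_eq_iterate] at this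
    exact this.mono fun s hs => mem_Udom hs.1.1
  obtain ⟨D, hD⟩ := hK.exists_bound_of_continuousOn hc
  have key : ∀ T : ℝ, 3 ≤ T → T ^ (-(3/2 : ℝ)) ≤ 4 * (1 + T) ^ (-(3/2 : ℝ)) := by
    intro T hT
    have h1 : (2 * T) ^ (-(3/2 : ℝ)) ≤ (1 + T) ^ (-(3/2 : ℝ)) := 
      Real.rpow_le_rpow_of_nonpos (by linarith) (by linarith) (by norm_num)
    rw [Real.mul_rpow (by norm_num) (by linarith)] at h1
    have h2 : (1/4 : ℝ) ≤ 2 ^ (-(3/2 : ℝ)) := by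
      calc (1/4 : ℝ) = 2 ^ (-2 : ℝ) := by norm_num [Real.rpow_neg]
        _ ≤ _ := Real.rpow_le_rpow_of_exponent_le (by norm_num) (by norm_num)
    have h3 : 0 < T ^ (-(3/2 : ℝ)) := by positivity
    nlinarith
  refine ⟨4 * C + |D| * 16, by positivity, fun s h1 h2 => ?_⟩
  have hp : 0 < (1 + |s.im|) ^ (-(3/2 : ℝ)) := by positivity
  rcases le_total 3 |s.im| with h3 | h3
  · refine (h s h1 h2 h3).trans ?_
    have := key _ h3
    have : 0 ≤ |D| * 16 * (1 + |s.im|) ^ (-(3/2 : ℝ)) := by positivity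
    nlinarith
  · have hm : s ∈ K := ⟨⟨h1.le, h2⟩, abs_le.1 h3⟩
    have h5 := (hD s hm).trans (le_abs_self D)
    have h6 : (1/16 : ℝ) ≤ (1 + |s.im|) ^ (-(3/2 : ℝ)) := by
      calc (1/16 : ℝ) = 4 ^ (-2 : ℝ) := by norm_num [Real.rpow_neg]
        _ ≤ 4 ^ (-(3/2 : ℝ)) := Real.rpow_le_rpow_of_exponent_le (by norm_num) (by norm_num)
        _ ≤ _ := Real.rpow_le_rpow_of_nonpos (by positivity) (by linarith) (by norm_num)
    have : 0 ≤ 4 * C * (1 + |s.im|) ^ (-(3/2 : ℝ)) := by positivity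
    nlinarith [abs_nonneg D]

end LcmAux


namespace LcmAux
open Complex Filter Topology MeasureTheory
open scoped FourierTransform

noncomputable def sv (c v : ℝ) : ℂ := (c : ℂ) + 2 * Real.pi * I * v

lemma sv_re (c v : ℝ) : (sv c v).re = c := by simp [sv]
lemma sv_im (c v : ℝ) : (sv c v).im = 2 * Real.pi * v := by simp [sv]

lemma g_iter (c : ℝ) (hc : 1 < c) (n : ℕ) : 
    iteratedDeriv n (fun v : ℝ => GG (sv c v)) = 
      fun v => (2 * Real.pi * I) ^ n * iteratedDeriv n GG (sv c v) := by
  induction n with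
  | zero => simp
  | succ n ih =>
    rw [iteratedDeriv_succ, ih]
    funext v
    have han : AnalyticAt ℂ (iteratedDeriv n GG) (sv c v) := by
      have := (GG_analytic.iterated_deriv n)
      rw [← iteratedDeriv_eq_iterate] at this
      exact this _ (mem_Udom (by rw [sv_re]; exact hc.le))
    have hd := han.differentiableAt.hasDerivAt
    have hs : HasDerivAt (fun v : ℝ => sv c v) (2 * Real.pi * I) v := by
      unfold sv
      have := ((Complex.ofRealCLM.hasDerivAt (x := v)).const_mul (2 * Real.pi * I : ℂ)).const_add (c : ℂ)
      simpa using this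
    have h2 := (HasDerivAt.comp_of_eq v (h₂ := iteratedDeriv n GG) (h := fun v : ℝ => sv c v) hd hs rfl).const_mul ((2 * Real.pi * I : ℂ) ^ n)
    have h3 := h2.deriv
    simp only [Function.comp_def] at h3
    rw [h3, iteratedDeriv_succ]
    ring

lemma g_contDiff (c : ℝ) (hc : 1 < c) : ContDiff ℝ ⊤ (fun v : ℝ => GG (sv c v)) := by
  rw [contDiff_iff_contDiffAt]
  intro v
  have h1 : AnalyticAt ℂ GG (sv c v) := GG_analytic _ (mem_Udom (by rw [sv_re]; exact hc.le))
  have h2 : ContDiffAt ℝ ⊤ GG (sv c v) := h1.contDiffAt.restrict_scalars ℝ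
  refine ContDiffAt.comp (g := GG) (f := fun v : ℝ => sv c v) v h2 ?_
  unfold sv
  have : ContDiff ℝ ⊤ (fun v : ℝ => (v : ℂ)) := Complex.ofRealCLM.contDiff
  exact (contDiff_const.add (contDiff_const.mul this)).contDiffAt

lemma int_base : Integrable (fun v : ℝ => (1 + |v|) ^ (-(3/2 : ℝ))) := by
  have := integrable_one_add_norm (E := ℝ) (μ := volume) (r := 3/2) (by norm_num)
  simpa [Real.norm_eq_abs] using this

lemma g_bound (n : ℕ) : ∃ C > 0, ∀ c : ℝ, 1 < c → c ≤ 3/2 → 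
    ∀ v, ‖iteratedDeriv n (fun v : ℝ => GG (sv c v)) v‖ ≤ C * (1 + |v|) ^ (-(3/2 : ℝ)) := by
  obtain ⟨C, hC, h⟩ := GG_deriv n
  refine ⟨(2 * Real.pi) ^ n * C, by positivity, fun c hc hc2 v => ?_⟩
  rw [g_iter c hc n]
  simp only [norm_mul, norm_pow]
  have h1 : ‖(2 * Real.pi * I : ℂ)‖ = 2 * Real.pi := by
    simp [abs_of_pos Real.pi_pos]
  have := h (sv c v) (by rw [sv_re]; exact hc) (by rw [sv_re]; exact hc2)
  rw [sv_im] at this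
  simp only [norm_mul] at h1
  rw [h1, mul_assoc]
  gcongr
  refine this.trans ?_
  have h3 : |v| ≤ |2 * Real.pi * v| := by
    rw [abs_mul]
    refine le_mul_of_one_le_left (abs_nonneg _) ?_
    rw [abs_of_pos (by positivity)]
    linarith [Real.pi_gt_three]
  exact mul_le_mul_of_nonneg_left (Real.rpow_le_rpow_of_nonpos (by positivity) (by linarith) (by norm_num)) hC.le

lemma g_int (c : ℝ) (hc : 1 < c) (hc2 : c ≤ 3/2) (n : ℕ) : 
    Integrable (iteratedDeriv n (fun v : ℝ => GG (sv c v))) := by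
  obtain ⟨C, hC, h⟩ := g_bound n
  refine Integrable.mono' (int_base.const_mul C) ?_ (Eventually.of_forall (h c hc hc2))
  exact ((g_contDiff c hc).continuous_iteratedDeriv n (by exact_mod_cast le_top)).aestronglyMeasurable

lemma fourier_decay (n : ℕ) : ∃ C > 0, ∀ c : ℝ, 1 < c → c ≤ 3/2 → ∀ y : ℝ, 0 < y → 
    ‖𝓕⁻ (fun v : ℝ => GG (sv c v)) y‖ ≤ C / y ^ n := by
  obtain ⟨C, hC, h⟩ := g_bound n
  set K := ∫ v : ℝ, (1 + |v|) ^ (-(3/2 : ℝ)) with hK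
  have hK0 : 0 ≤ K := integral_nonneg fun v => by positivity
  refine ⟨C * K + 1, by positivity, fun c hc hc2 y hy => ?_⟩
  have h1 := Real.fourier_iteratedDeriv (f := fun v : ℝ => GG (sv c v)) (N := ⊤) (n := n)
    ((g_contDiff c hc).of_le (by exact_mod_cast le_top)) (fun m _ => g_int c hc hc2 m) le_top
  have h2 := congrFun h1 (-y)
  have h3 : ‖𝓕 (iteratedDeriv n (fun v : ℝ => GG (sv c v))) (-y)‖ ≤ C * K := by
    refine (VectorFourier.norm_fourierIntegral_le_integral_norm _ _ _ _ _).trans ?_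
    rw [hK, ← integral_const_mul]
    exact integral_mono (g_int c hc hc2 n).norm (int_base.const_mul C) (h c hc hc2)
  rw [h2, norm_smul] at h3
  rw [Real.fourierInv_eq_fourier_neg, le_div_iff₀ (by positivity)]
  have h4 : y ^ n ≤ ‖(2 * Real.pi * I * ((-y : ℝ) : ℂ)) ^ n‖ := by
    rw [norm_pow]
    gcongr
    simp only [norm_mul, norm_real, norm_I, norm_ofNat, Real.norm_eq_abs, abs_neg, mul_one]
    rw [abs_of_pos hy, abs_of_pos Real.pi_pos]
    nlinarith [Real.pi_gt_three]
  calc _ = y ^ n * ‖𝓕 (fun v : ℝ => GG (sv c v)) (-y)‖ := by ring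
    _ ≤ _ := by gcongr
    _ ≤ C * K := h3
    _ ≤ _ := by linarith

noncomputable def ker (c y : ℝ) : ℂ := ((Real.exp (-c * y) * max 0 (1 - Real.exp (-y)) : ℝ) : ℂ)

lemma ker_cont (c : ℝ) : Continuous (ker c) := by unfold ker; fun_prop

lemma ker_eq (c : ℝ) : ker c = Set.indicator (Set.Ioi 0) 
    (fun y : ℝ => Complex.exp (-c * y) - Complex.exp (-(c + 1) * y)) := by
  funext y
  by_cases hy : y ∈ Set.Ioi (0 : ℝ)
  · rw [Set.indicator_of_mem hy]
    have : 0 ≤ 1 - Real.exp (-y) := by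
      have := Real.exp_le_one_iff.2 (neg_nonpos.2 (le_of_lt hy)); linarith
    rw [ker, max_eq_right this]
    push_cast
    rw [mul_sub, mul_one, ← Complex.exp_add]
    congr 2; ring
  · rw [Set.indicator_of_notMem hy]
    have hy' : y ≤ 0 := not_lt.1 hy
    have : 1 - Real.exp (-y) ≤ 0 := by
      have := Real.one_le_exp (neg_nonneg.2 hy'); linarith
    rw [ker, max_eq_left this]; simp

lemma int_exp_c (a : ℂ) (ha : a.re < 0) : IntegrableOn (fun y : ℝ => Complex.exp (a * y)) (Set.Ioi 0) :=
  integrableOn_exp_mul_complex_Ioi ha 0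

lemma ker_int (c : ℝ) (hc : 0 < c) : Integrable (ker c) := by
  rw [ker_eq, integrable_indicator_iff measurableSet_Ioi]
  apply Integrable.sub
  · exact int_exp_c (-c) (by simpa using hc)
  · exact int_exp_c (-(c+1)) (by simp; linarith)

lemma ker_fourier (c : ℝ) (hc : 0 < c) : 𝓕 (ker c) = fun v => 1 / (sv c v * (sv c v + 1)) := by
  funext v
  rw [Real.fourier_real_eq_integral_exp_smul, ker_eq]
  have e1 : ∀ y : ℝ, Complex.exp (↑(-2 * Real.pi * y * v) * I) • (Set.Ioi (0 : ℝ)).indicator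
    (fun y : ℝ => Complex.exp (-c * y) - Complex.exp (-(c + 1) * y)) y = (Set.Ioi (0 : ℝ)).indicator
    (fun y : ℝ => Complex.exp (-(sv c v) * y) - Complex.exp (-(sv c v + 1) * y)) y := by
    intro y
    by_cases hy : y ∈ Set.Ioi (0 : ℝ)
    · rw [Set.indicator_of_mem hy, Set.indicator_of_mem hy, smul_eq_mul, mul_sub, ← Complex.exp_add, ← Complex.exp_add]
      unfold sv; push_cast
      congr 2 <;> ring
    · rw [Set.indicator_of_notMem hy, Set.indicator_of_notMem hy, smul_zero]
  simp_rw [e1]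
  rw [integral_indicator measurableSet_Ioi, integral_sub]
  · have r1 : (-(sv c v)).re < 0 := by rw [neg_re, sv_re]; linarith
    have r2 : (-(sv c v + 1)).re < 0 := by rw [neg_re, add_re, sv_re]; simp; linarith
    rw [integral_exp_mul_complex_Ioi r1, integral_exp_mul_complex_Ioi r2]
    have n1 : sv c v ≠ 0 := by intro h; rw [h] at r1; simp at r1
    have n2 : sv c v + 1 ≠ 0 := by intro h; rw [h] at r2; simp at r2
    rw [ofReal_zero, mul_zero, mul_zero, Complex.exp_zero, neg_div_neg_eq, neg_div_neg_eq]
    field_simp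
    ring
  · exact int_exp_c _ (by rw [neg_re, sv_re]; linarith)
  · exact int_exp_c _ (by rw [neg_re, add_re, sv_re]; simp; linarith)

lemma kf_bound (c : ℝ) (hc : 1 < c) (v : ℝ) : ‖1 / (sv c v * (sv c v + 1))‖ ≤ (1 + v ^ 2)⁻¹ := by
  rw [norm_div, norm_one, one_div, norm_mul]
  apply inv_anti₀ (by positivity)
  have h1 : 1 + v ^ 2 ≤ ‖sv c v‖ ^ 2 := by
    rw [← Complex.normSq_eq_norm_sq, Complex.normSq_apply, sv_re, sv_im]
    have : 1 ≤ Real.pi ^ 2 := by nlinarith [Real.pi_gt_three]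
    nlinarith [mul_le_mul_of_nonneg_right this (sq_nonneg v), sq_nonneg v]
  have h2 : ‖sv c v‖ ≤ ‖sv c v + 1‖ := by
    rw [← abs_norm (sv c v), ← abs_norm (sv c v + 1), ← sq_le_sq, ← Complex.normSq_eq_norm_sq, ← Complex.normSq_eq_norm_sq,
      Complex.normSq_apply, Complex.normSq_apply]
    simp only [add_re, add_im, sv_re, one_re, one_im]
    nlinarith
  nlinarith [norm_nonneg (sv c v)]

lemma sv_cont (c : ℝ) : Continuous (sv c) := by unfold sv; fun_prop

lemma sv_ne (c : ℝ) (hc : 1 < c) (v : ℝ) : sv c v * (sv c v + 1) ≠ 0 :=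
  (mem_Udom (s := sv c v) (by rw [sv_re]; exact hc.le)).2

lemma kf_int (c : ℝ) (hc : 1 < c) : Integrable (fun v => 1 / (sv c v * (sv c v + 1))) := by
  refine Integrable.mono' integrable_inv_one_add_sq ?_ (Eventually.of_forall (kf_bound c hc))
  have := sv_cont c
  exact (continuous_const.div (by fun_prop) (sv_ne c hc)).aestronglyMeasurable

lemma perron (c : ℝ) (hc : 1 < c) (y : ℝ) : 
    ∫ v : ℝ, Complex.exp (2 * Real.pi * I * v * y) * (1 / (sv c v * (sv c v + 1))) = ker c y := by
  have h := (ker_cont c).fourierInv_fourier_eq (ker_int c (by linarith)) (by rw [ker_fourier c (by linarith)]; exact kf_int c hc)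
  have h2 := congrFun h y
  rw [ker_fourier c (by linarith), Real.fourierInv_eq', ] at h2
  rw [← h2]
  congr 1
  funext v
  rw [smul_eq_mul]
  congr 2
  simp
  ring

end LcmAux


namespace LcmAux
open Complex Filter Topology MeasureTheory
open scoped FourierTransform

noncomputable def aa (n : ℕ) : ℂ := (ArithmeticFunction.vonMangoldt n : ℂ) - 1

lemma aa_summable {s : ℂ} (hs : 1 < s.re) : LSeriesSummable aa s := by
  have h1 := ArithmeticFunction.LSeriesSummable_vonMangoldt hs
  have h2 := LSeriesSummable_one_iff.2 hs
  exact h1.sub h2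

lemma aa_LSeries {s : ℂ} (hs : 1 < s.re) : LSeries aa s = F0 s := by
  have h1 := ArithmeticFunction.LSeriesSummable_vonMangoldt hs
  have h2 := LSeriesSummable_one_iff.2 hs
  have h3 := LSeries_sub h1 h2
  have hs1 : s ≠ 1 := by rintro rfl; simp at hs
  rw [F0_eq hs1 (riemannZeta_ne_zero_of_one_le_re hs.le)]
  have h4 := ArithmeticFunction.LSeries_vonMangoldt_eq_deriv_riemannZeta_div hs
  have h5 := LSeries_one_eq_riemannZeta hs
  rw [h4, h5] at h3
  rw [← neg_div, ← h3]; rfl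

lemma cpow_sv (c : ℝ) (v : ℝ) (y : ℝ) (hy : 0 < y) : (y : ℂ) ^ (sv c v) = 
    ((y ^ c : ℝ) : ℂ) * Complex.exp (2 * Real.pi * I * v * Real.log y) := by
  have hy' : (y : ℂ) ≠ 0 := by exact_mod_cast hy.ne'
  rw [Complex.cpow_def_of_ne_zero hy', Complex.ofReal_cpow hy.le, Complex.cpow_def_of_ne_zero hy', ← Complex.exp_add,
    ← Complex.ofReal_log hy.le]
  unfold sv
  congr 1; ring

lemma smooth_formula (c : ℝ) (hc : 1 < c) (x : ℝ) (hx : 1 ≤ x) :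
    ∑ n ∈ Finset.Icc 1 ⌊x⌋₊, aa n * ((1 - n / x : ℝ) : ℂ) = 
      ((x ^ c : ℝ) : ℂ) * 𝓕⁻ (fun v : ℝ => GG (sv c v)) (Real.log x) := by
  have hx0 : 0 < x := by linarith
  set F : ℕ → ℝ → ℂ := fun n v => LSeries.term aa (sv c v) n * ((x : ℂ) ^ (sv c v) * (1 / (sv c v * (sv c v + 1)))) with hF
  have hkint := kf_int c hc
  -- explicit form
  have hform : ∀ n v, F n v = (if n = 0 then 0 else aa n * ((x / n) ^ c : ℝ)) * 
      (Complex.exp (2 * Real.pi * I * v * Real.log (x / n)) * (1 / (sv c v * (sv c v + 1)))) := by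
    intro n v
    rw [hF]
    by_cases hn : n = 0
    · simp [hn]
    · have hn0 : (0 : ℝ) < n := by exact_mod_cast Nat.pos_of_ne_zero hn
      simp only [LSeries.term, hn, if_false]
      have h1 := cpow_sv c v n hn0
      have h2 := cpow_sv c v (x / n) (by positivity)
      have h3 : ((x / n : ℝ) : ℂ) ^ (sv c v) = (x : ℂ) ^ (sv c v) / ((n : ℝ) : ℂ) ^ (sv c v) := by
        rw [h2, cpow_sv c v x hx0, cpow_sv c v (n : ℝ) hn0, Real.log_div hx0.ne' hn0.ne', Real.div_rpow hx0.le hn0.le,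
          mul_div_mul_comm, ← Complex.exp_sub, Complex.ofReal_div]
        congr 2
        push_cast; ring
      rw [ofReal_natCast] at h3
      rw [mul_assoc (aa n), ← mul_assoc (((x / n) ^ c : ℝ) : ℂ), ← h2, h3]
      ring
  have hint : ∀ n, Integrable (F n) := by
    intro n
    have : F n = fun v : ℝ => (if n = 0 then 0 else aa n * ((x / n) ^ c : ℝ)) * 
      (Complex.exp (2 * Real.pi * I * v * Real.log (x / n)) * (1 / (sv c v * (sv c v + 1)))) := funext (hform n)
    rw [this]
    apply Integrable.const_mul
    refine hkint.bdd_mul (c := 1) (by fun_prop) ?_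
    refine Eventually.of_forall fun v => ?_
    have : (2 * Real.pi * I * v * Real.log (x / n) : ℂ) = ((2 * Real.pi * v * Real.log (x / n) : ℝ) : ℂ) * I := by push_cast; ring
    rw [this, Complex.norm_exp_ofReal_mul_I]
  have hnorm : ∀ n v, ‖F n v‖ = ‖LSeries.term aa (c : ℂ) n‖ * (x ^ c * ‖1 / (sv c v * (sv c v + 1))‖) := by
    intro n v
    rw [hF]
    simp only [norm_mul]
    rw [Complex.norm_cpow_eq_rpow_re_of_pos hx0, LSeries.norm_term_eq, LSeries.norm_term_eq, sv_re, ofReal_re]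
  have hsum : Summable fun n => ∫ v, ‖F n v‖ := by
    simp_rw [hnorm, integral_const_mul]
    apply Summable.mul_right
    exact (aa_summable (s := (c : ℂ)) (by simpa using hc)).norm
  have hH := hasSum_integral_of_summable_integral_norm hint hsum
  have hR : ∫ v, ∑' n, F n v = ((x ^ c : ℝ) : ℂ) * 𝓕⁻ (fun v : ℝ => GG (sv c v)) (Real.log x) := by
    rw [Real.fourierInv_eq', ← integral_const_mul]
    congr 1
    funext v
    have hs : 1 < (sv c v).re := by rw [sv_re]; exact hc
    rw [hF]
    simp only
    rw [tsum_mul_right]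
    have : ∑' n, LSeries.term aa (sv c v) n = F0 (sv c v) := aa_LSeries hs
    rw [this, cpow_sv c v x hx0, smul_eq_mul, GG]
    have e : (↑(2 * Real.pi * inner ℝ v (Real.log x)) * I : ℂ) = 2 * Real.pi * I * v * Real.log x := by
      simp; ring
    rw [e]; ring
  have hL : ∀ n, ∫ v, F n v = if n ∈ Finset.Icc 1 ⌊x⌋₊ then aa n * ((1 - n / x : ℝ) : ℂ) else 0 := by
    intro n
    simp_rw [hform n]
    rw [integral_const_mul, perron c hc]
    by_cases hn : n = 0
    · simp [hn]
    · have hn0 : (0 : ℝ) < n := by exact_mod_cast Nat.pos_of_ne_zero hn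
      have hxn : 0 < x / n := by positivity
      simp only [hn, if_false]
      have h1 : Real.exp (-Real.log (x / n)) = n / x := by
        rw [Real.exp_neg, Real.exp_log hxn, inv_div]
      have h2 : Real.exp (-c * Real.log (x / n)) = ((x / n) ^ c)⁻¹ := by
        rw [Real.rpow_def_of_pos hxn, ← Real.exp_neg]; congr 1; ring
      rw [ker, h1, h2]
      have h3 : (x / n) ^ c ≠ 0 := by positivity
      rw [mul_assoc, ← Complex.ofReal_mul, mul_inv_cancel_left₀ h3]
      split_ifs with hm
      · have : (n : ℝ) ≤ x := (Nat.le_floor_iff hx0.le).1 (Finset.mem_Icc.1 hm).2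
        rw [max_eq_right]
        rw [sub_nonneg, div_le_one hx0]; exact this
      · have : x < n := by
          by_contra! hcon
          exact hm (Finset.mem_Icc.2 ⟨Nat.pos_of_ne_zero hn, (Nat.le_floor_iff hx0.le).2 hcon⟩)
        rw [max_eq_left]
        · simp
        · rw [sub_nonpos, one_le_div hx0]; exact this.le
  rw [← hR, ← hH.tsum_eq]
  simp_rw [hL]
  rw [tsum_eq_sum (s := Finset.Icc 1 ⌊x⌋₊)]
  · exact Finset.sum_congr rfl fun n hn => by rw [if_pos hn]
  · intro n hn; rw [if_neg hn]

lemma smooth_bound (A : ℕ) : ∃ C > 0, ∀ x : ℝ, 8 ≤ x → 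
    |∑ n ∈ Finset.Icc 1 ⌊x⌋₊, (ArithmeticFunction.vonMangoldt n - 1) * (1 - n / x)| ≤ C * x / (Real.log x) ^ A := by
  obtain ⟨C, hC, h⟩ := fourier_decay A
  refine ⟨C * Real.exp 1, by positivity, fun x hx => ?_⟩
  have hx0 : 0 < x := by linarith
  have hlog : 2 ≤ Real.log x := by
    rw [Real.le_log_iff_exp_le hx0]
    have h1 := Real.exp_one_lt_d9
    have h2 : Real.exp 2 = Real.exp 1 * Real.exp 1 := by rw [← Real.exp_add]; norm_num
    have h3 := Real.exp_pos 1
    rw [h2]; nlinarith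
  set c := 1 + 1 / Real.log x with hc
  have hlp : 0 < Real.log x := by linarith
  have hc1 : 1 < c := by rw [hc]; have : 0 < 1 / Real.log x := by positivity
                         linarith
  have hc2 : c ≤ 3/2 := by
    rw [hc]
    have : 1 / Real.log x ≤ 1 / 2 := one_div_le_one_div_of_le (by norm_num) hlog
    linarith
  have h1 := smooth_formula c hc1 x (by linarith)
  have h2 : ∑ n ∈ Finset.Icc 1 ⌊x⌋₊, aa n * ((1 - n / x : ℝ) : ℂ) = 
    ((∑ n ∈ Finset.Icc 1 ⌊x⌋₊, (ArithmeticFunction.vonMangoldt n - 1) * (1 - n / x) : ℝ) : ℂ) := by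
    push_cast; rfl
  have h3 : x ^ c = x * Real.exp 1 := by
    rw [hc, Real.rpow_add hx0, Real.rpow_one, Real.rpow_def_of_pos hx0]
    congr 2; field_simp
  rw [← Real.norm_eq_abs, ← Complex.norm_real, ← h2, h1, norm_mul, Complex.norm_real, Real.norm_eq_abs, abs_of_pos (by positivity), h3]
  calc _ ≤ x * Real.exp 1 * (C / (Real.log x) ^ A) := by
        gcongr
        exact h c hc1 hc2 _ hlp
    _ = _ := by ring

end LcmAux


namespace LcmAux
open Filter Topology MeasureTheory

noncomputable def Psi1 (x : ℝ) : ℝ := ∑ n ∈ Finset.Icc 1 ⌊x⌋₊, ArithmeticFunction.vonMangoldt n * (x - n)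

lemma sum_x_sub (x : ℝ) (hx : 1 ≤ x) : |∑ n ∈ Finset.Icc 1 ⌊x⌋₊, (x - n) - x ^ 2 / 2| ≤ x := by
  have h : ∀ m : ℕ, ∑ n ∈ Finset.Icc 1 m, (x - n) = m * x - m * (m + 1) / 2 := by
    intro m
    induction m with
    | zero => simp
    | succ k ih => rw [Finset.sum_Icc_succ_top (by omega), ih]; push_cast; ring
  rw [h]
  have h1 := Nat.floor_le (show 0 ≤ x by linarith)
  have h2 := Nat.lt_floor_add_one x
  set m : ℝ := (⌊x⌋₊ : ℝ)
  have h3 : 0 ≤ m := by positivity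
  rw [abs_le]
  constructor <;> nlinarith [mul_nonneg (sub_nonneg.2 h1) (sub_nonneg.2 h2.le)]

lemma Psi1_bound (B : ℕ) : ∃ C > 0, ∀ x : ℝ, 8 ≤ x → |Psi1 x - x ^ 2 / 2| ≤ C * (x ^ 2 / (Real.log x) ^ B) := by
  obtain ⟨C, hC, h⟩ := smooth_bound B
  refine ⟨C + (Nat.factorial B), by positivity, fun x hx => ?_⟩
  have h1 := h x hx
  have hx0 : 0 < x := by linarith
  have hlog : 0 < Real.log x := Real.log_pos (by linarith)
  have h2 : Psi1 x = x * (∑ n ∈ Finset.Icc 1 ⌊x⌋₊, (ArithmeticFunction.vonMangoldt n - 1) * (1 - n / x)) + ∑ n ∈ Finset.Icc 1 ⌊x⌋₊, (x - n) := by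
    rw [Psi1, Finset.mul_sum, ← Finset.sum_add_distrib]
    refine Finset.sum_congr rfl fun n _ => ?_
    field_simp; ring
  have h3 := sum_x_sub x (by linarith)
  have h4 : x ≤ (Nat.factorial B) * (x ^ 2 / (Real.log x) ^ B) := by
    have := Real.pow_div_factorial_le_exp (x := Real.log x) hlog.le B
    rw [Real.exp_log hx0, div_le_iff₀ (by positivity)] at this
    rw [← mul_div_assoc, le_div_iff₀ (by positivity)]
    nlinarith
  have h5 : Psi1 x - x ^ 2 / 2 = x * (∑ n ∈ Finset.Icc 1 ⌊x⌋₊, (ArithmeticFunction.vonMangoldt n - 1) * (1 - n / x)) + (∑ n ∈ Finset.Icc 1 ⌊x⌋₊, (x - n) - x ^ 2 / 2) := by rw [h2]; ring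
  rw [h5]
  calc _ ≤ _ := abs_add_le _ _
    _ ≤ x * (C * x / (Real.log x) ^ B) + (Nat.factorial B) * (x ^ 2 / (Real.log x) ^ B) := by
        rw [abs_mul, abs_of_pos hx0]
        gcongr
        exact h3.trans h4
    _ = _ := by ring

lemma Psi1_diff {x y : ℝ} (hx : 0 ≤ x) (hxy : x ≤ y) : 
    (y - x) * Chebyshev.psi x ≤ Psi1 y - Psi1 x ∧ Psi1 y - Psi1 x ≤ (y - x) * Chebyshev.psi y := by
  have hsub : Finset.Icc 1 ⌊x⌋₊ ⊆ Finset.Icc 1 ⌊y⌋₊ := Finset.Icc_subset_Icc le_rfl (Nat.floor_mono hxy)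
  have hpsi : ∀ z : ℝ, Chebyshev.psi z = ∑ n ∈ Finset.Icc 1 ⌊z⌋₊, ArithmeticFunction.vonMangoldt n := by
    intro z; rw [Chebyshev.psi]; rfl
  have e1 : Psi1 y - Psi1 x = (y - x) * ∑ n ∈ Finset.Icc 1 ⌊x⌋₊, ArithmeticFunction.vonMangoldt n + 
      ∑ n ∈ Finset.Icc 1 ⌊y⌋₊ \ Finset.Icc 1 ⌊x⌋₊, ArithmeticFunction.vonMangoldt n * (y - n) := by
    rw [Psi1, Psi1, ← Finset.sum_sdiff hsub, Finset.mul_sum, add_sub_assoc, ← Finset.sum_sub_distrib, add_comm]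
    congr 1
    exact Finset.sum_congr rfl fun n _ => by ring
  rw [e1, hpsi, hpsi]
  constructor
  · have : 0 ≤ ∑ n ∈ Finset.Icc 1 ⌊y⌋₊ \ Finset.Icc 1 ⌊x⌋₊, ArithmeticFunction.vonMangoldt n * (y - n) := by
      refine Finset.sum_nonneg fun n hn => mul_nonneg ArithmeticFunction.vonMangoldt_nonneg ?_
      have := (Nat.le_floor_iff (hx.trans hxy)).1 (Finset.mem_Icc.1 (Finset.mem_sdiff.1 hn).1).2
      linarith
    linarith
  · rw [← Finset.sum_sdiff hsub, mul_add, add_comm]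
    refine add_le_add ?_ le_rfl
    rw [Finset.mul_sum]
    refine Finset.sum_le_sum fun n hn => ?_
    rw [mul_comm]
    refine mul_le_mul_of_nonneg_right ?_ ArithmeticFunction.vonMangoldt_nonneg
    rw [Finset.mem_sdiff, Finset.mem_Icc, Finset.mem_Icc] at hn
    have : x < n := by
      by_contra! hc
      exact hn.2 ⟨hn.1.1, (Nat.le_floor_iff hx).2 hc⟩
    linarith

lemma psi_bound (A : ℕ) (hA : 1 ≤ A) : ∃ C > 0, ∀ x : ℝ, 16 ≤ x → |Chebyshev.psi x - x| ≤ C * (x / (Real.log x) ^ A) := by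
  obtain ⟨C, hC, h⟩ := Psi1_bound (2 * A)
  refine ⟨1 + 5 * C + C * (1 + 2 ^ (2 * A)), by positivity, fun x hx => ?_⟩
  have hx0 : 0 < x := by linarith
  have hL : 2 ≤ Real.log x := by
    rw [Real.le_log_iff_exp_le hx0]
    have h1 := Real.exp_one_lt_d9
    have h2 : Real.exp 2 = Real.exp 1 * Real.exp 1 := by rw [← Real.exp_add]; norm_num
    have h3 := Real.exp_pos 1
    rw [h2]; nlinarith
  set L := Real.log x with hLd
  have hL0 : 0 < L := by linarith
  have hLA : 2 ≤ L ^ A := hL.trans (le_self_pow₀ (by linarith) (by omega))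
  have hLA0 : 0 < L ^ A := by linarith
  set q := x / L ^ A with hq
  have hq0 : 0 < q := by positivity
  have hq2 : q ≤ x / 2 := by rw [hq]; gcongr
  have hqq : x ^ 2 / L ^ (2 * A) = q ^ 2 := by rw [hq, div_pow, ← pow_mul, mul_comm 2 A]
  have hx1 := abs_le.1 (h x (by linarith))
  rw [← hLd, hqq] at hx1
  have hx2 : |Psi1 (x + q) - (x + q) ^ 2 / 2| ≤ C * (4 * q ^ 2) := by
    refine (h (x + q) (by linarith)).trans ?_
    gcongr
    calc (x + q) ^ 2 / Real.log (x + q) ^ (2 * A) ≤ (2 * x) ^ 2 / L ^ (2 * A) := by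
          gcongr
          · linarith
          · rw [hLd]; exact Real.log_le_log hx0 (by linarith)
      _ = 4 * q ^ 2 := by rw [← hqq]; ring
  have hx3 : |Psi1 (x - q) - (x - q) ^ 2 / 2| ≤ C * (2 ^ (2 * A) * q ^ 2) := by
    refine (h (x - q) (by linarith)).trans ?_
    gcongr
    have hlog : L / 2 ≤ Real.log (x - q) := by
      have h1 : L / 2 = Real.log (Real.sqrt x) := by rw [Real.log_sqrt hx0.le]
      rw [h1]
      apply Real.log_le_log (by positivity)
      have : Real.sqrt x ≤ x / 2 := by
        rw [Real.sqrt_le_left (by linarith)]; nlinarith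
      linarith
    calc (x - q) ^ 2 / Real.log (x - q) ^ (2 * A) ≤ x ^ 2 / (L / 2) ^ (2 * A) := by
          gcongr
          · linarith
          · linarith
      _ = 2 ^ (2 * A) * q ^ 2 := by rw [← hqq, div_pow]; field_simp
  have hx2 := abs_le.1 hx2
  have hx3 := abs_le.1 hx3
  have d1 := (Psi1_diff hx0.le (show x ≤ x + q by linarith)).1
  have d2 := (Psi1_diff (show 0 ≤ x - q by linarith) (show x - q ≤ x by linarith)).2
  rw [add_sub_cancel_left] at d1
  rw [sub_sub_cancel] at d2
  set T : ℝ := 2 ^ (2 * A)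
  have hT : 0 < T := by positivity
  rw [abs_le]
  constructor
  · have : q * (-((1 + 5 * C + C * (1 + T)) * q)) ≤ q * (Chebyshev.psi x - x) := by
      nlinarith [mul_pos hC (sq_pos_of_pos hq0), mul_pos hC (mul_pos hT (sq_pos_of_pos hq0)), sq_pos_of_pos hq0]
    exact le_of_mul_le_mul_left this hq0
  · have : q * (Chebyshev.psi x - x) ≤ q * ((1 + 5 * C + C * (1 + T)) * q) := by
      nlinarith [mul_pos hC (sq_pos_of_pos hq0), mul_pos hC (mul_pos hT (sq_pos_of_pos hq0)), sq_pos_of_pos hq0]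
    exact le_of_mul_le_mul_left this hq0

end LcmAux


namespace LcmAux
open Filter Topology MeasureTheory

lemma log_pow_le (ε : ℝ) (hε : 0 < ε) (B : ℕ) : ∃ C > 0, ∀ y : ℝ, 1 ≤ y → (Real.log y) ^ B ≤ C * y ^ ε := by
  refine ⟨Nat.factorial B / ε ^ B, by positivity, fun y hy => ?_⟩
  have hl := Real.log_nonneg hy
  have h := Real.pow_div_factorial_le_exp (x := ε * Real.log y) (by positivity) B
  rw [div_le_iff₀ (by positivity), mul_pow] at h
  rw [div_mul_eq_mul_div, le_div_iff₀ (by positivity), Real.rpow_def_of_pos (by linarith), mul_comm (Real.log y) ε]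
  linarith

lemma log_pos2 {y : ℝ} (hy : 2 ≤ y) : 0 < Real.log y := Real.log_pos (by linarith)

lemma sqrt_le_div_log (B : ℕ) : ∃ C > 0, ∀ y : ℝ, 2 ≤ y → Real.sqrt y ≤ C * (y / (Real.log y) ^ B) := by
  obtain ⟨C, hC, h⟩ := log_pow_le (1/2) (by norm_num) B
  refine ⟨C, hC, fun y hy => ?_⟩
  have h1 := h y (by linarith)
  have hl := log_pos2 hy
  rw [← Real.sqrt_eq_rpow] at h1
  rw [← mul_div_assoc, le_div_iff₀ (by positivity)]
  calc _ ≤ Real.sqrt y * (C * Real.sqrt y) := by gcongr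
    _ = C * (Real.sqrt y * Real.sqrt y) := by ring
    _ = _ := by rw [Real.mul_self_sqrt (by linarith)]

lemma theta_bound (A : ℕ) (hA : 1 ≤ A) : ∃ C > 0, ∀ y : ℝ, 2 ≤ y → |Chebyshev.theta y - y| ≤ C * (y / (Real.log y) ^ A) := by
  obtain ⟨C, hC, h⟩ := psi_bound A hA
  obtain ⟨C', hC', h'⟩ := sqrt_le_div_log (A + 1)
  have h16 : 0 < Real.log 16 := Real.log_pos (by norm_num)
  refine ⟨C + 2 * C' + 2 * (Real.log 16) ^ A, by positivity, fun y hy => ?_⟩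
  have hl := log_pos2 hy
  have hq : 0 < y / (Real.log y) ^ A := by positivity
  rcases le_total 16 y with h1 | h1
  · have e1 := h y h1
    have e2 := Chebyshev.abs_psi_sub_theta_le_sqrt_mul_log (show 1 ≤ y by linarith)
    have e3 : 2 * Real.sqrt y * Real.log y ≤ 2 * C' * (y / (Real.log y) ^ A) := by
      calc _ ≤ 2 * (C' * (y / (Real.log y) ^ (A + 1))) * Real.log y := by gcongr; exact h' y hy
        _ = _ := by field_simp; ring
    have e4 : |Chebyshev.theta y - y| ≤ |Chebyshev.psi y - y| + |Chebyshev.psi y - Chebyshev.theta y| := by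
      have := abs_sub (Chebyshev.psi y - y) (Chebyshev.psi y - Chebyshev.theta y)
      rwa [sub_sub_sub_cancel_left] at this
    have : 0 ≤ 2 * (Real.log 16) ^ A * (y / (Real.log y) ^ A) := by positivity
    linarith
  · have e1 := Chebyshev.theta_nonneg y
    have e2 := Chebyshev.theta_le_log4_mul_x (show 0 ≤ y by linarith)
    have e3 : Real.log 4 ≤ 2 := by
      have : Real.log 4 = 2 * Real.log 2 := by rw [show (4 : ℝ) = 2 ^ 2 by norm_num, Real.log_pow]; norm_num
      have := Real.log_two_lt_d9
      linarith
    have e4 : |Chebyshev.theta y - y| ≤ 2 * y := by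
      rw [abs_le]; constructor <;> nlinarith
    have e5 : 2 * y ≤ 2 * (Real.log 16) ^ A * (y / (Real.log y) ^ A) := by
      have : (Real.log y) ^ A ≤ (Real.log 16) ^ A := by
        gcongr
      calc 2 * y = 2 * (Real.log y) ^ A * (y / (Real.log y) ^ A) := by field_simp
        _ ≤ _ := by gcongr
    have : 0 ≤ (C + 2 * C') * (y / (Real.log y) ^ A) := by positivity
    linarith

lemma log_contOn (n : ℕ) : ContinuousOn (fun t : ℝ => 1 / (Real.log t) ^ n) (Set.Ioi 1) := by
  intro t ht
  have ht : 1 < t := ht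
  apply ContinuousAt.continuousWithinAt
  have h1 : Real.log t ≠ 0 := (Real.log_pos ht).ne'
  have h0 : t ≠ 0 := by linarith
  fun_prop (disch := first | assumption | positivity)

lemma log_ii (n : ℕ) {a b : ℝ} (ha : 1 < a) (hb : 1 < b) : IntervalIntegrable (fun t : ℝ => 1 / (Real.log t) ^ n) volume a b := by
  apply ContinuousOn.intervalIntegrable
  refine (log_contOn n).mono fun t ht => ?_
  rw [Set.mem_uIcc] at ht
  rw [Set.mem_Ioi]
  rcases ht with ht | ht <;> linarith [ht.1]

lemma int_log_le (n : ℕ) {a b : ℝ} (ha : 1 < a) (hab : a ≤ b) : ∫ t in a..b, 1 / (Real.log t) ^ n ≤ (b - a) * (1 / (Real.log a) ^ n) := by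
  have : ∫ t in a..b, 1 / (Real.log t) ^ n ≤ ∫ t in a..b, 1 / (Real.log a) ^ n := by
    apply intervalIntegral.integral_mono_on hab (log_ii n ha (by linarith)) (by simp)
    intro t ht
    have := Real.log_pos ha
    gcongr
    exact ht.1
  refine this.trans ?_
  rw [intervalIntegral.integral_const, smul_eq_mul]

lemma int_log_bound (n : ℕ) : ∃ C > 0, ∀ y : ℝ, 2 ≤ y → ∫ t in (2:ℝ)..y, 1 / (Real.log t) ^ n ≤ C * (y / (Real.log y) ^ n) := by
  obtain ⟨C, hC, h⟩ := sqrt_le_div_log n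
  have h2 : 0 < Real.log 2 := Real.log_pos (by norm_num)
  refine ⟨C / (Real.log 2) ^ n + 2 ^ n, by positivity, fun y hy => ?_⟩
  have hl := log_pos2 hy
  have hq : 0 < y / (Real.log y) ^ n := by positivity
  rcases le_total 4 y with h1 | h1
  · have hs : 2 ≤ Real.sqrt y := by
      rw [Real.le_sqrt (by norm_num) (by linarith)]; linarith
    have hsy : Real.sqrt y ≤ y := by
      rw [Real.sqrt_le_left (by linarith)]; nlinarith
    rw [← intervalIntegral.integral_add_adjacent_intervals (log_ii n (by norm_num) (show 1 < Real.sqrt y by linarith)) (log_ii n (by linarith) (by linarith))]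
    have i1 := int_log_le n (show (1:ℝ) < 2 by norm_num) hs
    have i2 := int_log_le n (show (1:ℝ) < Real.sqrt y by linarith) hsy
    rw [Real.log_sqrt (by linarith)] at i2
    have i3 : (Real.sqrt y - 2) * (1 / (Real.log 2) ^ n) ≤ C / (Real.log 2) ^ n * (y / (Real.log y) ^ n) := by
      calc _ ≤ (C * (y / (Real.log y) ^ n)) * (1 / (Real.log 2) ^ n) := by gcongr; linarith [h y hy]
        _ = _ := by ring
    have i4 : (y - Real.sqrt y) * (1 / (Real.log y / 2) ^ n) ≤ 2 ^ n * (y / (Real.log y) ^ n) := by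
      calc _ ≤ y * (1 / (Real.log y / 2) ^ n) := by gcongr; linarith [Real.sqrt_nonneg y]
        _ = _ := by rw [div_pow]; field_simp
    linarith
  · have i1 := int_log_le n (show (1:ℝ) < 2 by norm_num) hy
    have i4 : (y - 2) * (1 / (Real.log 2) ^ n) ≤ 2 ^ n * (y / (Real.log y) ^ n) := by
      have : Real.log y ≤ 2 * Real.log 2 := by
        rw [← Real.log_rpow (by norm_num)]
        apply Real.log_le_log (by linarith); norm_num; linarith
      calc _ ≤ y * (1 / (Real.log y / 2) ^ n) := by gcongr <;> linarith
        _ = _ := by rw [div_pow]; field_simp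
    have : 0 ≤ C / (Real.log 2) ^ n * (y / (Real.log y) ^ n) := by positivity
    linarith

noncomputable def li (y : ℝ) : ℝ := ∫ t in (2:ℝ)..y, 1 / Real.log t

lemma li_parts {y : ℝ} (hy : 2 ≤ y) : y / Real.log y - 2 / Real.log 2 = li y - ∫ t in (2:ℝ)..y, 1 / (Real.log t) ^ 2 := by
  have i1 := log_ii 1 (show (1:ℝ) < 2 by norm_num) (show 1 < y by linarith)
  have i2 := log_ii 2 (show (1:ℝ) < 2 by norm_num) (show 1 < y by linarith)
  simp only [pow_one] at i1
  rw [li, ← intervalIntegral.integral_sub i1 i2]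
  symm
  refine intervalIntegral.integral_eq_sub_of_hasDerivAt (f := fun t => t / Real.log t) ?_ (i1.sub i2)
  intro t ht
  rw [Set.uIcc_of_le hy] at ht
  have h0 : t ≠ 0 := by linarith [ht.1]
  have hl : Real.log t ≠ 0 := (log_pos2 ht.1).ne'
  have hd := (hasDerivAt_id t).div (Real.hasDerivAt_log h0) hl
  have e : (1 * Real.log t - id t * t⁻¹) / Real.log t ^ 2 = 1 / Real.log t - 1 / Real.log t ^ 2 := by
    rw [id_eq, mul_inv_cancel₀ h0]; field_simp
  rw [e] at hd
  exact hd

noncomputable def RR (y : ℝ) : ℝ := (Nat.primeCounting ⌊y⌋₊ : ℝ) - li y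

lemma RR_eq {y : ℝ} (hy : 2 ≤ y) : RR y = (Chebyshev.theta y - y) / Real.log y + 
    (∫ t in (2:ℝ)..y, (Chebyshev.theta t - t) / (t * Real.log t ^ 2)) + 2 / Real.log 2 := by
  have h1 := Chebyshev.primeCounting_eq_theta_div_log_add_integral hy
  have h2 := li_parts hy
  have h3 : ∫ t in (2:ℝ)..y, (Chebyshev.theta t - t) / (t * Real.log t ^ 2) = 
    (∫ t in (2:ℝ)..y, Chebyshev.theta t / (t * Real.log t ^ 2)) - ∫ t in (2:ℝ)..y, 1 / (Real.log t) ^ 2 := by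
    rw [← intervalIntegral.integral_sub]
    · apply intervalIntegral.integral_congr
      intro t ht
      rw [Set.uIcc_of_le hy] at ht
      have h0 : t ≠ 0 := by linarith [ht.1]
      have hl : Real.log t ≠ 0 := (log_pos2 ht.1).ne'
      simp only
      field_simp
    · rw [intervalIntegrable_iff_integrableOn_Icc_of_le hy]
      exact Chebyshev.integrableOn_theta_div_id_mul_log_sq y
    · exact log_ii 2 (by norm_num) (by linarith)
  rw [RR, h1, h3, sub_div]
  linarith

lemma RR_bound (A : ℕ) : ∃ C > 0, ∀ y : ℝ, 2 ≤ y → |RR y| ≤ C * (y / (Real.log y) ^ A) := by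
  obtain ⟨C, hC, h⟩ := theta_bound (A + 1) (by omega)
  obtain ⟨D, hD, hd⟩ := int_log_bound (A + 3)
  obtain ⟨S, hS, hs⟩ := sqrt_le_div_log A
  have h2 : 0 < Real.log 2 := Real.log_pos (by norm_num)
  refine ⟨C / (Real.log 2) ^ 2 + C * D / (Real.log 2) ^ 3 + 2 / Real.log 2 * S, by positivity, fun y hy => ?_⟩
  have hl := log_pos2 hy
  have hl2 : Real.log 2 ≤ Real.log y := Real.log_le_log (by norm_num) hy
  rw [RR_eq hy]
  have b1 : |(Chebyshev.theta y - y) / Real.log y| ≤ C / (Real.log 2) ^ 2 * (y / (Real.log y) ^ A) := by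
    rw [abs_div, abs_of_pos hl]
    calc _ ≤ C * (y / (Real.log y) ^ (A + 1)) / Real.log y := by gcongr; exact h y hy
      _ = C / (Real.log y) ^ 2 * (y / (Real.log y) ^ A) := by field_simp; ring
      _ ≤ _ := by gcongr
  have b2 : |∫ t in (2:ℝ)..y, (Chebyshev.theta t - t) / (t * Real.log t ^ 2)| ≤ C * D / (Real.log 2) ^ 3 * (y / (Real.log y) ^ A) := by
    rw [← Real.norm_eq_abs]
    calc _ ≤ ∫ t in (2:ℝ)..y, C * (1 / (Real.log t) ^ (A + 3)) := by
          apply intervalIntegral.norm_integral_le_of_norm_le hy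
          · refine Eventually.of_forall fun t ht => ?_
            have h0 : 0 < t := by linarith [ht.1]
            have hl := log_pos2 ht.1.le
            rw [norm_div, Real.norm_eq_abs, Real.norm_eq_abs, abs_of_pos (show 0 < t * Real.log t ^ 2 by positivity)]
            calc _ ≤ C * (t / (Real.log t) ^ (A + 1)) / (t * Real.log t ^ 2) := by gcongr; exact h t ht.1.le
              _ = _ := by field_simp; ring
          · exact (log_ii _ (by norm_num) (by linarith)).const_mul C
      _ ≤ C * (D * (y / (Real.log y) ^ (A + 3))) := by
          rw [intervalIntegral.integral_const_mul]
          gcongr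
          exact hd y hy
      _ = C * D / (Real.log y) ^ 3 * (y / (Real.log y) ^ A) := by field_simp; ring
      _ ≤ _ := by gcongr
  have b3 : |2 / Real.log 2| ≤ 2 / Real.log 2 * S * (y / (Real.log y) ^ A) := by
    rw [abs_of_pos (by positivity), mul_assoc]
    apply le_mul_of_one_le_right (by positivity)
    refine le_trans ?_ (hs y hy)
    rw [Real.one_le_sqrt]; linarith
  refine (abs_add_le _ _).trans ?_
  refine (add_le_add (abs_add_le _ _) le_rfl).trans ?_
  refine (add_le_add (add_le_add b1 b2) b3).trans ?_
  apply le_of_eq; ring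

end LcmAux


namespace LcmAux
open Filter Topology MeasureTheory

noncomputable def pr (y : ℝ) : Finset ℕ := (Finset.Icc 1 ⌊y⌋₊).filter Nat.Prime

lemma mem_pr {y : ℝ} {p : ℕ} : p ∈ pr y ↔ p.Prime ∧ (p : ℝ) ≤ y := by
  rw [pr, Finset.mem_filter, Finset.mem_Icc]
  constructor
  · rintro ⟨⟨h1, h2⟩, h3⟩
    exact ⟨h3, (Nat.le_floor_iff' (by omega)).1 h2⟩
  · rintro ⟨h1, h2⟩
    exact ⟨⟨h1.pos, Nat.le_floor h2⟩, h1⟩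

noncomputable def wt (t : ℝ) : ℝ := (1 + Real.log t) / (t ^ 2 * Real.log t ^ 2)

lemma wt_cont : ContinuousOn wt (Set.Ioi 1) := by
  intro t ht
  have ht : 1 < t := ht
  apply ContinuousAt.continuousWithinAt
  have h1 : Real.log t ≠ 0 := (Real.log_pos ht).ne'
  have h0 : t ≠ 0 := by linarith
  have h2 : t ^ 2 * Real.log t ^ 2 ≠ 0 := by positivity
  unfold wt
  fun_prop (disch := assumption)

lemma wt_deriv {t : ℝ} (ht : 1 < t) : HasDerivAt (fun t => (t * Real.log t)⁻¹) (- wt t) t := by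
  have h1 : Real.log t ≠ 0 := (Real.log_pos ht).ne'
  have h0 : t ≠ 0 := by linarith
  have hd := ((hasDerivAt_id t).mul (Real.hasDerivAt_log h0)).inv (mul_ne_zero h0 h1)
  refine hd.congr_deriv ?_
  simp only [id_eq, Pi.mul_apply, wt]
  field_simp
  ring

lemma theta_abel {y : ℝ} (hy : 2 ≤ y) : ∑ p ∈ pr y, (1 / p : ℝ) = 
    Chebyshev.theta y / (y * Real.log y) + ∫ t in Set.Ioc 2 y, wt t * Chebyshev.theta t := by
  let a : ℕ → ℝ := fun n => if n.Prime then Real.log n else 0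
  have hth : ∀ t : ℝ, ∑ k ∈ Finset.Icc 0 ⌊t⌋₊, a k = Chebyshev.theta t := by
    intro t
    rw [Chebyshev.theta_eq_sum_Icc, Finset.sum_filter]
  have hd : ∀ t ∈ Set.Icc 2 y, DifferentiableAt ℝ (fun t : ℝ => (t * Real.log t)⁻¹) t := 
    fun t ht => (wt_deriv (by linarith [ht.1])).differentiableAt
  have hdd : ∀ t ∈ Set.Icc 2 y, deriv (fun t : ℝ => (t * Real.log t)⁻¹) t = - wt t := 
    fun t ht => (wt_deriv (by linarith [ht.1])).deriv
  have h := sum_mul_eq_sub_integral_mul₁ a (f := fun t : ℝ => (t * Real.log t)⁻¹) (by simp [a]) (by simp [a, Nat.not_prime_one]) y hd ?_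
  · have e1 : ∑ p ∈ pr y, (1 / p : ℝ) = ∑ k ∈ Finset.Icc 0 ⌊y⌋₊, ((k : ℝ) * Real.log k)⁻¹ * a k := by
      rw [pr, Finset.sum_filter]
      rw [show Finset.Icc 0 ⌊y⌋₊ = insert 0 (Finset.Icc 1 ⌊y⌋₊) by ext; simp; omega, Finset.sum_insert (by simp)]
      simp only [CharP.cast_eq_zero, zero_mul, inv_zero, zero_add]
      refine Finset.sum_congr rfl fun n hn => ?_
      simp only [a]
      split_ifs with hp
      · have : Real.log n ≠ 0 := (Real.log_pos (by exact_mod_cast hp.one_lt)).ne'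
        have : (n : ℝ) ≠ 0 := by exact_mod_cast hp.ne_zero
        field_simp
      · simp
    rw [e1, h, hth]
    simp_rw [hth]
    have e2 : ∫ t in Set.Ioc 2 y, deriv (fun t : ℝ => (t * Real.log t)⁻¹) t * Chebyshev.theta t = - ∫ t in Set.Ioc 2 y, wt t * Chebyshev.theta t := by
      rw [← integral_neg]
      apply setIntegral_congr_fun measurableSet_Ioc
      intro t ht
      simp only
      rw [hdd t ⟨ht.1.le, ht.2⟩]; ring
    rw [e2]; ring
  · refine (ContinuousOn.integrableOn_Icc ?_ : IntegrableOn (fun t => - wt t) _ _).congr_fun (fun t ht => (hdd t ht).symm) measurableSet_Icc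
    exact (wt_cont.mono fun t ht => by rw [Set.mem_Ioi]; linarith [ht.1]).neg

lemma tail_deriv (n : ℕ) (hn : 1 ≤ n) {t : ℝ} (ht : 1 < t) : 
    HasDerivAt (fun t => - (1 / (n * Real.log t ^ n))) (1 / (t * Real.log t ^ (n + 1))) t := by
  have h1 : Real.log t ≠ 0 := (Real.log_pos ht).ne'
  have h0 : t ≠ 0 := by linarith
  have hn0 : (n : ℝ) ≠ 0 := by positivity
  have hd := ((((Real.hasDerivAt_log h0).pow n).const_mul (n : ℝ)).inv (mul_ne_zero hn0 (pow_ne_zero n h1))).neg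
  simp only [one_div]
  refine hd.congr_deriv ?_
  obtain ⟨m, rfl⟩ : ∃ m, n = m + 1 := ⟨n - 1, by omega⟩
  simp only [Nat.add_sub_cancel, Pi.pow_apply]
  field_simp
  ring

lemma tail_lim (n : ℕ) (hn : 1 ≤ n) : Tendsto (fun t => - (1 / ((n:ℝ) * Real.log t ^ n))) atTop (𝓝 0) := by
  rw [← neg_zero]
  apply Tendsto.neg
  simp only [one_div]
  apply Tendsto.inv_tendsto_atTop
  apply Tendsto.const_mul_atTop (by positivity)
  exact (tendsto_pow_atTop (by omega)).comp Real.tendsto_log_atTop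

lemma tail_int (n : ℕ) (hn : 1 ≤ n) {y : ℝ} (hy : 2 ≤ y) : 
    IntegrableOn (fun t : ℝ => 1 / (t * Real.log t ^ (n + 1))) (Set.Ioi y) ∧
    ∫ t in Set.Ioi y, 1 / (t * Real.log t ^ (n + 1)) = 1 / (n * Real.log y ^ n) := by
  have hd : ∀ t ∈ Set.Ici y, HasDerivAt (fun t => - (1 / (n * Real.log t ^ n))) (1 / (t * Real.log t ^ (n + 1))) t :=
    fun t ht => tail_deriv n hn (by linarith [show y ≤ t from ht])
  have hnn : ∀ t ∈ Set.Ioi y, 0 ≤ 1 / (t * Real.log t ^ (n + 1)) := by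
    intro t ht
    have : y < t := ht
    have := Real.log_pos (show 1 < t by linarith)
    have : 0 < t := by linarith
    positivity
  have h1 := integrableOn_Ioi_deriv_of_nonneg' hd hnn (tail_lim n hn)
  refine ⟨h1, ?_⟩
  rw [integral_Ioi_of_hasDerivAt_of_tendsto' hd h1 (tail_lim n hn)]
  ring

noncomputable def EE (t : ℝ) : ℝ := Chebyshev.theta t - t

lemma EE_wt (A : ℕ) (hA : 1 ≤ A) : ∃ C > 0, ∀ t : ℝ, 2 ≤ t → ‖wt t * EE t‖ ≤ C * (1 / (t * Real.log t ^ (A + 1))) := by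
  obtain ⟨C, hC, h⟩ := theta_bound A hA
  have h2 : 0 < Real.log 2 := Real.log_pos (by norm_num)
  refine ⟨C * (1 / Real.log 2 + 1), by positivity, fun t ht => ?_⟩
  have hl := log_pos2 ht
  have ht0 : 0 < t := by linarith
  have hl2 : Real.log 2 ≤ Real.log t := Real.log_le_log (by norm_num) ht
  have hw : 0 ≤ wt t := by unfold wt; positivity
  rw [norm_mul, Real.norm_eq_abs, Real.norm_eq_abs, abs_of_nonneg hw]
  calc _ ≤ wt t * (C * (t / Real.log t ^ A)) := by gcongr; exact h t ht
    _ = C * (1 / Real.log t + 1) * (1 / (t * Real.log t ^ (A + 1))) := by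
        unfold wt; field_simp; ring
    _ ≤ _ := by gcongr

lemma EE_meas : Measurable EE := Chebyshev.theta_mono.measurable.sub measurable_id

lemma wtEE_int {y : ℝ} (hy : 2 ≤ y) : IntegrableOn (fun t => wt t * EE t) (Set.Ioi y) := by
  obtain ⟨C, hC, h⟩ := EE_wt 1 le_rfl
  refine Integrable.mono' ((tail_int 1 le_rfl hy).1.const_mul C) ?_ ?_
  · refine AEStronglyMeasurable.mul ?_ EE_meas.aestronglyMeasurable
    exact (wt_cont.mono fun t ht => by rw [Set.mem_Ioi] at *; linarith).aestronglyMeasurable measurableSet_Ioi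
  · filter_upwards [ae_restrict_mem measurableSet_Ioi] with t ht
    exact h t (by linarith [show y < t from ht])

noncomputable def MM : ℝ := 1 / Real.log 2 - Real.log (Real.log 2) + ∫ t in Set.Ioi 2, wt t * EE t

lemma wt_id_int {y : ℝ} (hy : 2 ≤ y) : ∫ t in Set.Ioc 2 y, wt t * t = 
    (Real.log (Real.log y) - 1 / Real.log y) - (Real.log (Real.log 2) - 1 / Real.log 2) := by
  rw [← intervalIntegral.integral_of_le hy]
  refine intervalIntegral.integral_eq_sub_of_hasDerivAt (f := fun t => Real.log (Real.log t) - 1 / Real.log t) ?_ ?_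
  · intro t ht
    rw [Set.uIcc_of_le hy] at ht
    have h0 : t ≠ 0 := by linarith [ht.1]
    have hl : Real.log t ≠ 0 := (log_pos2 ht.1).ne'
    have d1 := (Real.hasDerivAt_log h0).log hl
    have d2 := (Real.hasDerivAt_log h0).inv hl
    have := d1.sub d2
    simp only [one_div]
    refine this.congr_deriv ?_
    unfold wt; field_simp; ring
  · apply ContinuousOn.intervalIntegrable
    rw [Set.uIcc_of_le hy]
    exact (wt_cont.mono fun t ht => by rw [Set.mem_Ioi]; linarith [ht.1]).mul continuousOn_id

lemma mertens (A : ℕ) (hA : 1 ≤ A) : ∃ C > 0, ∀ y : ℝ, 2 ≤ y → 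
    |∑ p ∈ pr y, (1 / p : ℝ) - Real.log (Real.log y) - MM| ≤ C / (Real.log y) ^ A := by
  obtain ⟨C, hC, h⟩ := EE_wt A hA
  obtain ⟨D, hD, hd⟩ := theta_bound A hA
  have h2 : 0 < Real.log 2 := Real.log_pos (by norm_num)
  refine ⟨D / Real.log 2 + C, by positivity, fun y hy => ?_⟩
  have hl := log_pos2 hy
  have hy0 : 0 < y := by linarith
  have hl2 : Real.log 2 ≤ Real.log y := Real.log_le_log (by norm_num) hy
  have e1 : ∫ t in Set.Ioc 2 y, wt t * Chebyshev.theta t = (∫ t in Set.Ioc 2 y, wt t * t) + ∫ t in Set.Ioc 2 y, wt t * EE t := by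
    rw [← integral_add]
    · congr 1; funext t; unfold EE; ring
    · apply IntegrableOn.mono_set (t := Set.Icc 2 y) _ Set.Ioc_subset_Icc_self
      apply ContinuousOn.integrableOn_Icc
      exact (wt_cont.mono fun t ht => by rw [Set.mem_Ioi]; linarith [ht.1]).mul continuousOn_id
    · exact (wtEE_int le_rfl).mono_set Set.Ioc_subset_Ioi_self
  have e2 : ∫ t in Set.Ioi 2, wt t * EE t = (∫ t in Set.Ioc 2 y, wt t * EE t) + ∫ t in Set.Ioi y, wt t * EE t := by
    rw [← setIntegral_union (Set.Ioc_disjoint_Ioi le_rfl) measurableSet_Ioi ((wtEE_int le_rfl).mono_set Set.Ioc_subset_Ioi_self) (wtEE_int hy), Set.Ioc_union_Ioi_eq_Ioi hy]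
  have e3 : ∑ p ∈ pr y, (1 / p : ℝ) - Real.log (Real.log y) - MM = EE y / (y * Real.log y) - ∫ t in Set.Ioi y, wt t * EE t := by
    rw [theta_abel hy, e1, wt_id_int hy, MM, e2, EE]
    field_simp
    ring
  have b1 : |EE y / (y * Real.log y)| ≤ D / Real.log 2 / (Real.log y) ^ A := by
    rw [abs_div, abs_of_pos (show 0 < y * Real.log y by positivity)]
    calc _ ≤ D * (y / (Real.log y) ^ A) / (y * Real.log y) := by gcongr; exact hd y hy
      _ = D / Real.log y / (Real.log y) ^ A := by field_simp
      _ ≤ _ := by gcongr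
  have b2 : |∫ t in Set.Ioi y, wt t * EE t| ≤ C / (Real.log y) ^ A := by
    rw [← Real.norm_eq_abs]
    calc _ ≤ ∫ t in Set.Ioi y, C * (1 / (t * Real.log t ^ (A + 1))) := by
          apply norm_integral_le_of_norm_le ((tail_int A hA hy).1.const_mul C)
          filter_upwards [ae_restrict_mem measurableSet_Ioi] with t ht
          exact h t (by linarith [show y < t from ht])
      _ = C / (Real.log y) ^ A * (1 / A) := by
          rw [integral_const_mul, (tail_int A hA hy).2]; field_simp
      _ ≤ _ := by
          apply mul_le_of_le_one_right (by positivity)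
          rw [div_le_one (by positivity)]; exact_mod_cast hA
  rw [e3]
  refine (abs_sub _ _).trans ((add_le_add b1 b2).trans ?_)
  rw [← add_div]

end LcmAux


namespace LcmAux
open Filter Topology MeasureTheory

lemma gamma_int_eq : ∫ t in Set.Ioi (0:ℝ), Real.log t * Real.exp (-t) = - Real.eulerMascheroniConstant := by
  have h1 := Complex.hasDerivAt_GammaIntegral (s := 1) (by simp)
  have h2 := Complex.hasDerivAt_Gamma_one
  have h3 : Complex.GammaIntegral =ᶠ[𝓝 1] Complex.Gamma := by
    have : {s : ℂ | 0 < s.re} ∈ 𝓝 (1 : ℂ) := (isOpen_lt continuous_const Complex.continuous_re).mem_nhds (by simp)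
    filter_upwards [this] with s hs
    exact (Complex.Gamma_eq_integral hs).symm
  have h4 := h1.unique (h2.congr_of_eventuallyEq h3)
  have h5 : ∫ t in Set.Ioi (0:ℝ), (t : ℂ) ^ ((1:ℂ) - 1) * (Real.log t * Real.exp (-t)) = ((∫ t in Set.Ioi (0:ℝ), Real.log t * Real.exp (-t) : ℝ) : ℂ) := by
    rw [← integral_complex_ofReal]
    congr 1
    funext t
    simp
  rw [h5] at h4
  exact_mod_cast h4

lemma gamma_int : IntegrableOn (fun t : ℝ => Real.log t * Real.exp (-t)) (Set.Ioi 0) := by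
  by_contra h
  have h1 := gamma_int_eq
  rw [integral_undef h] at h1
  have := Real.one_half_lt_eulerMascheroniConstant
  linarith

lemma log_exp_int {σ : ℝ} (hσ : 0 < σ) : IntegrableOn (fun u : ℝ => Real.log u * Real.exp (-σ * u)) (Set.Ioi 0) ∧ 
    σ * ∫ u in Set.Ioi (0:ℝ), Real.log u * Real.exp (-σ * u) = - Real.eulerMascheroniConstant - Real.log σ := by
  have e : Set.EqOn (fun u : ℝ => Real.log u * Real.exp (-σ * u)) 
    (fun u => Real.log (σ * u) * Real.exp (-(σ * u)) - Real.log σ * Real.exp (-σ * u)) (Set.Ioi 0) := by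
    intro u hu
    have hu : 0 < u := hu
    simp only
    rw [Real.log_mul hσ.ne' hu.ne', neg_mul]; ring
  have i1 : IntegrableOn (fun u => Real.log (σ * u) * Real.exp (-(σ * u))) (Set.Ioi 0) := by
    have := (integrableOn_Ioi_comp_mul_left_iff (fun t => Real.log t * Real.exp (-t)) 0 hσ).2 (by rw [mul_zero]; exact gamma_int)
    exact this
  have i2 : IntegrableOn (fun u => Real.log σ * Real.exp (-σ * u)) (Set.Ioi 0) := 
    (integrableOn_exp_mul_Ioi (show -σ < 0 by linarith) 0).const_mul _
  constructor
  · exact IntegrableOn.congr_fun (i1.sub i2) e.symm measurableSet_Ioi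
  · rw [setIntegral_congr_fun measurableSet_Ioi e, integral_sub i1 i2]
    have := integral_comp_mul_left_Ioi (fun t => Real.log t * Real.exp (-t)) 0 hσ
    rw [this, mul_zero, gamma_int_eq, integral_const_mul, integral_exp_mul_Ioi (by linarith)]
    simp only [mul_zero, Real.exp_zero, smul_eq_mul]
    field_simp

noncomputable def QQ (u : ℝ) : ℝ := ∑ p ∈ pr (Real.exp u), (1 / p : ℝ)

lemma QQ_mono : Monotone QQ := by
  intro u v huv
  apply Finset.sum_le_sum_of_subset_of_nonneg
  · intro p hp
    rw [mem_pr] at *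
    exact ⟨hp.1, hp.2.trans (Real.exp_le_exp.2 huv)⟩
  · intros; positivity

noncomputable def DD (u : ℝ) : ℝ := QQ u - Real.log u - MM

lemma DD_int : IntegrableOn DD (Set.Ioi 0) := by
  have h2 : 0 < Real.log 2 := Real.log_pos (by norm_num)
  rw [← Set.Ioc_union_Ioi_eq_Ioi h2.le, integrableOn_union]
  constructor
  · rw [← intervalIntegrable_iff_integrableOn_Ioc_of_le h2.le]
    apply IntervalIntegrable.sub (IntervalIntegrable.sub _ _) (by simp)
    · exact QQ_mono.intervalIntegrable
    · exact intervalIntegral.intervalIntegrable_log'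
  · obtain ⟨C, hC, h⟩ := mertens 2 (by norm_num)
    have := (integrableOn_Ioi_rpow_of_lt (show (-2:ℝ) < -1 by norm_num) h2).const_mul C
    refine Integrable.mono' this ?_ ?_
    · exact ((QQ_mono.measurable.sub Real.measurable_log).sub measurable_const).aestronglyMeasurable
    · filter_upwards [ae_restrict_mem measurableSet_Ioi] with u hu
      have hu : Real.log 2 < u := hu
      have := h (Real.exp u) (by rw [← Real.log_le_iff_le_exp (by norm_num)]; exact hu.le)
      rw [Real.log_exp] at this
      rw [Real.norm_eq_abs, DD, QQ]
      refine this.trans (le_of_eq ?_)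
      rw [Real.rpow_neg (by linarith)]
      norm_cast

lemma QQ_tsum (u : ℝ) : HasSum (fun p : Nat.Primes => (Set.Ici (Real.log p)).indicator (fun _ => (1 / (p:ℕ) : ℝ)) u) (QQ u) := by
  have hinj : Function.Injective (fun p : Nat.Primes => (p : ℕ)) := fun p q h => Subtype.ext h
  have : QQ u = ∑ p ∈ (pr (Real.exp u)).preimage (fun p : Nat.Primes => (p : ℕ)) hinj.injOn, 
      (Set.Ici (Real.log p)).indicator (fun _ => (1 / (p:ℕ) : ℝ)) u := by
    rw [QQ]
    have : ∀ p ∈ (pr (Real.exp u)).preimage (fun p : Nat.Primes => (p : ℕ)) hinj.injOn, 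
      (Set.Ici (Real.log p)).indicator (fun _ => (1 / (p:ℕ) : ℝ)) u = (1 / (p : ℕ) : ℝ) := by
      intro p hp
      rw [Finset.mem_preimage, mem_pr] at hp
      apply Set.indicator_of_mem
      rw [Set.mem_Ici, Real.log_le_iff_le_exp (by exact_mod_cast p.2.pos)]
      exact hp.2
    rw [Finset.sum_congr rfl this]
    rw [Finset.sum_preimage (fun p : Nat.Primes => (p : ℕ)) _ hinj.injOn (fun n : ℕ => (1 / n : ℝ))]
    intro p hp hp2
    exact absurd ⟨⟨p, (mem_pr.1 hp).1⟩, rfl⟩ hp2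
  rw [this]
  apply hasSum_sum_of_ne_finset_zero
  intro p hp
  rw [Finset.mem_preimage, mem_pr] at hp
  apply Set.indicator_of_notMem
  rw [Set.mem_Ici, Real.log_le_iff_le_exp (by exact_mod_cast p.2.pos)]
  exact fun h => hp ⟨p.2, h⟩

lemma prime_sum_eq {σ : ℝ} (hσ : 0 < σ) : ∑' p : Nat.Primes, ((p : ℕ) : ℝ) ^ (-(1 + σ)) = σ * ∫ u in Set.Ioi 0, QQ u * Real.exp (-σ * u) := by
  set F : Nat.Primes → ℝ → ℝ := fun p u => (Set.Ici (Real.log p)).indicator (fun _ => (1 / (p:ℕ) : ℝ)) u * Real.exp (-σ * u) with hF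
  have hF2 : ∀ p, F p = (Set.Ici (Real.log p)).indicator (fun u => (1 / (p:ℕ) : ℝ) * Real.exp (-σ * u)) := by
    intro p; funext u
    rw [hF]; simp only [Set.indicator_apply]; split_ifs <;> simp
  have hpos : ∀ p : Nat.Primes, (0:ℝ) < (p : ℕ) := fun p => by exact_mod_cast p.2.pos
  have hlp : ∀ p : Nat.Primes, 0 < Real.log (p : ℕ) := fun p => Real.log_pos (by exact_mod_cast p.2.one_lt)
  have hI : ∀ p, ∫ u in Set.Ioi 0, F p u = σ⁻¹ * ((p : ℕ) : ℝ) ^ (-(1 + σ)) := by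
    intro p
    rw [hF2, setIntegral_indicator measurableSet_Ici]
    rw [show Set.Ioi 0 ∩ Set.Ici (Real.log p) = Set.Ici (Real.log p) from Set.inter_eq_right.2 fun u hu => lt_of_lt_of_le (hlp p) hu]
    rw [integral_Ici_eq_integral_Ioi, integral_const_mul, integral_exp_mul_Ioi (by linarith), neg_add, Real.rpow_add (hpos p), Real.rpow_neg_one,
      Real.rpow_def_of_pos (hpos p), mul_comm (Real.log _)]
    field_simp
  have hint : ∀ p, Integrable (F p) (volume.restrict (Set.Ioi 0)) := by
    intro p
    rw [hF2]
    exact ((integrableOn_exp_mul_Ioi (show -σ < 0 by linarith) 0).const_mul _).indicator measurableSet_Ici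
  have hn : ∀ p u, ‖F p u‖ = F p u := by
    intro p u
    rw [Real.norm_eq_abs, abs_of_nonneg]
    rw [hF2]
    apply Set.indicator_nonneg
    intro u _
    have := hpos p
    positivity
  have hsm : Summable fun p : Nat.Primes => ((p : ℕ) : ℝ) ^ (-(1 + σ)) := Nat.Primes.summable_rpow.2 (by linarith)
  have h := hasSum_integral_of_summable_integral_norm hint (by simp_rw [hn, hI]; exact hsm.mul_left _)
  have hQ : ∀ u, ∑' p, F p u = QQ u * Real.exp (-σ * u) := by
    intro u
    rw [hF]; simp only
    rw [tsum_mul_right, (QQ_tsum u).tsum_eq]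
  simp_rw [hQ, hI] at h
  rw [← h.tsum_eq, tsum_mul_left]
  field_simp

lemma prime_sum_lim1 : Tendsto (fun σ : ℝ => ∑' p : Nat.Primes, ((p : ℕ) : ℝ) ^ (-(1 + σ)) + Real.log σ) (𝓝[>] 0) (𝓝 (MM - Real.eulerMascheroniConstant)) := by
  have key : ∀ σ : ℝ, 0 < σ → ∑' p : Nat.Primes, ((p : ℕ) : ℝ) ^ (-(1 + σ)) + Real.log σ = 
      σ * (∫ u in Set.Ioi 0, DD u * Real.exp (-σ * u)) + (MM - Real.eulerMascheroniConstant) := by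
    intro σ hσ
    rw [prime_sum_eq hσ]
    have i1 : IntegrableOn (fun u => DD u * Real.exp (-σ * u)) (Set.Ioi 0) := by
      refine Integrable.mul_bdd (c := 1) DD_int (by fun_prop) ?_
      filter_upwards [ae_restrict_mem measurableSet_Ioi] with u hu
      have hu : 0 < u := hu
      rw [Real.norm_eq_abs, abs_of_pos (Real.exp_pos _), Real.exp_le_one_iff]
      nlinarith
    have i2 := log_exp_int hσ
    have i3 := (integrableOn_exp_mul_Ioi (show -σ < 0 by linarith) 0).const_mul MM
    have : ∫ u in Set.Ioi 0, QQ u * Real.exp (-σ * u) = (∫ u in Set.Ioi 0, DD u * Real.exp (-σ * u)) + 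
      (∫ u in Set.Ioi 0, Real.log u * Real.exp (-σ * u)) + ∫ u in Set.Ioi 0, MM * Real.exp (-σ * u) := by
      have i12 : IntegrableOn (fun u => DD u * Real.exp (-σ * u) + Real.log u * Real.exp (-σ * u)) (Set.Ioi 0) := i1.add i2.1
      rw [← integral_add i1 i2.1, ← integral_add i12 i3]
      congr 1; funext u
      simp only [DD]; ring
    rw [this, mul_add, mul_add, i2.2, integral_const_mul, integral_exp_mul_Ioi (by linarith)]
    simp only [mul_zero, Real.exp_zero]
    field_simp
    ring
  have hz : Tendsto (fun σ : ℝ => σ * (∫ u in Set.Ioi 0, DD u * Real.exp (-σ * u)) + (MM - Real.eulerMascheroniConstant)) (𝓝[>] 0) (𝓝 (MM - Real.eulerMascheroniConstant)) := by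
    have : Tendsto (fun σ : ℝ => σ * (∫ u in Set.Ioi 0, DD u * Real.exp (-σ * u))) (𝓝[>] 0) (𝓝 0) := by
      have hb : Tendsto (fun σ : ℝ => σ * ∫ u in Set.Ioi 0, ‖DD u‖) (𝓝[>] 0) (𝓝 0) := by
        have : Tendsto (fun σ : ℝ => σ * ∫ u in Set.Ioi 0, ‖DD u‖) (𝓝 0) (𝓝 (0 * ∫ u in Set.Ioi 0, ‖DD u‖)) := 
          tendsto_id.mul_const _
        rw [zero_mul] at this
        exact this.mono_left nhdsWithin_le_nhds
      refine squeeze_zero_norm' ?_ hb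
      filter_upwards [self_mem_nhdsWithin] with σ hσ
      have hσ : 0 < σ := hσ
      rw [norm_mul, Real.norm_eq_abs, abs_of_pos hσ]
      gcongr
      apply norm_integral_le_of_norm_le DD_int.norm
      filter_upwards [ae_restrict_mem measurableSet_Ioi] with u hu
      have hu : 0 < u := hu
      rw [norm_mul]
      apply mul_le_of_le_one_right (norm_nonneg _)
      rw [Real.norm_eq_abs, abs_of_pos (Real.exp_pos _), Real.exp_le_one_iff]
      nlinarith
    simpa using this.add_const (MM - Real.eulerMascheroniConstant)
  refine hz.congr' ?_
  filter_upwards [self_mem_nhdsWithin] with σ hσ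
  exact (key σ hσ).symm

lemma log_quad {x : ℝ} (hx : 0 ≤ x) (hx2 : x ≤ 1/2) : |Real.log (1 - x) + x| ≤ 2 * x ^ 2 := by
  have h := Real.abs_log_sub_add_sum_range_le (x := x) (by rw [abs_of_nonneg hx]; linarith) 1
  simp at h
  rw [abs_of_nonneg hx] at h
  rw [add_comm]
  refine h.trans ?_
  rw [div_le_iff₀ (by linarith)]
  nlinarith [sq_nonneg x]

noncomputable def lp (s : ℝ) (p : Nat.Primes) : ℝ := Real.log (1 - ((p : ℕ) : ℝ) ^ (-s)) + ((p : ℕ) : ℝ) ^ (-s)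

lemma pow_half {s : ℝ} (hs : 1 ≤ s) (p : Nat.Primes) : 0 < ((p : ℕ) : ℝ) ^ (-s) ∧ ((p : ℕ) : ℝ) ^ (-s) ≤ 1 / (p : ℕ) ∧ (1 / (p : ℕ) : ℝ) ≤ 1/2 := by
  have h2 : (2 : ℝ) ≤ (p : ℕ) := by exact_mod_cast p.2.two_le
  refine ⟨by positivity, ?_, one_div_le_one_div_of_le (by norm_num) h2⟩
  rw [one_div, ← Real.rpow_neg_one]
  exact Real.rpow_le_rpow_of_exponent_le (by linarith) (by linarith)

lemma lp_bound {s : ℝ} (hs : 1 ≤ s) (p : Nat.Primes) : ‖lp s p‖ ≤ 2 * (((p : ℕ) : ℝ) ^ (-2 : ℝ)) := by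
  obtain ⟨h1, h2, h3⟩ := pow_half hs p
  rw [Real.norm_eq_abs, lp]
  refine (log_quad h1.le (h2.trans h3)).trans ?_
  have e : ((p : ℕ) : ℝ) ^ (-2 : ℝ) = (1 / ((p : ℕ) : ℝ)) ^ 2 := by
    rw [Real.rpow_neg (Nat.cast_nonneg _), one_div, inv_pow, Real.rpow_two]
  rw [e]
  gcongr

lemma lp_lim : Tendsto (fun s => ∑' p, lp s p) (𝓝[>] 1) (𝓝 (∑' p, lp 1 p)) := by
  apply tendsto_tsum_of_dominated_convergence (bound := fun p : Nat.Primes => 2 * (((p : ℕ) : ℝ) ^ (-2 : ℝ)))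
  · exact (Nat.Primes.summable_rpow.2 (by norm_num)).mul_left _
  · intro p
    have h2 : (2 : ℝ) ≤ (p : ℕ) := by exact_mod_cast p.2.two_le
    obtain ⟨h1, h2', h3⟩ := pow_half le_rfl p
    have c1 : ContinuousAt (fun s : ℝ => ((p : ℕ) : ℝ) ^ (-s)) 1 := by
      apply ContinuousAt.rpow continuousAt_const continuousAt_id.neg
      left; linarith
    have : ContinuousAt (fun s => lp s p) 1 := by
      unfold lp
      apply ContinuousAt.add _ c1
      apply ContinuousAt.log (continuousAt_const.sub c1)
      simp only [Pi.sub_apply]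
      linarith
    exact this.tendsto.mono_left nhdsWithin_le_nhds
  · filter_upwards [self_mem_nhdsWithin] with s hs p
    exact lp_bound (le_of_lt hs) p

lemma log_zeta {s : ℝ} (hs : 1 < s) : ∑' p : Nat.Primes, ((p : ℕ) : ℝ) ^ (-s) = Real.log (riemannZeta s).re + ∑' p, lp s p := by
  have h := riemannZeta_eulerProduct_exp_log (s := (s : ℂ)) (by simpa using hs)
  have e : ∀ p : Nat.Primes, -Complex.log (1 - ((p : ℕ) : ℂ) ^ (-(s : ℂ))) = ((-Real.log (1 - ((p : ℕ) : ℝ) ^ (-s)) : ℝ) : ℂ) := by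
    intro p
    obtain ⟨h1, h2, h3⟩ := pow_half hs.le p
    push_cast
    rw [Complex.ofReal_log (by linarith)]
    push_cast
    rw [Complex.ofReal_cpow (by positivity)]
    simp
  simp_rw [e] at h
  rw [← Complex.ofReal_tsum, ← Complex.ofReal_exp] at h
  rw [← h, Complex.ofReal_re, Real.log_exp]
  have s1 : Summable (fun p : Nat.Primes => ((p : ℕ) : ℝ) ^ (-s)) := Nat.Primes.summable_rpow.2 (by linarith)
  have s2 : Summable (lp s) := Summable.of_norm_bounded ((Nat.Primes.summable_rpow.2 (show (-2:ℝ) < -1 by norm_num)).mul_left 2) (lp_bound hs.le)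
  have s3 : Summable (fun p : Nat.Primes => -Real.log (1 - ((p : ℕ) : ℝ) ^ (-s))) := by
    refine (s1.sub s2).congr fun p => ?_
    unfold lp; ring
  rw [← s3.tsum_add s2]
  congr 1; funext p; unfold lp; ring

lemma prime_sum_lim2 : Tendsto (fun σ : ℝ => ∑' p : Nat.Primes, ((p : ℕ) : ℝ) ^ (-(1 + σ)) + Real.log σ) (𝓝[>] 0) (𝓝 (∑' p, lp 1 p)) := by
  have h1 := (Asymptotics.isLittleO_one_iff ℝ).1 log_riemannZeta_add_log_sub_isLittleO_ofReal
  have h2 := h1.add lp_lim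
  rw [zero_add] at h2
  have h3 : Tendsto (fun σ : ℝ => 1 + σ) (𝓝[>] 0) (𝓝[>] 1) := by
    apply tendsto_nhdsWithin_of_tendsto_nhds_of_eventually_within
    · have : Tendsto (fun σ : ℝ => 1 + σ) (𝓝 0) (𝓝 (1 + 0)) := tendsto_const_nhds.add tendsto_id
      rw [add_zero] at this
      exact this.mono_left nhdsWithin_le_nhds
    · filter_upwards [self_mem_nhdsWithin] with σ hσ
      have : 0 < σ := hσ
      rw [Set.mem_Ioi]; linarith
  refine (h2.comp h3).congr' ?_
  filter_upwards [self_mem_nhdsWithin] with σ hσ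
  have : 0 < σ := hσ
  rw [log_zeta (by linarith)]
  simp only [Function.comp, add_sub_cancel_left]
  ring

lemma MM_eq : MM = Real.eulerMascheroniConstant + ∑' p : Nat.Primes, (Real.log (1 - 1 / ((p : ℕ) : ℝ)) + 1 / ((p : ℕ) : ℝ)) := by
  have h := tendsto_nhds_unique prime_sum_lim1 prime_sum_lim2
  have : ∀ p, lp 1 p = Real.log (1 - 1 / ((p : ℕ) : ℝ)) + 1 / ((p : ℕ) : ℝ) := by
    intro p; unfold lp; rw [Real.rpow_neg_one, one_div]
  simp_rw [this] at h
  linarith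

lemma lp_summable : Summable fun p : Nat.Primes => (Real.log (1 - 1 / ((p : ℕ) : ℝ)) + 1 / ((p : ℕ) : ℝ)) := by
  have s2 : Summable (lp 1) := Summable.of_norm_bounded ((Nat.Primes.summable_rpow.2 (show (-2:ℝ) < -1 by norm_num)).mul_left 2) (lp_bound le_rfl)
  refine s2.congr fun p => ?_
  unfold lp; rw [Real.rpow_neg_one, one_div]

end LcmAux


namespace LcmAux
open Filter Topology MeasureTheory

noncomputable def fr (u : ℝ) : ℝ := u - (⌊u⌋₊ : ℝ)

lemma fr_meas : Measurable fr := measurable_id.sub (measurable_from_top.comp Nat.measurable_floor)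

lemma fr_bd {u : ℝ} (hu : 0 ≤ u) : 0 ≤ fr u ∧ fr u ≤ 1 := by
  unfold fr
  have h1 := Nat.floor_le hu
  have h2 := Nat.lt_floor_add_one u
  constructor <;> linarith

lemma logpow_int (j : ℕ) : IntegrableOn (fun u : ℝ => Real.log u ^ j / u ^ 2) (Set.Ioi 1) := by
  obtain ⟨C, hC, h⟩ := log_pow_le (1/2) (by norm_num) j
  refine Integrable.mono' ((integrableOn_Ioi_rpow_of_lt (show (-(3/2):ℝ) < -1 by norm_num) one_pos).const_mul C) ?_ ?_
  · exact ((Real.measurable_log.pow_const j).div (measurable_id.pow_const 2)).aestronglyMeasurable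
  · filter_upwards [ae_restrict_mem measurableSet_Ioi] with u hu
    have hu : 1 < u := hu
    have hl := Real.log_pos hu
    have hu0 : 0 < u := by linarith
    rw [Real.norm_eq_abs, abs_of_nonneg (by positivity)]
    calc _ ≤ C * u ^ (1/2 : ℝ) / u ^ 2 := by gcongr; exact h u hu.le
      _ = _ := by
        rw [mul_div_assoc, ← Real.rpow_two, ← Real.rpow_sub hu0]; norm_num

lemma frlog_int (j : ℕ) : IntegrableOn (fun u : ℝ => fr u * Real.log u ^ j / u ^ 2) (Set.Ioi 1) := by
  refine Integrable.mono' (logpow_int j) ?_ ?_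
  · exact ((fr_meas.mul (Real.measurable_log.pow_const j)).div (measurable_id.pow_const 2)).aestronglyMeasurable
  · filter_upwards [ae_restrict_mem measurableSet_Ioi] with u hu
    have hu : 1 < u := hu
    have hl := Real.log_pos hu
    have hf := fr_bd (show 0 ≤ u by linarith)
    have := hf.1
    rw [Real.norm_eq_abs, abs_of_nonneg (by positivity)]
    gcongr
    exact mul_le_of_le_one_left (by positivity) hf.2

lemma geom_id (N : ℕ) {L l : ℝ} (hL : 0 < L) (hl : l < L) : 
    1 / (L - l) - ∑ j ∈ Finset.Icc 1 N, l ^ (j - 1) / L ^ j = l ^ N / (L ^ N * (L - l)) := by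
  have h : L - l ≠ 0 := by linarith
  induction N with
  | zero => simp
  | succ n ih =>
    rw [Finset.sum_Icc_succ_top (by omega), ← sub_sub, ih, Nat.add_sub_cancel]
    field_simp
    ring

lemma frac_expand (N : ℕ) (hN : 1 ≤ N) : ∃ C > 0, ∀ x : ℝ, 16 ≤ x → 
    |(∫ u in Set.Ioc 1 (Real.sqrt x), fr u / (u ^ 2 * (Real.log x - Real.log u))) - 
      ∑ j ∈ Finset.Icc 1 N, (∫ u in Set.Ioi 1, fr u * Real.log u ^ (j - 1) / u ^ 2) / Real.log x ^ j| ≤ C / Real.log x ^ (N + 1) := by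
  set K := ∫ u in Set.Ioi (1:ℝ), Real.log u ^ N / u ^ 2 with hK
  have hK0 : 0 ≤ K := setIntegral_nonneg measurableSet_Ioi fun u hu => by
    have := Real.log_pos (show 1 < u from hu); positivity
  refine ⟨N * 2 ^ N * K + 1, by positivity, fun x hx => ?_⟩
  set L := Real.log x with hLd
  have hx0 : 0 < x := by linarith
  have hL : 0 < L := Real.log_pos (by linarith)
  set z := Real.sqrt x with hz
  have hz1 : 1 < z := by rw [hz, Real.lt_sqrt (by norm_num)]; linarith
  have hlz : Real.log z = L / 2 := by rw [hz, Real.log_sqrt hx0.le]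
  set G : ℝ → ℝ := fun u => (Set.Ioc 1 z).indicator (fun u => 1 / (L - Real.log u)) u - ∑ j ∈ Finset.Icc 1 N, Real.log u ^ (j - 1) / L ^ j with hG
  have hGb : ∀ u, 1 < u → |G u| ≤ N * 2 ^ N * (Real.log u ^ N / L ^ (N + 1)) := by
    intro u hu
    have hl := Real.log_pos hu
    have hN1 : (1 : ℝ) ≤ N := by exact_mod_cast hN
    rw [hG]
    by_cases huz : u ≤ z
    · have h1 : Real.log u ≤ L / 2 := hlz ▸ Real.log_le_log (by linarith) huz
      simp only
      rw [Set.indicator_of_mem (show u ∈ Set.Ioc 1 z from ⟨hu, huz⟩), geom_id N hL (by linarith)]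
      have h3 : 0 < L - Real.log u := by linarith
      rw [abs_of_nonneg (by positivity)]
      have h2N : (2 : ℝ) ≤ 2 ^ N := le_self_pow₀ (by norm_num) (by omega)
      calc Real.log u ^ N / (L ^ N * (L - Real.log u)) ≤ Real.log u ^ N / (L ^ N * (L / 2)) := by
            gcongr; linarith
        _ = 2 * (Real.log u ^ N / L ^ (N + 1)) := by rw [pow_succ]; field_simp
        _ ≤ _ := by gcongr; nlinarith
    · push Not at huz
      have h1 : L < 2 * Real.log u := by
        have := Real.log_lt_log (by linarith) huz
        linarith
      simp only
      rw [Set.indicator_of_notMem (fun h => absurd h.2 (not_le.2 huz)), zero_sub, abs_neg, abs_of_nonneg (by positivity)]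
      have : ∀ j ∈ Finset.Icc 1 N, Real.log u ^ (j - 1) / L ^ j ≤ 2 ^ N * (Real.log u ^ N / L ^ (N + 1)) := by
        intro j hj
        rw [Finset.mem_Icc] at hj
        rw [← mul_div_assoc, div_le_div_iff₀ (by positivity) (by positivity)]
        calc Real.log u ^ (j - 1) * L ^ (N + 1) = Real.log u ^ (j - 1) * L ^ (N + 1 - j) * L ^ j := by
              rw [mul_assoc, ← pow_add]; congr 2; omega
          _ ≤ Real.log u ^ (j - 1) * (2 * Real.log u) ^ (N + 1 - j) * L ^ j := by gcongr
          _ = 2 ^ (N + 1 - j) * (Real.log u ^ (j - 1) * Real.log u ^ (N + 1 - j)) * L ^ j := by rw [mul_pow]; ring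
          _ = 2 ^ (N + 1 - j) * Real.log u ^ N * L ^ j := by rw [← pow_add]; congr 3; omega
          _ ≤ _ := by gcongr
                      · norm_num
                      · omega
      refine (Finset.sum_le_sum this).trans (le_of_eq ?_)
      rw [Finset.sum_const, Nat.card_Icc, nsmul_eq_mul, Nat.add_sub_cancel]; ring
  have hGm : Measurable G := by
    rw [hG]
    apply Measurable.sub
    · exact Measurable.indicator (by fun_prop) measurableSet_Ioc
    · fun_prop
  have hH : IntegrableOn (fun u => fr u / u ^ 2 * G u) (Set.Ioi 1) ∧ ∀ᵐ u ∂(volume.restrict (Set.Ioi 1)), ‖fr u / u ^ 2 * G u‖ ≤ N * 2 ^ N / L ^ (N + 1) * (Real.log u ^ N / u ^ 2) := by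
    have hb : ∀ᵐ u ∂(volume.restrict (Set.Ioi 1)), ‖fr u / u ^ 2 * G u‖ ≤ N * 2 ^ N / L ^ (N + 1) * (Real.log u ^ N / u ^ 2) := by
      filter_upwards [ae_restrict_mem measurableSet_Ioi] with u hu
      have hu : 1 < u := hu
      have hf := fr_bd (show 0 ≤ u by linarith)
      have h0 : 0 ≤ fr u / u ^ 2 := div_nonneg hf.1 (by positivity)
      have hl := Real.log_pos hu
      rw [norm_mul, Real.norm_eq_abs, Real.norm_eq_abs, abs_of_nonneg h0]
      calc _ ≤ 1 / u ^ 2 * (N * 2 ^ N * (Real.log u ^ N / L ^ (N + 1))) := by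
            gcongr
            · exact hf.2
            · exact hGb u hu
        _ = _ := by ring
    refine ⟨Integrable.mono' ((logpow_int N).const_mul (N * 2 ^ N / L ^ (N + 1))) ?_ hb, hb⟩
    exact (((fr_meas.div (measurable_id.pow_const 2))).mul hGm).aestronglyMeasurable
  have hS : IntegrableOn (fun u => ∑ j ∈ Finset.Icc 1 N, (fr u * Real.log u ^ (j - 1) / u ^ 2) / L ^ j) (Set.Ioi 1) := by
    apply integrable_finsetSum
    intro j _
    exact (frlog_int (j - 1)).div_const _
  have e1 : (∫ u in Set.Ioc 1 z, fr u / (u ^ 2 * (L - Real.log u))) = ∫ u in Set.Ioi 1, (Set.Ioc 1 z).indicator (fun u => fr u / (u ^ 2 * (L - Real.log u))) u := by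
    rw [setIntegral_indicator measurableSet_Ioc, Set.inter_eq_right.2 Set.Ioc_subset_Ioi_self]
  have e2 : ∑ j ∈ Finset.Icc 1 N, (∫ u in Set.Ioi 1, fr u * Real.log u ^ (j - 1) / u ^ 2) / L ^ j = ∫ u in Set.Ioi 1, ∑ j ∈ Finset.Icc 1 N, (fr u * Real.log u ^ (j - 1) / u ^ 2) / L ^ j := by
    rw [integral_finsetSum]
    · simp_rw [integral_div]
    · intro j _
      exact (frlog_int (j - 1)).div_const _
  have e3 : ∀ u, (Set.Ioc 1 z).indicator (fun u => fr u / (u ^ 2 * (L - Real.log u))) u = fr u / u ^ 2 * G u + ∑ j ∈ Finset.Icc 1 N, (fr u * Real.log u ^ (j - 1) / u ^ 2) / L ^ j := by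
    intro u
    have : ∑ j ∈ Finset.Icc 1 N, (fr u * Real.log u ^ (j - 1) / u ^ 2) / L ^ j = fr u / u ^ 2 * ∑ j ∈ Finset.Icc 1 N, Real.log u ^ (j - 1) / L ^ j := by
      rw [Finset.mul_sum]
      refine Finset.sum_congr rfl fun j _ => by ring
    rw [this, hG]
    simp only [Set.indicator_apply]
    split_ifs
    · rw [← mul_add, sub_add_cancel, div_mul_div_comm, mul_one]
    · ring
  rw [e1, e2]
  simp_rw [e3]
  rw [integral_add hH.1 hS, add_sub_cancel_right, ← Real.norm_eq_abs]
  calc _ ≤ ∫ u in Set.Ioi 1, N * 2 ^ N / L ^ (N + 1) * (Real.log u ^ N / u ^ 2) := 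
        norm_integral_le_of_norm_le ((logpow_int N).const_mul _) hH.2
    _ = N * 2 ^ N * K / L ^ (N + 1) := by rw [integral_const_mul, hK]; ring
    _ ≤ _ := by gcongr; linarith

end LcmAux


namespace LcmAux
open Filter Topology MeasureTheory

lemma card_pr (y : ℝ) : (pr y).card = Nat.primeCounting ⌊y⌋₊ := by
  rw [← Nat.primesLE_card_eq_primeCounting]
  congr 1
  ext p
  rw [pr, Finset.mem_filter, Finset.mem_Icc, Nat.mem_primesLE]
  constructor
  · rintro ⟨⟨_, h⟩, h2⟩; exact ⟨h, h2⟩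
  · rintro ⟨h, h2⟩; exact ⟨⟨h2.pos, h⟩, h2⟩

lemma pr_mono {a b : ℝ} (h : a ≤ b) : pr a ⊆ pr b := by
  intro p hp
  rw [mem_pr] at *
  exact ⟨hp.1, hp.2.trans h⟩

lemma hyper {x : ℝ} (hx : 16 ≤ x) : ∑ p ∈ pr x, (⌊x / p⌋₊ : ℝ) = ∑ p ∈ pr √x, (⌊x / p⌋₊ : ℝ) +
    ∑ m ∈ Finset.Icc 1 ⌊√x⌋₊, (((pr (x / m)).card : ℝ) - (pr √x).card) := by
  have hx0 : 0 < x := by linarith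
  set z := √x with hz
  have hzz : z * z = x := Real.mul_self_sqrt hx0.le
  have hz0 : 0 < z := Real.sqrt_pos.2 hx0
  have hz1 : 1 ≤ z := by nlinarith
  have hzx : z ≤ x := by nlinarith
  rw [← Finset.sum_sdiff (pr_mono hzx), add_comm]
  congr 1
  have e1 : ∀ p ∈ pr x \ pr z, (⌊x / p⌋₊ : ℝ) = ∑ m ∈ Finset.Icc 1 ⌊z⌋₊, if (p : ℝ) ≤ x / m then (1:ℝ) else 0 := by
    intro p hp
    rw [Finset.mem_sdiff, mem_pr, mem_pr] at hp
    have hpz : z < p := by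
      by_contra h
      exact hp.2 ⟨hp.1.1, not_lt.1 h⟩
    have hp0 : (0:ℝ) < p := by linarith
    rw [← Finset.sum_filter, Finset.sum_const, nsmul_eq_mul, mul_one]
    norm_cast
    have : ⌊x / p⌋₊ = (Finset.Icc 1 ⌊x / p⌋₊).card := by simp
    rw [this]
    congr 1
    ext m
    rw [Finset.mem_filter, Finset.mem_Icc, Finset.mem_Icc]
    have hlt : x / p < z := by rw [div_lt_iff₀ hp0]; nlinarith
    constructor
    · rintro ⟨h1, h2⟩
      have h3 := (Nat.le_floor_iff' (by omega)).1 h2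
      have hm0 : (0:ℝ) < m := by exact_mod_cast h1
      refine ⟨⟨h1, Nat.le_floor (by linarith)⟩, ?_⟩
      rw [le_div_iff₀ hm0]; rw [le_div_iff₀ hp0] at h3; linarith
    · rintro ⟨⟨h1, h2⟩, h3⟩
      have hm0 : (0:ℝ) < m := by exact_mod_cast h1
      refine ⟨h1, Nat.le_floor ?_⟩
      rw [le_div_iff₀ hp0]; rw [le_div_iff₀ hm0] at h3; linarith
  rw [Finset.sum_congr rfl e1, Finset.sum_comm]
  refine Finset.sum_congr rfl fun m hm => ?_
  rw [Finset.mem_Icc] at hm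
  have h3 := (Nat.le_floor_iff' (by omega)).1 hm.2
  have hm0 : (0:ℝ) < m := by exact_mod_cast hm.1
  have hm1 : (1:ℝ) ≤ m := by exact_mod_cast hm.1
  have hzm : z ≤ x / m := by rw [le_div_iff₀ hm0]; nlinarith
  have hxm : x / m ≤ x := div_le_self hx0.le hm1
  rw [← Finset.sum_filter, Finset.sum_const, nsmul_eq_mul, mul_one]
  rw [eq_sub_iff_add_eq]
  norm_cast
  rw [← Finset.card_sdiff_add_card_eq_card (pr_mono hzm)]
  congr 2
  ext p
  rw [Finset.mem_filter, Finset.mem_sdiff, Finset.mem_sdiff, mem_pr, mem_pr, mem_pr]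
  constructor
  · rintro ⟨⟨h1, h2⟩, h3⟩; exact ⟨⟨h1.1, h3⟩, h2⟩
  · rintro ⟨⟨h1, h2⟩, h3⟩; exact ⟨⟨⟨h1, h2.trans hxm⟩, h3⟩, h2⟩

noncomputable def hh (x u : ℝ) : ℝ := 1 / (u ^ 2 * (Real.log x - Real.log u))

lemma hh_cont {x : ℝ} (hx : 16 ≤ x) : ContinuousOn (hh x) (Set.Icc 1 √x) := by
  intro u hu
  have hx0 : 0 < x := by linarith
  have hzz : √x * √x = x := Real.mul_self_sqrt hx0.le
  have hux : u < x := lt_of_le_of_lt hu.2 (by nlinarith [hu.1, hu.2])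
  have hu0 : 0 < u := by linarith [hu.1]
  have := Real.log_lt_log hu0 hux
  apply ContinuousAt.continuousWithinAt
  have h1 : u ≠ 0 := hu0.ne'
  have h2 : u ^ 2 * (Real.log x - Real.log u) ≠ 0 := mul_ne_zero (by positivity) (by linarith)
  unfold hh
  fun_prop (disch := assumption)

lemma li_diff {x m : ℝ} (hx : 16 ≤ x) (hm : 1 ≤ m) (hmz : m ≤ √x) : li (x / m) - li √x = x * ∫ u in Set.Icc m √x, hh x u := by
  have hx0 : 0 < x := by linarith
  set z := √x with hz
  have hzz : z * z = x := Real.mul_self_sqrt hx0.le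
  have hz0 : 0 < z := Real.sqrt_pos.2 hx0
  have hz1 : 4 ≤ z := by nlinarith
  have hxm : z ≤ x / m := by rw [le_div_iff₀ (by linarith)]; nlinarith
  have hxz : x / z = z := by rw [div_eq_iff hz0.ne', hzz]
  have hli : li (x / m) - li z = ∫ t in z..(x/m), 1 / Real.log t := by
    unfold li
    have hi : ∀ {a b : ℝ}, 1 < a → 1 < b → IntervalIntegrable (fun t : ℝ => 1 / Real.log t) volume a b := by
      intro a b ha hb
      simpa using log_ii 1 ha hb
    rw [intervalIntegral.integral_interval_sub_left (hi (by norm_num) (by linarith)) (hi (by norm_num) (by linarith))]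
  rw [hli, integral_Icc_eq_integral_Ioc, ← intervalIntegral.integral_of_le hmz]
  have key := intervalIntegral.integral_comp_mul_deriv'' (a := m) (b := z) (f := fun u => x / u) (f' := fun u => -x / u ^ 2) (g := fun t => 1 / Real.log t) ?_ ?_ ?_ ?_
  · rw [hxz] at key
    rw [intervalIntegral.integral_symm, ← key, ← intervalIntegral.integral_neg, ← intervalIntegral.integral_const_mul]
    refine intervalIntegral.integral_congr fun u hu => ?_
    rw [Set.uIcc_of_le hmz] at hu
    have hu0 : 0 < u := by linarith [hu.1]
    simp only [Function.comp, hh]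
    rw [Real.log_div hx0.ne' hu0.ne', ← div_div]
    ring
  · rw [Set.uIcc_of_le hmz]
    intro u hu
    have : u ≠ 0 := by linarith [hu.1]
    exact (continuousAt_const.div continuousAt_id this).continuousWithinAt
  · intro u hu
    rw [min_eq_left hmz, max_eq_right hmz] at hu
    have : u ≠ 0 := by linarith [hu.1]
    apply HasDerivAt.hasDerivWithinAt
    have := (hasDerivAt_inv this).const_mul x
    simp only [div_eq_mul_inv]
    refine this.congr_deriv ?_
    ring
  · rw [Set.uIcc_of_le hmz]
    intro u hu
    have : u ^ 2 ≠ 0 := by have : 0 < u := by linarith [hu.1]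
                           positivity
    apply ContinuousAt.continuousWithinAt
    fun_prop (disch := assumption)
  · have := (log_contOn 1)
    simp only [pow_one] at this
    refine this.mono ?_
    rintro t ⟨u, hu, rfl⟩
    rw [Set.uIcc_of_le hmz] at hu
    have hu0 : 0 < u := by linarith [hu.1]
    show 1 < x / u
    rw [lt_div_iff₀ hu0]
    nlinarith [hu.2]

lemma floor_sum_int {x : ℝ} (hx : 16 ≤ x) : ∑ m ∈ Finset.Icc 1 ⌊√x⌋₊, ∫ u in Set.Icc (m:ℝ) √x, hh x u = 
    ∫ u in Set.Icc 1 √x, (⌊u⌋₊ : ℝ) * hh x u := by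
  set z := √x with hz
  have hi : IntegrableOn (hh x) (Set.Icc 1 z) := (hh_cont hx).integrableOn_Icc
  have e1 : ∀ m ∈ Finset.Icc 1 ⌊z⌋₊, ∫ u in Set.Icc (m:ℝ) z, hh x u = ∫ u in Set.Icc 1 z, (Set.Ici (m:ℝ)).indicator (hh x) u := by
    intro m hm
    rw [setIntegral_indicator measurableSet_Ici]
    congr 2
    ext u
    have : (1:ℝ) ≤ m := by exact_mod_cast (Finset.mem_Icc.1 hm).1
    simp only [Set.mem_Icc, Set.mem_inter_iff, Set.mem_Ici]
    constructor
    · rintro ⟨h1, h2⟩; exact ⟨⟨by linarith, h2⟩, h1⟩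
    · rintro ⟨⟨h1, h2⟩, h3⟩; exact ⟨h3, h2⟩
  rw [Finset.sum_congr rfl e1, ← integral_finsetSum]
  · refine setIntegral_congr_fun measurableSet_Icc fun u hu => ?_
    simp only [Set.indicator_apply, Set.mem_Ici]
    rw [← Finset.sum_filter, Finset.sum_const, nsmul_eq_mul]
    congr 2
    have : ⌊u⌋₊ = (Finset.Icc 1 ⌊u⌋₊).card := by simp
    rw [this]
    congr 1
    ext m
    rw [Finset.mem_filter, Finset.mem_Icc, Finset.mem_Icc]
    constructor
    · rintro ⟨⟨h1, h2⟩, h3⟩; exact ⟨h1, Nat.le_floor h3⟩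
    · rintro ⟨h1, h2⟩
      exact ⟨⟨h1, h2.trans (Nat.floor_le_floor hu.2)⟩, (Nat.le_floor_iff' (by omega)).1 h2⟩
  · intro m _
    exact hi.indicator measurableSet_Ici

lemma log_two_int {x : ℝ} (hx : 16 ≤ x) : ∫ u in Set.Icc 1 √x, u * hh x u = Real.log 2 := by
  have hx0 : 0 < x := by linarith
  set z := √x with hz
  have hzz : z * z = x := Real.mul_self_sqrt hx0.le
  have hz0 : 0 < z := Real.sqrt_pos.2 hx0
  have hz1 : 4 ≤ z := by nlinarith
  have h1z : 1 ≤ z := by linarith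
  have hL : 0 < Real.log x := Real.log_pos (by linarith)
  have hlz : Real.log z = Real.log x / 2 := Real.log_sqrt hx0.le
  rw [integral_Icc_eq_integral_Ioc, ← intervalIntegral.integral_of_le h1z]
  rw [intervalIntegral.integral_eq_sub_of_hasDerivAt (f := fun u => - Real.log (Real.log x - Real.log u))]
  · rw [hlz, Real.log_one, sub_zero, show Real.log x - Real.log x / 2 = Real.log x / 2 by ring, Real.log_div hL.ne' (by norm_num)]
    ring
  · intro u hu
    rw [Set.uIcc_of_le h1z] at hu
    have hu0 : 0 < u := by linarith [hu.1]
    have := Real.log_lt_log hu0 (show u < x by nlinarith [hu.1, hu.2])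
    have hd := ((((Real.hasDerivAt_log hu0.ne').const_sub (Real.log x))).log (by linarith)).neg
    refine hd.congr_deriv ?_
    have : Real.log x - Real.log u ≠ 0 := by linarith
    unfold hh
    field_simp
  · apply ContinuousOn.intervalIntegrable
    rw [Set.uIcc_of_le h1z]
    exact continuousOn_id.mul (hh_cont hx)

lemma main_int {x : ℝ} (hx : 16 ≤ x) : ∑ m ∈ Finset.Icc 1 ⌊√x⌋₊, (li (x / m) - li √x) = 
    x * (Real.log 2 - ∫ u in Set.Ioc 1 √x, fr u / (u ^ 2 * (Real.log x - Real.log u))) := by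
  have e1 : ∀ m ∈ Finset.Icc 1 ⌊√x⌋₊, li (x / m) - li √x = x * ∫ u in Set.Icc (m:ℝ) √x, hh x u := by
    intro m hm
    rw [Finset.mem_Icc] at hm
    exact li_diff hx (by exact_mod_cast hm.1) ((Nat.le_floor_iff' (by omega)).1 hm.2)
  rw [Finset.sum_congr rfl e1, ← Finset.mul_sum, floor_sum_int hx, ← log_two_int hx, ← integral_Icc_eq_integral_Ioc, ← integral_sub]
  · congr 1
    refine setIntegral_congr_fun measurableSet_Icc fun u hu => ?_
    simp only [fr, hh]
    ring
  · exact (continuousOn_id.mul (hh_cont hx)).integrableOn_Icc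
  · have hi : IntegrableOn (hh x) (Set.Icc 1 √x) := (hh_cont hx).integrableOn_Icc
    have := Integrable.bdd_mul (c := 1) hi (f := fr) fr_meas.aestronglyMeasurable ?_
    · refine this.congr (Eventually.of_forall fun u => ?_)
      simp only [hh]; ring
    · filter_upwards [ae_restrict_mem measurableSet_Icc] with u hu
      have := fr_bd (show 0 ≤ u by linarith [hu.1])
      rw [Real.norm_eq_abs, abs_of_nonneg this.1]
      exact this.2

end LcmAux


namespace LcmAux
open Filter Topology MeasureTheory

lemma prime_floor (N : ℕ) (hN : 1 ≤ N) : ∃ C > 0, ∀ x : ℝ, 16 ≤ x → 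
    |∑ p ∈ pr x, (⌊x / p⌋₊ : ℝ) - x * (Real.log (Real.log x) + MM - ∑ j ∈ Finset.Icc 1 N, (∫ u in Set.Ioi 1, fr u * Real.log u ^ (j - 1) / u ^ 2) / Real.log x ^ j)| ≤ C * (x / Real.log x ^ (N + 1)) := by
  obtain ⟨C1, hC1, h1⟩ := mertens (N + 1) (by omega)
  obtain ⟨C2, hC2, h2⟩ := RR_bound (N + 2)
  obtain ⟨C3, hC3, h3⟩ := sqrt_le_div_log (N + 1)
  obtain ⟨C4, hC4, h4⟩ := frac_expand N hN
  refine ⟨C3 + C1 * 2 ^ (N + 1) + 2 * C2 * 2 ^ (N + 2) + C4, by positivity, fun x hx => ?_⟩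
  have h3 := h3 x (by linarith)
  have h4 := h4 x hx
  rw [hyper hx]
  have hsum : ∑ m ∈ Finset.Icc 1 ⌊√x⌋₊, (((pr (x / m)).card : ℝ) - (pr √x).card) = 
    ∑ m ∈ Finset.Icc 1 ⌊√x⌋₊, (li (x / m) - li √x) + ∑ m ∈ Finset.Icc 1 ⌊√x⌋₊, (RR (x / m) - RR √x) := by
    rw [← Finset.sum_add_distrib]
    refine Finset.sum_congr rfl fun m _ => ?_
    rw [card_pr, card_pr, RR, RR]
    ring
  rw [hsum, main_int hx]
  have hx0 : 0 < x := by linarith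
  set z := √x with hz
  have hzz : z * z = x := Real.mul_self_sqrt hx0.le
  have hz0 : 0 < z := Real.sqrt_pos.2 hx0
  have hz1 : 4 ≤ z := by nlinarith
  have hlz : Real.log z = Real.log x / 2 := Real.log_sqrt hx0.le
  set L := Real.log x with hL
  have hL2 : 2 ≤ L := by
    have h : Real.log 16 ≤ L := Real.log_le_log (by norm_num) hx
    rw [show (16:ℝ) = 2 ^ 4 by norm_num, Real.log_pow] at h
    have := Real.log_two_gt_d9
    push_cast at h
    linarith
  have hL0 : 0 < L := by linarith
  -- piece one
  have p1 : |∑ p ∈ pr z, (⌊x / p⌋₊ : ℝ) - x * ∑ p ∈ pr z, (1 / p : ℝ)| ≤ z := by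
    rw [Finset.mul_sum, ← Finset.sum_sub_distrib]
    calc _ ≤ ∑ p ∈ pr z, |(⌊x / p⌋₊ : ℝ) - x * (1 / p)| := Finset.abs_sum_le_sum_abs _ _
      _ ≤ ∑ p ∈ pr z, (1:ℝ) := by
        refine Finset.sum_le_sum fun p _ => ?_
        have h := fr_bd (show 0 ≤ x / p by positivity)
        unfold fr at h
        rw [mul_one_div, abs_le]
        constructor <;> linarith [h.1, h.2]
      _ = (pr z).card := by simp
      _ ≤ (⌊z⌋₊ : ℝ) := by
        have : (pr z).card ≤ (Finset.Icc 1 ⌊z⌋₊).card := Finset.card_filter_le _ _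
        rw [Nat.card_Icc] at this
        exact_mod_cast this
      _ ≤ z := Nat.floor_le hz0.le
  have p2 := h1 z (by linarith)
  rw [hlz, Real.log_div hL0.ne' (by norm_num)] at p2
  have p2' : C1 / (L / 2) ^ (N + 1) = C1 * 2 ^ (N + 1) / L ^ (N + 1) := by
    rw [div_pow]; field_simp
  rw [p2'] at p2
  have p3 : |∑ m ∈ Finset.Icc 1 ⌊z⌋₊, (RR (x / m) - RR z)| ≤ 2 * C2 * 2 ^ (N + 2) * (x / L ^ (N + 1)) := by
    have hb : ∀ m ∈ Finset.Icc 1 ⌊z⌋₊, |RR (x / m) - RR z| ≤ 2 * C2 * 2 ^ (N + 2) / L ^ (N + 2) * x * (m : ℝ)⁻¹ := by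
      intro m hm
      rw [Finset.mem_Icc] at hm
      have hmz := (Nat.le_floor_iff' (by omega)).1 hm.2
      have hm0 : (0:ℝ) < m := by exact_mod_cast hm.1
      have hzm : z ≤ x / m := by rw [le_div_iff₀ hm0]; nlinarith
      have key : ∀ y, z ≤ y → y ≤ x / m → |RR y| ≤ C2 * 2 ^ (N + 2) / L ^ (N + 2) * x * (m : ℝ)⁻¹ := by
        intro y hy1 hy2
        have hly : L / 2 ≤ Real.log y := by rw [← hlz]; exact Real.log_le_log hz0 hy1
        calc _ ≤ C2 * (y / Real.log y ^ (N + 2)) := h2 y (by linarith)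
          _ ≤ C2 * ((x / m) / (L / 2) ^ (N + 2)) := by gcongr
          _ = _ := by rw [div_pow]; field_simp
      have a1 := key z le_rfl hzm
      have a2 := key (x / m) hzm le_rfl
      calc _ ≤ |RR (x / m)| + |RR z| := abs_sub _ _
        _ ≤ _ := add_le_add a2 a1
        _ = _ := by ring
    have hharm : ∑ m ∈ Finset.Icc 1 ⌊z⌋₊, ((m:ℝ))⁻¹ ≤ L := by
      have h := harmonic_floor_le_one_add_log z (by linarith)
      rw [harmonic_eq_sum_Icc] at h
      push_cast at h
      linarith
    calc _ ≤ ∑ m ∈ Finset.Icc 1 ⌊z⌋₊, |RR (x / m) - RR z| := Finset.abs_sum_le_sum_abs _ _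
      _ ≤ ∑ m ∈ Finset.Icc 1 ⌊z⌋₊, 2 * C2 * 2 ^ (N + 2) / L ^ (N + 2) * x * (m : ℝ)⁻¹ := Finset.sum_le_sum hb
      _ = 2 * C2 * 2 ^ (N + 2) / L ^ (N + 2) * x * ∑ m ∈ Finset.Icc 1 ⌊z⌋₊, (m : ℝ)⁻¹ := by rw [Finset.mul_sum]
      _ ≤ 2 * C2 * 2 ^ (N + 2) / L ^ (N + 2) * x * L := by gcongr
      _ = _ := by field_simp; ring
  set S1 := ∑ p ∈ pr z, (⌊x / p⌋₊ : ℝ)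
  set S2 := ∑ p ∈ pr z, (1 / p : ℝ)
  set S3 := ∑ m ∈ Finset.Icc 1 ⌊z⌋₊, (RR (x / m) - RR z)
  set S4 := ∫ u in Set.Ioc 1 z, fr u / (u ^ 2 * (L - Real.log u))
  set S5 := ∑ j ∈ Finset.Icc 1 N, (∫ u in Set.Ioi 1, fr u * Real.log u ^ (j - 1) / u ^ 2) / L ^ j
  have e : S1 + (x * (Real.log 2 - S4) + S3) - x * (Real.log L + MM - S5) = 
    (S1 - x * S2) + x * (S2 - (Real.log L - Real.log 2) - MM) + S3 + x * (- (S4 - S5)) := by ring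
  rw [e]
  have q2 : |x * (S2 - (Real.log L - Real.log 2) - MM)| ≤ C1 * 2 ^ (N + 1) * (x / L ^ (N + 1)) := by
    rw [abs_mul, abs_of_pos hx0]
    calc _ ≤ x * (C1 * 2 ^ (N + 1) / L ^ (N + 1)) := by gcongr
      _ = _ := by ring
  have q4 : |x * (- (S4 - S5))| ≤ C4 * (x / L ^ (N + 1)) := by
    rw [abs_mul, abs_of_pos hx0, abs_neg]
    calc _ ≤ x * (C4 / L ^ (N + 1)) := by gcongr
      _ = _ := by ring
  calc _ ≤ |S1 - x * S2| + |x * (S2 - (Real.log L - Real.log 2) - MM)| + |S3| + |x * (- (S4 - S5))| := 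
        (abs_add_le _ _).trans (add_le_add_left ((abs_add_le _ _).trans (add_le_add_left (abs_add_le _ _) _)) _)
    _ ≤ C3 * (x / L ^ (N + 1)) + C1 * 2 ^ (N + 1) * (x / L ^ (N + 1)) + 2 * C2 * 2 ^ (N + 2) * (x / L ^ (N + 1)) + C4 * (x / L ^ (N + 1)) := by
      linarith
    _ = _ := by ring

end LcmAux


namespace LcmAux
open Filter Topology MeasureTheory

lemma pp_dvd_lcm2 {p : ℕ} (hp : p.Prime) (ν a b : ℕ) : p ^ ν ∣ Nat.lcm a b ↔ p ^ ν ∣ a ∨ p ^ ν ∣ b := by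
  rcases eq_or_ne a 0 with rfl | ha
  · simp
  rcases eq_or_ne b 0 with rfl | hb
  · simp
  rw [hp.pow_dvd_iff_le_factorization (Nat.lcm_ne_zero ha hb), hp.pow_dvd_iff_le_factorization ha, hp.pow_dvd_iff_le_factorization hb, Nat.factorization_lcm ha hb]
  simp

lemma pp_dvd_lcm {ι : Type*} [DecidableEq ι] {p : ℕ} (hp : p.Prime) (ν : ℕ) (s : Finset ι) (n : ι → ℕ) : 
    p ^ (ν + 1) ∣ s.lcm n ↔ ∃ i ∈ s, p ^ (ν + 1) ∣ n i := by
  induction s using Finset.induction_on with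
  | empty =>
    simp
    exact hp.one_lt.ne'
  | insert a s ha ih =>
    rw [Finset.lcm_insert, lcm_eq_nat_lcm, pp_dvd_lcm2 hp, ih]
    simp

lemma f_one {f : ℕ → ℂ} (hadd : ∀ m n : ℕ, Nat.Coprime m n → f (m * n) = f m + f n) : f 1 = 0 := by
  have := hadd 1 1 (by simp)
  simpa using this

lemma f_fact {f : ℕ → ℂ} (hadd : ∀ m n : ℕ, Nat.Coprime m n → f (m * n) = f m + f n) {M : ℕ} (hM : M ≠ 0) : 
    f M = ∑ p ∈ M.primeFactors, f (p ^ M.factorization p) := by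
  have := Nat.multiplicative_factorization (fun n => Multiplicative.ofAdd (f n)) 
    (fun a b h => by rw [← ofAdd_add, hadd a b h]) (by simp [f_one hadd]) hM
  rw [Finsupp.prod, ← ofAdd_sum] at this
  exact Multiplicative.ofAdd.injective this

lemma f_pp {f : ℕ → ℂ} (hf1 : f 1 = 0) (p v T : ℕ) (hv : v ≤ T) : 
    f (p ^ v) = ∑ ν ∈ Finset.range T, if ν + 1 ≤ v then (f (p ^ (ν + 1)) - f (p ^ ν)) else 0 := by
  rw [← Finset.sum_filter]
  have : (Finset.range T).filter (fun ν => ν + 1 ≤ v) = Finset.range v := by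
    ext ν; simp; omega
  rw [this, Finset.sum_range_sub (fun ν => f (p ^ ν)), pow_zero, hf1, sub_zero]

lemma f_lcm {f : ℕ → ℂ} (hadd : ∀ m n : ℕ, Nat.Coprime m n → f (m * n) = f m + f n) {k : ℕ} (X : ℕ) (n : Fin k → ℕ) 
    (hn : ∀ i, n i ∈ Finset.Icc 1 X) : f (Finset.univ.lcm n) = ∑ p ∈ (Finset.Icc 1 X).filter Nat.Prime, ∑ ν ∈ Finset.range X, 
      if ∃ i, p ^ (ν + 1) ∣ n i then (f (p ^ (ν + 1)) - f (p ^ ν)) else 0 := by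
  have hM : Finset.univ.lcm n ≠ 0 := by
    rw [Ne, Finset.lcm_eq_zero_iff]
    rintro ⟨i, _, h⟩
    have := Finset.mem_Icc.1 (hn i)
    omega
  have hle : ∀ p, p.Prime → ∀ ν, p ^ (ν + 1) ∣ Finset.univ.lcm n → p ^ (ν + 1) ≤ X := by
    intro p hp ν h
    obtain ⟨i, _, h⟩ := (pp_dvd_lcm hp ν _ n).1 h
    have := Finset.mem_Icc.1 (hn i)
    exact (Nat.le_of_dvd (by omega) h).trans this.2
  rw [f_fact hadd hM]
  set M := Finset.univ.lcm n with hMdef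
  have hsub : M.primeFactors ⊆ (Finset.Icc 1 X).filter Nat.Prime := by
    intro p hp
    have hpp := Nat.prime_of_mem_primeFactors hp
    rw [Finset.mem_filter, Finset.mem_Icc]
    refine ⟨⟨hpp.pos, ?_⟩, hpp⟩
    simpa using hle p hpp 0 (by simpa using Nat.dvd_of_mem_primeFactors hp)
  rw [Finset.sum_subset hsub]
  · refine Finset.sum_congr rfl fun p hp => ?_
    have hpp := (Finset.mem_filter.1 hp).2
    rw [f_pp (f_one hadd) p (M.factorization p) X]
    · refine Finset.sum_congr rfl fun ν _ => ?_
      have : ν + 1 ≤ M.factorization p ↔ ∃ i, p ^ (ν + 1) ∣ n i := by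
        rw [← hpp.pow_dvd_iff_le_factorization hM, pp_dvd_lcm hpp]
        simp
      simp only [this]
    · rcases h : M.factorization p with _ | v
      · simp
      · have := hle p hpp v ((hpp.pow_dvd_iff_le_factorization hM).2 h.ge)
        exact (Nat.lt_pow_self hpp.one_lt).le.trans this
  · intro p hp hnp
    have hpp := (Finset.mem_filter.1 hp).2
    have : M.factorization p = 0 := by
      rw [← Finsupp.notMem_support_iff, Nat.support_factorization]; exact hnp
    rw [this, pow_zero, f_one hadd]

lemma count_nd (k X q : ℕ) : 
    ((Fintype.piFinset (fun _ : Fin k => Finset.Icc 1 X)).filter (fun n => ∃ i, q ∣ n i)).card + (X - X / q) ^ k = X ^ k := by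
  have h1 : (Fintype.piFinset (fun _ : Fin k => Finset.Icc 1 X)).card = X ^ k := by simp
  rw [← h1, ← Finset.card_filter_add_card_filter_not (s := Fintype.piFinset (fun _ : Fin k => Finset.Icc 1 X)) (fun n => ∃ i, q ∣ n i)]
  congr 1
  have h2 : (Fintype.piFinset (fun _ : Fin k => Finset.Icc 1 X)).filter (fun n => ¬ ∃ i, q ∣ n i) = 
    Fintype.piFinset (fun _ : Fin k => (Finset.Icc 1 X).filter (fun m => ¬ q ∣ m)) := by
    ext n
    simp only [Finset.mem_filter, Fintype.mem_piFinset, not_exists]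
    exact ⟨fun h i => ⟨h.1 i, h.2 i⟩, fun h => ⟨fun i => (h i).1, fun i => (h i).2⟩⟩
  rw [h2, Fintype.card_piFinset]
  simp only [Finset.prod_const, Finset.card_univ, Fintype.card_fin]
  congr 1
  have h3 := Finset.card_filter_add_card_filter_not (s := Finset.Icc 1 X) (fun m => q ∣ m)
  have h4 : ((Finset.Icc 1 X).filter (fun m => q ∣ m)).card = X / q := by
    rw [← Nat.Ioc_filter_dvd_card_eq_div]; rfl
  rw [Nat.card_Icc, h4] at h3
  omega

lemma sum_swap {f : ℕ → ℂ} (hadd : ∀ m n : ℕ, Nat.Coprime m n → f (m * n) = f m + f n) (k X : ℕ) : 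
    ∑ n ∈ Fintype.piFinset (fun _ : Fin k => Finset.Icc 1 X), f (Finset.univ.lcm n) = 
    ∑ p ∈ (Finset.Icc 1 X).filter Nat.Prime, ∑ ν ∈ Finset.range X, (f (p ^ (ν + 1)) - f (p ^ ν)) * ((X:ℂ) ^ k - ((X:ℂ) - (X / p ^ (ν + 1) : ℕ)) ^ k) := by
  rw [Finset.sum_congr rfl fun n hn => f_lcm hadd X n (Fintype.mem_piFinset.1 hn), Finset.sum_comm]
  refine Finset.sum_congr rfl fun p hp => ?_
  rw [Finset.sum_comm]
  refine Finset.sum_congr rfl fun ν _ => ?_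
  have hq : 0 < p ^ (ν + 1) := pow_pos (Finset.mem_filter.1 hp).2.pos _
  rw [← Finset.sum_filter, Finset.sum_const, nsmul_eq_mul, mul_comm]
  congr 1
  have := count_nd k X (p ^ (ν + 1))
  rw [← Nat.cast_sub (Nat.div_le_self _ _), eq_sub_iff_add_eq]
  exact_mod_cast this

lemma binom_exp (X m : ℂ) (k : ℕ) : X ^ k - (X - m) ^ k = ∑ j ∈ Finset.Icc 1 k, (-1) ^ (j + 1) * (k.choose j : ℂ) * X ^ (k - j) * m ^ j := by
  rw [sub_eq_neg_add X m, add_pow, Finset.range_eq_Ico, Finset.sum_eq_sum_Ico_succ_bot (by omega)]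
  simp only [pow_zero, Nat.choose_zero_right, one_mul, Nat.cast_one, mul_one, tsub_zero]
  rw [sub_add_cancel_left, ← Finset.sum_neg_distrib]
  refine Finset.sum_congr (by ext; simp) fun j _ => ?_
  rw [neg_pow m]
  ring

noncomputable def TT (f : ℕ → ℂ) (X j : ℕ) : ℂ := ∑ p ∈ (Finset.Icc 1 X).filter Nat.Prime, ∑ ν ∈ Finset.range X, (f (p ^ (ν + 1)) - f (p ^ ν)) * ((X / p ^ (ν + 1) : ℕ) : ℂ) ^ j

lemma sum_TT {f : ℕ → ℂ} (hadd : ∀ m n : ℕ, Nat.Coprime m n → f (m * n) = f m + f n) (k X : ℕ) : 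
    ∑ n ∈ Fintype.piFinset (fun _ : Fin k => Finset.Icc 1 X), f (Finset.univ.lcm n) = 
    ∑ j ∈ Finset.Icc 1 k, (-1) ^ (j + 1) * (k.choose j : ℂ) * ((X : ℂ) ^ (k - j) * TT f X j) := by
  rw [sum_swap hadd]
  simp_rw [binom_exp, TT, Finset.mul_sum]
  rw [Finset.sum_comm (s := Finset.Icc 1 k)]
  refine Finset.sum_congr rfl fun p _ => ?_
  rw [Finset.sum_comm (s := Finset.Icc 1 k)]
  refine Finset.sum_congr rfl fun ν _ => Finset.sum_congr rfl fun j _ => ?_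
  ring

/-- sums over pairs -/
lemma tsum_pairs (X : ℕ) (φ : ℕ → ℕ → ℂ) (h : ∀ p ν, p.Prime → X < p ^ (ν + 1) → φ p ν = 0) : 
    HasSum (fun i : Nat.Primes × ℕ => φ i.1 i.2) (∑ p ∈ (Finset.Icc 1 X).filter Nat.Prime, ∑ ν ∈ Finset.range X, φ p ν) := by
  have e : ∑ p ∈ (Finset.Icc 1 X).filter Nat.Prime, ∑ ν ∈ Finset.range X, φ p ν = 
    ∑ i ∈ (Finset.subtype Nat.Prime (Finset.Icc 1 X)) ×ˢ Finset.range X, φ (i.1 : ℕ) i.2 := by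
    rw [Finset.sum_product, ← Finset.sum_subtype_eq_sum_filter]
  rw [e]
  apply hasSum_sum_of_ne_finset_zero
  rintro ⟨p, ν⟩ hi
  apply h p ν p.2
  by_contra hc
  apply hi
  rw [not_lt] at hc
  have hν : ν < p.1 ^ (ν + 1) := (Nat.lt_succ_self ν).trans (Nat.lt_pow_self p.2.one_lt)
  have hp : p.1 ≤ p.1 ^ (ν + 1) := Nat.le_self_pow (by omega) _
  exact Finset.mem_product.2 ⟨Finset.mem_subtype.2 (Finset.mem_Icc.2 ⟨p.2.pos, hp.trans hc⟩), Finset.mem_range.2 (lt_of_lt_of_le hν hc)⟩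

end LcmAux


namespace LcmAux
open Filter Topology MeasureTheory

noncomputable def gg (f : ℕ → ℂ) (p ν : ℕ) : ℂ := f (p ^ (ν + 1)) - f (p ^ ν)

noncomputable def g2 (f : ℕ → ℂ) (p ν : ℕ) : ℂ := if ν = 0 then 0 else gg f p ν

lemma f_bd {f : ℕ → ℂ} (hf1 : f 1 = 0) (hp1 : ∀ p : ℕ, p.Prime → f p = 1)
    (hbound : ∃ (l : ℕ) (K : ℝ), ∀ p : ℕ, p.Prime → ∀ ν : ℕ, 2 ≤ ν → ‖f (p ^ ν)‖ ≤ K * (ν : ℝ) ^ l) : 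
    ∃ (l : ℕ) (B : ℝ), 0 < B ∧ ∀ p : ℕ, p.Prime → ∀ ν : ℕ, ‖f (p ^ ν)‖ ≤ B * ((ν : ℝ) + 1) ^ l ∧ ‖gg f p ν‖ ≤ B * ((ν : ℝ) + 1) ^ l := by
  obtain ⟨l, K, h⟩ := hbound
  have key : ∀ p : ℕ, p.Prime → ∀ ν : ℕ, ‖f (p ^ ν)‖ ≤ (1 + |K|) * (ν : ℝ) ^ l + (if ν = 0 then 0 else 0) := by
    intro p hp ν
    rcases ν with _ | _ | ν
    · simp [hf1]; positivity
    · simp [hp1 p hp]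
    · have := h p hp (ν + 2) (by omega)
      simp only [ite_self, add_zero]
      refine this.trans ?_
      gcongr
      linarith [le_abs_self K]
  simp only [ite_self, add_zero] at key
  refine ⟨l, 2 * (1 + |K|), by positivity, fun p hp ν => ?_⟩
  have a : (1 + |K|) * (ν : ℝ) ^ l ≤ (1 + |K|) * ((ν : ℝ) + 1) ^ l := by gcongr; linarith
  have b : 0 ≤ (1 + |K|) * ((ν : ℝ) + 1) ^ l := by positivity
  have c1 := key p hp ν
  have c2 := key p hp (ν + 1)
  push_cast at c2
  constructor
  · linarith
  · exact (norm_sub_le _ _).trans (by linarith)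

lemma pow_diff {y m : ℝ} (hm : 0 ≤ m) (hmy : m ≤ y) (j : ℕ) : y ^ (j + 1) - m ^ (j + 1) ≤ ((j:ℝ) + 1) * y ^ j * (y - m) := by
  induction j with
  | zero => simp
  | succ j ih =>
    have h1 : m ^ (j + 1) ≤ y ^ (j + 1) := by gcongr
    have hy : 0 ≤ y := hm.trans hmy
    have h2 := mul_le_mul_of_nonneg_left ih hy
    have h3 := mul_le_mul_of_nonneg_right h1 (sub_nonneg.2 hmy)
    push_cast
    calc _ = y * (y ^ (j + 1) - m ^ (j + 1)) + m ^ (j + 1) * (y - m) := by ring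
      _ ≤ y * (((j:ℝ) + 1) * y ^ j * (y - m)) + y ^ (j + 1) * (y - m) := add_le_add h2 h3
      _ = _ := by ring

lemma floor_pow {y : ℝ} (hy : 0 < y) {j : ℕ} (hj : 1 ≤ j) : |(⌊y⌋₊ : ℝ) ^ j - y ^ j| ≤ j * y ^ ((j:ℝ) - 1 / 3) := by
  obtain ⟨i, rfl⟩ : ∃ i, j = i + 1 := ⟨j - 1, by omega⟩
  have hm := Nat.floor_le hy.le
  have h0 : (0:ℝ) ≤ (⌊y⌋₊ : ℝ) := Nat.cast_nonneg _
  have h1 : (⌊y⌋₊ : ℝ) ^ (i + 1) ≤ y ^ (i + 1) := by gcongr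
  have hfr : y - ⌊y⌋₊ ≤ y ^ (2/3 : ℝ) := by
    rcases le_total y 1 with h | h
    · have : y ^ (1:ℝ) ≤ y ^ (2/3 : ℝ) := Real.rpow_le_rpow_of_exponent_ge hy h (by norm_num)
      rw [Real.rpow_one] at this
      linarith
    · have := Real.one_le_rpow h (show (0:ℝ) ≤ 2/3 by norm_num)
      linarith [Nat.lt_floor_add_one y]
  rw [abs_sub_comm, abs_of_nonneg (by linarith)]
  calc _ ≤ ((i:ℝ) + 1) * y ^ i * (y - ⌊y⌋₊) := pow_diff h0 hm i
    _ ≤ ((i:ℝ) + 1) * y ^ i * y ^ (2/3 : ℝ) := by gcongr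
    _ = _ := by
      rw [mul_assoc, ← Real.rpow_natCast y i, ← Real.rpow_add hy]
      push_cast
      congr 2
      ring

noncomputable def rr : ℝ := 2 ^ (-(2/3) : ℝ)
lemma rr_pos : 0 < rr := by unfold rr; positivity
lemma rr_lt : rr < 1 := Real.rpow_lt_one_of_one_lt_of_neg (by norm_num) (by norm_num)

noncomputable def VV (l : ℕ) (i : Nat.Primes × ℕ) : ℝ := ((i.1 : ℕ) : ℝ) ^ (-(4/3) : ℝ) * (((i.2 : ℝ) + 1) ^ l * rr ^ i.2)

lemma VV_inner (l : ℕ) : Summable fun ν : ℕ => ((ν : ℝ) + 1) ^ l * rr ^ ν := by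
  have h := summable_pow_mul_geometric_of_norm_lt_one (R := ℝ) l (r := rr) (by rw [Real.norm_eq_abs, abs_of_pos rr_pos]; exact rr_lt)
  have h2 := ((summable_nat_add_iff 1).2 h).mul_left rr⁻¹
  refine h2.congr fun ν => ?_
  push_cast
  have := rr_pos.ne'
  field_simp
  ring

lemma VV_sum (l : ℕ) : Summable (VV l) := by
  refine Summable.mul_of_nonneg (f := fun p : Nat.Primes => ((p : ℕ) : ℝ) ^ (-(4/3) : ℝ)) (g := fun ν : ℕ => ((ν : ℝ) + 1) ^ l * rr ^ ν) ?_ (VV_inner l) ?_ ?_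
  · exact (Nat.Primes.summable_rpow).2 (by norm_num)
  · intro p; show (0:ℝ) ≤ _; positivity
  · intro ν
    have := rr_pos
    show (0:ℝ) ≤ _; positivity

lemma decay {p : ℕ} (hp : p.Prime) (ν : ℕ) (s : ℝ) (h : 4/3 ≤ s ∨ (2/3 ≤ s ∧ ν ≠ 0)) : 
    ((p:ℝ) ^ (ν + 1)) ^ (-s) ≤ rr⁻¹ * ((p:ℝ) ^ (-(4/3) : ℝ) * rr ^ ν) := by
  have hp2 : (2:ℝ) ≤ p := by exact_mod_cast hp.two_le
  have hp0 : (0:ℝ) < p := by linarith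
  have hr := rr_pos
  rcases ν with _ | μ
  · have hs : 4/3 ≤ s := by
      rcases h with h | h
      · exact h
      · exact absurd rfl h.2
    simp only [zero_add, pow_one, pow_zero, mul_one]
    calc (p:ℝ) ^ (-s) ≤ 1 * (p:ℝ) ^ (-(4/3) : ℝ) := by
          rw [one_mul]; exact Real.rpow_le_rpow_of_exponent_le (by linarith) (by linarith)
      _ ≤ _ := by
        gcongr
        exact (one_le_inv₀ hr).2 rr_lt.le
  · have hs : 2/3 ≤ s := by
      rcases h with h | h
      · linarith
      · exact h.1
    have hpp : (1:ℝ) ≤ (p:ℝ) ^ (μ + 1 + 1) := one_le_pow₀ (by linarith)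
    calc ((p:ℝ) ^ (μ + 1 + 1)) ^ (-s) ≤ ((p:ℝ) ^ (μ + 1 + 1)) ^ (-(2/3) : ℝ) := 
          Real.rpow_le_rpow_of_exponent_le hpp (by linarith)
      _ = (p:ℝ) ^ (-(4/3) : ℝ) * ((p:ℝ) ^ (-(2/3) : ℝ)) ^ μ := by
        rw [← Real.rpow_natCast, ← Real.rpow_mul hp0.le, ← Real.rpow_natCast, ← Real.rpow_mul hp0.le, ← Real.rpow_add hp0]
        congr 1
        push_cast
        ring
      _ ≤ (p:ℝ) ^ (-(4/3) : ℝ) * rr ^ μ := by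
        gcongr
        exact Real.rpow_le_rpow_of_nonpos (by norm_num) hp2 (by norm_num)
      _ = _ := by rw [pow_succ]; field_simp

section
variable {w : ℕ → ℕ → ℂ} {l : ℕ} {B : ℝ}

lemma wdecay (hB : 0 < B) (hw : ∀ p : ℕ, p.Prime → ∀ ν : ℕ, ‖w p ν‖ ≤ B * ((ν : ℝ) + 1) ^ l) (s : ℝ) 
    (h : 4/3 ≤ s ∨ (2/3 ≤ s ∧ ∀ p, w p 0 = 0)) (i : Nat.Primes × ℕ) : 
    ‖w i.1 i.2‖ * (((i.1 : ℕ) : ℝ) ^ (i.2 + 1)) ^ (-s) ≤ B * rr⁻¹ * VV l i := by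
  have hr := rr_pos
  by_cases h0 : w i.1 i.2 = 0
  · rw [h0, norm_zero, zero_mul]
    unfold VV
    positivity
  · have hd := decay i.1.2 i.2 s (by
      rcases h with h | h
      · exact Or.inl h
      · refine Or.inr ⟨h.1, fun h2 => h0 ?_⟩
        rw [h2]; exact h.2 _)
    calc _ ≤ (B * ((i.2 : ℝ) + 1) ^ l) * (rr⁻¹ * (((i.1 : ℕ):ℝ) ^ (-(4/3) : ℝ) * rr ^ i.2)) := by
          gcongr
          exact hw _ i.1.2 _
      _ = _ := by unfold VV; ring

lemma w_summable (hB : 0 < B) (hw : ∀ p : ℕ, p.Prime → ∀ ν : ℕ, ‖w p ν‖ ≤ B * ((ν : ℝ) + 1) ^ l) {j : ℕ} (hj : 1 ≤ j)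
    (h : 2 ≤ j ∨ ∀ p, w p 0 = 0) : 
    Summable fun i : Nat.Primes × ℕ => w i.1 i.2 / ((i.1 : ℕ) : ℂ) ^ ((i.2 + 1) * j) := by
  refine Summable.of_norm_bounded ((VV_sum l).mul_left (B * rr⁻¹)) fun i => ?_
  have hd := wdecay hB hw j (by
      rcases h with h | h
      · left; have : (2:ℝ) ≤ j := by exact_mod_cast h
        linarith
      · right; have : (1:ℝ) ≤ j := by exact_mod_cast hj
        exact ⟨by linarith, h⟩) i
  refine le_trans (le_of_eq ?_) hd
  rw [norm_div, norm_pow, Complex.norm_natCast, Real.rpow_neg (by positivity), Real.rpow_natCast, ← pow_mul, div_eq_mul_inv]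

lemma w_asym (hB : 0 < B) (hw : ∀ p : ℕ, p.Prime → ∀ ν : ℕ, ‖w p ν‖ ≤ B * ((ν : ℝ) + 1) ^ l) {j : ℕ} (hj : 1 ≤ j)
    (h : 2 ≤ j ∨ ∀ p, w p 0 = 0) : ∃ C > 0, ∀ x : ℝ, 1 ≤ x → 
    ‖∑ p ∈ (Finset.Icc 1 ⌊x⌋₊).filter Nat.Prime, ∑ ν ∈ Finset.range ⌊x⌋₊, w p ν * ((⌊x⌋₊ / p ^ (ν + 1) : ℕ) : ℂ) ^ j - 
      (x : ℂ) ^ j * ∑' i : Nat.Primes × ℕ, w i.1 i.2 / ((i.1 : ℕ) : ℂ) ^ ((i.2 + 1) * j)‖ ≤ C * x ^ ((j : ℝ) - 1/3) := by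
  have hr := rr_pos
  have hV0 : 0 ≤ ∑' i, VV l i := tsum_nonneg fun i => by unfold VV; positivity
  have hj1 : (1:ℝ) ≤ j := by exact_mod_cast hj
  refine ⟨j * (B * rr⁻¹) * (∑' i, VV l i) + 1, by positivity, fun x hx => ?_⟩
  have hx0 : 0 < x := by linarith
  have hS := tsum_pairs ⌊x⌋₊ (fun p ν => w p ν * ((⌊x⌋₊ / p ^ (ν + 1) : ℕ) : ℂ) ^ j) (by
    intro p ν hp hlt
    rw [Nat.div_eq_of_lt hlt]
    simp
    right; omega)
  have hD := ((w_summable hB hw hj h).hasSum).mul_left ((x : ℂ) ^ j)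
  have hsub := hS.sub hD
  have hV := ((VV_sum l).hasSum).mul_left (j * (B * rr⁻¹) * x ^ ((j:ℝ) - 1/3))
  refine (hsub.norm_le_of_bounded hV fun i => ?_).trans ?_
  · have hd := wdecay hB hw (j - 1/3) (by
      rcases h with h | h
      · left; have : (2:ℝ) ≤ j := by exact_mod_cast h
        linarith
      · right
        exact ⟨by linarith, h⟩) i
    have hq0 : (0:ℝ) < ((i.1 : ℕ) : ℝ) ^ (i.2 + 1) := by
      have : (0:ℝ) < ((i.1 : ℕ) : ℝ) := by exact_mod_cast i.1.2.pos
      positivity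
    set q : ℕ := (i.1 : ℕ) ^ (i.2 + 1) with hq
    have hqr : ((i.1 : ℕ) : ℝ) ^ (i.2 + 1) = (q : ℝ) := by rw [hq]; push_cast; rfl
    rw [hqr] at hq0 hd
    have e : w i.1 i.2 * ((⌊x⌋₊ / q : ℕ) : ℂ) ^ j - (x : ℂ) ^ j * (w i.1 i.2 / ((i.1 : ℕ) : ℂ) ^ ((i.2 + 1) * j)) = 
        w i.1 i.2 * (((⌊x / q⌋₊ : ℝ) ^ j - (x / q) ^ j : ℝ) : ℂ) := by
      rw [Nat.floor_div_natCast, pow_mul]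
      have : ((i.1 : ℕ) : ℂ) ^ (i.2 + 1) = (q : ℂ) := by rw [hq]; push_cast; rfl
      rw [this]
      push_cast
      rw [div_pow]
      ring
    rw [e, norm_mul, Complex.norm_real, Real.norm_eq_abs]
    calc _ ≤ ‖w i.1 i.2‖ * (j * (x / q) ^ ((j:ℝ) - 1/3)) := by
          gcongr
          exact floor_pow (by positivity) hj
      _ = j * x ^ ((j:ℝ) - 1/3) * (‖w i.1 i.2‖ * (q:ℝ) ^ (-((j:ℝ) - 1/3))) := by
          rw [Real.div_rpow hx0.le hq0.le, Real.rpow_neg hq0.le]; ring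
      _ ≤ j * x ^ ((j:ℝ) - 1/3) * (B * rr⁻¹ * VV l i) := by gcongr
      _ = _ := by ring
  · have : 0 ≤ x ^ ((j:ℝ) - 1/3) := by positivity
    nlinarith
end

end LcmAux


namespace LcmAux
open Filter Topology MeasureTheory

section
variable {f : ℕ → ℂ} {l : ℕ} {B : ℝ}

lemma F_summable (hB : 0 < B) (hf : ∀ p : ℕ, p.Prime → ∀ ν : ℕ, ‖f (p ^ ν)‖ ≤ B * ((ν : ℝ) + 1) ^ l) {j : ℕ} (hj : 1 ≤ j)
    {p : ℕ} (hp : p.Prime) : Summable fun ν : ℕ => f (p ^ ν) / (p : ℂ) ^ (ν * j) := by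
  refine Summable.of_norm_bounded ((VV_inner l).mul_left B) fun ν => ?_
  rw [norm_div, norm_pow, Complex.norm_natCast, div_eq_mul_inv, mul_comm ν j, pow_mul, ← inv_pow, ← mul_assoc]
  have hp2 : (2:ℝ) ≤ p := by exact_mod_cast hp.two_le
  have h1 : ((p:ℝ) ^ j)⁻¹ ≤ rr := by
    have : (p:ℝ) ≤ (p:ℝ) ^ j := le_self_pow₀ (by linarith) (by omega)
    calc ((p:ℝ) ^ j)⁻¹ ≤ (2:ℝ)⁻¹ := inv_anti₀ (by norm_num) (by linarith)
      _ = (2:ℝ) ^ (-1 : ℝ) := by rw [Real.rpow_neg_one]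
      _ ≤ rr := Real.rpow_le_rpow_of_exponent_le (by norm_num) (by norm_num)
  gcongr
  exact hf p hp ν

lemma D_inner (hf1 : f 1 = 0) (hB : 0 < B) (hf : ∀ p : ℕ, p.Prime → ∀ ν : ℕ, ‖f (p ^ ν)‖ ≤ B * ((ν : ℝ) + 1) ^ l) {j : ℕ} (hj : 1 ≤ j)
    {p : ℕ} (hp : p.Prime) : (1 - 1 / (p:ℂ) ^ j) * ∑' ν : ℕ, f (p ^ (ν + 1)) / (p : ℂ) ^ ((ν + 1) * j) = 
      ∑' ν : ℕ, gg f p ν / (p : ℂ) ^ ((ν + 1) * j) := by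
  have hs := F_summable hB hf hj hp
  have hs1 := (summable_nat_add_iff 1).2 hs
  have e0 : ∑' ν : ℕ, f (p ^ ν) / (p : ℂ) ^ (ν * j) = ∑' ν : ℕ, f (p ^ (ν + 1)) / (p : ℂ) ^ ((ν + 1) * j) := by
    rw [hs.tsum_eq_zero_add]
    simp [hf1]
  have e1 : ∀ ν, gg f p ν / (p : ℂ) ^ ((ν + 1) * j) = f (p ^ (ν + 1)) / (p : ℂ) ^ ((ν + 1) * j) - 1 / (p:ℂ) ^ j * (f (p ^ ν) / (p : ℂ) ^ (ν * j)) := by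
    intro ν
    rw [gg, sub_div]
    congr 1
    rw [div_mul_div_comm, one_mul, mul_comm ((p:ℂ) ^ j), ← pow_add, add_mul, one_mul]
  simp_rw [e1]
  rw [hs1.tsum_sub (hs.mul_left _), tsum_mul_left, e0]
  ring

lemma D_eq (hf1 : f 1 = 0) (hB : 0 < B) (hf : ∀ p : ℕ, p.Prime → ∀ ν : ℕ, ‖f (p ^ ν)‖ ≤ B * ((ν : ℝ) + 1) ^ l) 
    (hg : ∀ p : ℕ, p.Prime → ∀ ν : ℕ, ‖gg f p ν‖ ≤ B * ((ν : ℝ) + 1) ^ l) {j : ℕ} (hj : 2 ≤ j) : 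
    ∑' p : Nat.Primes, (1 - 1 / ((p : ℕ) : ℂ) ^ j) * ∑' ν : ℕ, f ((p : ℕ) ^ (ν + 1)) / ((p : ℕ) : ℂ) ^ ((ν + 1) * j) = 
    ∑' i : Nat.Primes × ℕ, gg f i.1 i.2 / ((i.1 : ℕ) : ℂ) ^ ((i.2 + 1) * j) := by
  rw [(w_summable hB hg (by omega) (Or.inl hj)).tsum_prod]
  exact tsum_congr fun p => D_inner hf1 hB hf (by omega) p.2

lemma g2_bd (hB : 0 < B) (hg : ∀ p : ℕ, p.Prime → ∀ ν : ℕ, ‖gg f p ν‖ ≤ B * ((ν : ℝ) + 1) ^ l) :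
    ∀ p : ℕ, p.Prime → ∀ ν : ℕ, ‖g2 f p ν‖ ≤ B * ((ν : ℝ) + 1) ^ l := by
  intro p hp ν
  unfold g2
  split_ifs
  · rw [norm_zero]; positivity
  · exact hg p hp ν

lemma gg_eq (hf1 : f 1 = 0) (hp1 : ∀ p : ℕ, p.Prime → f p = 1) {p : ℕ} (hp : p.Prime) (ν : ℕ) : 
    gg f p ν = g2 f p ν + if ν = 0 then 1 else 0 := by
  unfold g2
  split_ifs with h
  · subst h; simp [gg, hf1, hp1 p hp]
  · simp

lemma C_eq (hf1 : f 1 = 0) (hp1 : ∀ p : ℕ, p.Prime → f p = 1) (hB : 0 < B) (hf : ∀ p : ℕ, p.Prime → ∀ ν : ℕ, ‖f (p ^ ν)‖ ≤ B * ((ν : ℝ) + 1) ^ l) 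
    (hg : ∀ p : ℕ, p.Prime → ∀ ν : ℕ, ‖gg f p ν‖ ≤ B * ((ν : ℝ) + 1) ^ l) : 
    (Real.eulerMascheroniConstant : ℂ) +
              ∑' p : Nat.Primes,
                ((Real.log (1 - 1 / ((p : ℕ) : ℝ)) : ℂ) +
                  (1 - 1 / ((p : ℕ) : ℂ)) *
                    ∑' ν : ℕ, f ((p : ℕ) ^ (ν + 1)) / ((p : ℕ) : ℂ) ^ (ν + 1)) = 
    (MM : ℂ) + ∑' i : Nat.Primes × ℕ, g2 f i.1 i.2 / ((i.1 : ℕ) : ℂ) ^ ((i.2 + 1) * 1) := by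
  have hs2 := w_summable (w := g2 f) hB (g2_bd hB hg) le_rfl (Or.inr fun p => by simp [g2])
  have key : ∀ p : Nat.Primes, (Real.log (1 - 1 / ((p : ℕ) : ℝ)) : ℂ) + (1 - 1 / ((p : ℕ) : ℂ)) * ∑' ν : ℕ, f ((p : ℕ) ^ (ν + 1)) / ((p : ℕ) : ℂ) ^ (ν + 1) = 
     ((Real.log (1 - 1 / ((p : ℕ) : ℝ)) + 1 / ((p : ℕ) : ℝ) : ℝ) : ℂ) + ∑' ν : ℕ, g2 f p ν / ((p : ℕ) : ℂ) ^ ((ν + 1) * 1) := by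
    intro p
    have h := D_inner hf1 hB hf (le_refl 1) p.2
    simp only [pow_one, mul_one] at h ⊢
    rw [h]
    have h2 := hs2.prod_factor p
    simp only [mul_one] at h2
    have h3 : HasSum (fun ν : ℕ => if ν = 0 then 1 / ((p : ℕ) : ℂ) else 0) (1 / ((p : ℕ) : ℂ)) := hasSum_ite_eq 0 _
    have e : ∀ ν, gg f p ν / ((p : ℕ) : ℂ) ^ (ν + 1) = (if ν = 0 then 1 / ((p : ℕ) : ℂ) else 0) + g2 f p ν / ((p : ℕ) : ℂ) ^ (ν + 1) := by
      intro ν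
      rw [gg_eq hf1 hp1 p.2]
      split_ifs with h
      · subst h; simp; ring
      · simp
    simp_rw [e]
    rw [h3.summable.tsum_add h2, h3.tsum_eq]
    push_cast
    ring
  simp_rw [key]
  have hl := lp_summable.hasSum.mapL Complex.ofRealCLM
  have hl' : HasSum (fun p : Nat.Primes => ((Real.log (1 - 1 / ((p : ℕ) : ℝ)) + 1 / ((p : ℕ) : ℝ) : ℝ) : ℂ)) ((∑' p : Nat.Primes, (Real.log (1 - 1 / ((p : ℕ) : ℝ)) + 1 / ((p : ℕ) : ℝ)) : ℝ) : ℂ) := hl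
  rw [hl'.summable.tsum_add hs2.prod, hl'.tsum_eq, MM_eq, hs2.tsum_prod]
  push_cast
  ring

lemma TT_one (hf1 : f 1 = 0) (hp1 : ∀ p : ℕ, p.Prime → f p = 1) {x : ℝ} (hx : 1 ≤ x) : 
    TT f ⌊x⌋₊ 1 = ((∑ p ∈ pr x, (⌊x / p⌋₊ : ℝ) : ℝ) : ℂ) + ∑ p ∈ (Finset.Icc 1 ⌊x⌋₊).filter Nat.Prime, ∑ ν ∈ Finset.range ⌊x⌋₊, g2 f p ν * ((⌊x⌋₊ / p ^ (ν + 1) : ℕ) : ℂ) ^ 1 := by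
  rw [TT, pr]
  push_cast
  rw [← Finset.sum_add_distrib]
  refine Finset.sum_congr rfl fun p hp => ?_
  have hpp := (Finset.mem_filter.1 hp).2
  have hX : 0 < ⌊x⌋₊ := Nat.floor_pos.2 hx
  have e : ∀ ν, (f (p ^ (ν + 1)) - f (p ^ ν)) * ((⌊x⌋₊ / p ^ (ν + 1) : ℕ) : ℂ) ^ 1 = (if ν = 0 then ((⌊x⌋₊ / p ^ (ν + 1) : ℕ) : ℂ) else 0) + g2 f p ν * ((⌊x⌋₊ / p ^ (ν + 1) : ℕ) : ℂ) ^ 1 := by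
    intro ν
    have := gg_eq hf1 hp1 hpp ν
    rw [gg] at this
    rw [this]
    split_ifs <;> ring
  simp_rw [e]
  rw [Finset.sum_add_distrib, Finset.sum_ite_eq' , if_pos (Finset.mem_range.2 hX), Nat.floor_div_natCast]
  simp
end

lemma replace_X (k N : ℕ) : ∃ C > 0, ∀ x : ℝ, 16 ≤ x → ∀ j, 1 ≤ j → j ≤ k → ∀ (T D : ℂ) (A : ℝ), 0 < A → 
    ‖T - (x:ℂ) ^ j * D‖ ≤ A * (x ^ j / Real.log x ^ (N + 1)) → ‖D‖ ≤ A * Real.log x → 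
    ‖(⌊x⌋₊ : ℂ) ^ (k - j) * T - (x:ℂ) ^ k * D‖ ≤ A * C * (x ^ k / Real.log x ^ (N + 1)) := by
  obtain ⟨C, hC, h⟩ := log_pow_le 1 one_pos (N + 2)
  refine ⟨1 + k * C, by positivity, fun x hx j hj hjk T D A hA h1 h2 => ?_⟩
  have hx0 : 0 < x := by linarith
  have hL0 : 0 < Real.log x := Real.log_pos (by linarith)
  have h := h x (by linarith)
  rw [Real.rpow_one] at h
  have hXx : (⌊x⌋₊ : ℝ) ≤ x := Nat.floor_le hx0.le
  have hX0 : (0:ℝ) ≤ ⌊x⌋₊ := Nat.cast_nonneg _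
  have hX1 := Nat.lt_floor_add_one x
  set X : ℝ := (⌊x⌋₊ : ℝ) with hX
  have hXc : (⌊x⌋₊ : ℂ) = ((X : ℝ) : ℂ) := by simp [hX]
  set L := Real.log x
  obtain ⟨i, hi⟩ : ∃ i, k - j = i := ⟨_, rfl⟩
  have hk : k = i + j := by omega
  rw [hi]
  have hpd : x * |X ^ i - x ^ i| ≤ k * x ^ i := by
    rcases i with _ | i
    · simp
    · have h1 : X ^ (i + 1) ≤ x ^ (i + 1) := by gcongr
      rw [abs_sub_comm, abs_of_nonneg (by linarith)]
      have := pow_diff hX0 hXx i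
      have h3 : ((i:ℝ) + 1) * x ^ i * (x - X) ≤ k * x ^ i * 1 := by
        gcongr
        · exact_mod_cast (by omega : i + 1 ≤ k)
        · linarith
      calc x * (x ^ (i + 1) - X ^ (i + 1)) ≤ x * (k * x ^ i * 1) := by gcongr; linarith
        _ = _ := by ring
  have e : (⌊x⌋₊ : ℂ) ^ i * T - (x:ℂ) ^ k * D = ((X ^ i : ℝ) : ℂ) * (T - (x:ℂ) ^ j * D) + ((X ^ i - x ^ i : ℝ) : ℂ) * ((x ^ j : ℝ) : ℂ) * D := by
    rw [hXc, hk, pow_add]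
    push_cast
    ring
  rw [e]
  refine (norm_add_le _ _).trans ?_
  rw [norm_mul, norm_mul, norm_mul, Complex.norm_real, Complex.norm_real, Complex.norm_real, Real.norm_eq_abs, Real.norm_eq_abs, Real.norm_eq_abs,
    abs_of_nonneg (show 0 ≤ X ^ i by positivity), abs_of_nonneg (show 0 ≤ x ^ j by positivity)]
  have a1 : X ^ i * ‖T - (x:ℂ) ^ j * D‖ ≤ A * (x ^ k / L ^ (N + 1)) := by
    calc _ ≤ x ^ i * (A * (x ^ j / L ^ (N + 1))) := by gcongr
      _ = _ := by rw [hk, pow_add]; ring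
  have a2 : |X ^ i - x ^ i| * x ^ j * ‖D‖ ≤ A * (k * C) * (x ^ k / L ^ (N + 1)) := by
    calc _ ≤ |X ^ i - x ^ i| * x ^ j * (A * L) := by gcongr
      _ = A * x ^ j / L ^ (N + 1) * |X ^ i - x ^ i| * L ^ (N + 2) := by field_simp; ring
      _ ≤ A * x ^ j / L ^ (N + 1) * |X ^ i - x ^ i| * (C * x) := by gcongr
      _ = A * x ^ j / L ^ (N + 1) * C * (x * |X ^ i - x ^ i|) := by ring
      _ ≤ A * x ^ j / L ^ (N + 1) * C * (k * x ^ i) := by gcongr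
      _ = _ := by
        have : x ^ k = x ^ i * x ^ j := by rw [← pow_add, hk]
        rw [this]; ring
  calc _ ≤ A * (x ^ k / L ^ (N + 1)) + A * (k * C) * (x ^ k / L ^ (N + 1)) := add_le_add a1 a2
    _ = _ := by ring

end LcmAux


namespace LcmAux
open Filter Topology MeasureTheory

lemma log_ge_two {x : ℝ} (hx : 16 ≤ x) : 2 ≤ Real.log x := by
  have h : Real.log 16 ≤ Real.log x := Real.log_le_log (by norm_num) hx
  rw [show (16:ℝ) = 2 ^ 4 by norm_num, Real.log_pow] at h
  have := Real.log_two_gt_d9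
  push_cast at h
  linarith

lemma small_err (N : ℕ) : ∃ C > 0, ∀ x : ℝ, 16 ≤ x → ∀ j : ℕ, x ^ ((j : ℝ) - 1/3) ≤ C * (x ^ j / Real.log x ^ (N + 1)) := by
  obtain ⟨C, hC, h⟩ := log_pow_le (1/3) (by norm_num) (N + 1)
  refine ⟨C, hC, fun x hx j => ?_⟩
  have h := h x (by linarith)
  have hx0 : 0 < x := by linarith
  have hL := log_ge_two hx
  rw [Real.rpow_sub hx0, Real.rpow_natCast, ← mul_div_assoc, div_le_div_iff₀ (by positivity) (by positivity)]
  calc _ ≤ x ^ j * (C * x ^ (1/3 : ℝ)) := by gcongr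
    _ = _ := by ring

noncomputable def II (j : ℕ) : ℝ := ∫ u in Set.Ioi 1, fr u * Real.log u ^ (j - 1) / u ^ 2

noncomputable def PP (N : ℕ) (x : ℝ) : ℝ := Real.log (Real.log x) + MM - ∑ j ∈ Finset.Icc 1 N, II j / Real.log x ^ j

lemma PP_bd (N : ℕ) : ∃ C > 0, ∀ x : ℝ, 16 ≤ x → |PP N x| ≤ C * Real.log x := by
  refine ⟨1 + |MM| + ∑ j ∈ Finset.Icc 1 N, |II j|, by positivity, fun x hx => ?_⟩
  have hL := log_ge_two hx
  have h1 : |Real.log (Real.log x)| ≤ Real.log x := by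
    rw [abs_of_nonneg (Real.log_nonneg (by linarith))]
    exact (Real.log_le_sub_one_of_pos (by linarith)).trans (by linarith)
  have h2 : |∑ j ∈ Finset.Icc 1 N, II j / Real.log x ^ j| ≤ ∑ j ∈ Finset.Icc 1 N, |II j| := by
    refine (Finset.abs_sum_le_sum_abs _ _).trans (Finset.sum_le_sum fun j _ => ?_)
    rw [abs_div]
    refine div_le_self (abs_nonneg _) ?_
    rw [abs_of_nonneg (by positivity)]
    exact one_le_pow₀ (by linarith)
  have h3 : 0 ≤ ∑ j ∈ Finset.Icc 1 N, |II j| := by positivity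
  have h4 : |PP N x| ≤ Real.log x + |MM| + ∑ j ∈ Finset.Icc 1 N, |II j| := by
    unfold PP
    exact (abs_sub _ _).trans (add_le_add ((abs_add_le _ _).trans (by linarith)) h2)
  nlinarith [abs_nonneg MM]

end LcmAux

open LcmAux
/-- **Lcm sums for the class `F₀`** (Theorem `Th_f_additive_lcm`).
`F₀` is the class of additive `f : ℕ → ℂ` with `f p = 1` for every prime `p` and
`|f (p^ν)| ≤ K ν^ℓ` uniformly for primes `p` and `ν ≥ 2`. For `f ∈ F₀`, fixed
`k ≥ 2` and fixed `N ≥ 1`: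
`Σ_{n₁,…,n_k ≤ x} f (lcm(n₁,…,n_k)) = k x^k log log x + E_{f,k} x^k
  + k x^k Σ_{j=1}^N a_j/(log x)^j + O(x^k/(log x)^{N+1})`,
where `E_{f,k} = k C_f − Σ_{j=2}^k (−1)^j binom(k,j) D_{f,j}`, with
`C_f = γ + Σ_p (log(1 − 1/p) + (1 − 1/p) Σ_{ν ≥ 1} f(p^ν)/p^ν)`,
`D_{f,j} = Σ_p (1 − 1/p^j) Σ_{ν ≥ 1} f(p^ν)/p^{νj}`, and
`a_j = −∫_1^∞ (t − ⌊t⌋)(log t)^{j−1}/t² dt`. -/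
theorem stmt_12 (f : ℕ → ℂ)
    (hadd : ∀ m n : ℕ, Nat.Coprime m n → f (m * n) = f m + f n)
    (hp1 : ∀ p : ℕ, p.Prime → f p = 1)
    (hbound : ∃ (l : ℕ) (K : ℝ), ∀ p : ℕ, p.Prime → ∀ ν : ℕ, 2 ≤ ν →
      ‖f (p ^ ν)‖ ≤ K * (ν : ℝ) ^ l)
    (k : ℕ) (hk : 2 ≤ k) (N : ℕ) (hN : 1 ≤ N) :
    ∃ c > (0 : ℝ), ∃ x₀ : ℝ, 3 ≤ x₀ ∧ ∀ x ≥ x₀,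
      ‖(∑ n ∈ Fintype.piFinset (fun _ : Fin k => Finset.Icc 1 ⌊x⌋₊),
          f (Finset.univ.lcm n)) -
        ((k : ℂ) * (x : ℂ) ^ k * ((Real.log (Real.log x) : ℝ) : ℂ) +
          ((k : ℂ) * ((Real.eulerMascheroniConstant : ℂ) +
              ∑' p : Nat.Primes,
                ((Real.log (1 - 1 / ((p : ℕ) : ℝ)) : ℂ) +
                  (1 - 1 / ((p : ℕ) : ℂ)) *
                    ∑' ν : ℕ, f ((p : ℕ) ^ (ν + 1)) / ((p : ℕ) : ℂ) ^ (ν + 1))) -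
            ∑ j ∈ Finset.Icc 2 k, (-1 : ℂ) ^ j * (Nat.choose k j : ℂ) *
              ∑' p : Nat.Primes, (1 - 1 / ((p : ℕ) : ℂ) ^ j) *
                ∑' ν : ℕ, f ((p : ℕ) ^ (ν + 1)) / ((p : ℕ) : ℂ) ^ ((ν + 1) * j)) *
            (x : ℂ) ^ k +
          (k : ℂ) * (x : ℂ) ^ k *
            ((∑ j ∈ Finset.Icc 1 N,
              (-∫ t in Set.Ioi (1 : ℝ),
                  (t - (⌊t⌋₊ : ℝ)) * (Real.log t) ^ (j - 1) / t ^ 2) /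
                (Real.log x) ^ j : ℝ) : ℂ))‖ ≤
        c * x ^ k / (Real.log x) ^ (N + 1) := by
  
  obtain ⟨l, B, hB, hfb⟩ := f_bd (f_one hadd) hp1 hbound
  have hf1 := f_one hadd
  have hf : ∀ p : ℕ, p.Prime → ∀ ν : ℕ, ‖f (p ^ ν)‖ ≤ B * ((ν : ℝ) + 1) ^ l := fun p hp ν => (hfb p hp ν).1
  have hg : ∀ p : ℕ, p.Prime → ∀ ν : ℕ, ‖gg f p ν‖ ≤ B * ((ν : ℝ) + 1) ^ l := fun p hp ν => (hfb p hp ν).2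
  rw [C_eq hf1 hp1 hB hf hg]
  rw [Finset.sum_congr rfl fun j hj => by rw [D_eq hf1 hB hf hg (Finset.mem_Icc.1 hj).1]]
  set H := ∑' i : Nat.Primes × ℕ, g2 f i.1 i.2 / ((i.1 : ℕ) : ℂ) ^ ((i.2 + 1) * 1) with hH
  let D : ℕ → ℂ := fun j => ∑' i : Nat.Primes × ℕ, gg f i.1 i.2 / ((i.1 : ℕ) : ℂ) ^ ((i.2 + 1) * j)
  let DX : ℕ → ℝ → ℂ := fun j x => if j = 1 then ((PP N x : ℝ) : ℂ) + H else D j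
  obtain ⟨C0, hC0, hrep⟩ := replace_X k N
  obtain ⟨C1, hC1, hse⟩ := small_err N
  have key : ∀ j, ∃ A > 0, 1 ≤ j → j ≤ k → ∀ x : ℝ, 16 ≤ x → 
      ‖(⌊x⌋₊ : ℂ) ^ (k - j) * TT f ⌊x⌋₊ j - (x:ℂ) ^ k * DX j x‖ ≤ A * (x ^ k / Real.log x ^ (N + 1)) := by
    intro j
    by_cases hj0 : 1 ≤ j
    swap
    · exact ⟨1, one_pos, fun h => absurd h hj0⟩
    by_cases hj1 : j = 1
    · subst hj1
      obtain ⟨C2, hC2, hw⟩ := w_asym (w := g2 f) hB (g2_bd hB hg) (le_refl 1) (Or.inr fun p => by simp [g2])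
      obtain ⟨C3, hC3, hpf⟩ := prime_floor N hN
      obtain ⟨C4, hC4, hPP⟩ := PP_bd N
      refine ⟨(C3 + C2 * C1 + C4 + ‖H‖) * C0, by positivity, fun _ hjk x hx => ?_⟩
      have hL := log_ge_two hx
      have hx0 : 0 < x := by linarith
      refine hrep x hx 1 le_rfl hjk _ _ _ (by positivity) ?_ ?_
      · simp only [DX, if_true]
        rw [TT_one hf1 hp1 (by linarith)]
        have a1 := hpf x hx
        have a2 := hw x (by linarith)
        have a3 := hse x hx 1
        set W := ∑ p ∈ (Finset.Icc 1 ⌊x⌋₊).filter Nat.Prime, ∑ ν ∈ Finset.range ⌊x⌋₊, g2 f p ν * ((⌊x⌋₊ / p ^ (ν + 1) : ℕ) : ℂ) ^ 1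
        set S := ∑ p ∈ pr x, (⌊x / p⌋₊ : ℝ)
        have a1' : ‖((S - x * PP N x : ℝ) : ℂ)‖ ≤ C3 * (x / Real.log x ^ (N + 1)) := by
          rw [Complex.norm_real, Real.norm_eq_abs]
          exact a1
        have e : (S : ℂ) + W - (x:ℂ) ^ 1 * (((PP N x : ℝ) : ℂ) + H) = ((S - x * PP N x : ℝ) : ℂ) + (W - (x:ℂ) ^ 1 * H) := by
          push_cast; ring
        rw [e]
        refine (norm_add_le _ _).trans ((add_le_add a1' a2).trans ?_)
        have hE : 0 ≤ x ^ 1 / Real.log x ^ (N + 1) := by positivity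
        rw [pow_one] at *
        have := mul_le_mul_of_nonneg_left a3 hC2.le
        have := mul_nonneg (add_nonneg hC4.le (norm_nonneg H)) hE
        linarith
      · simp only [DX, if_true]
        have a4 := hPP x hx
        refine (norm_add_le _ _).trans ?_
        rw [Complex.norm_real, Real.norm_eq_abs]
        have := mul_nonneg (norm_nonneg H) (show 0 ≤ Real.log x - 1 by linarith)
        have : 0 ≤ (C3 + C2 * C1) * Real.log x := by positivity
        linarith
    · obtain ⟨C2, hC2, hw⟩ := w_asym (w := gg f) hB hg hj0 (Or.inl (by omega))
      refine ⟨(C2 * C1 + ‖D j‖) * C0, by positivity, fun _ hjk x hx => ?_⟩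
      have hL := log_ge_two hx
      have hx0 : 0 < x := by linarith
      refine hrep x hx j hj0 hjk _ _ _ (by positivity) ?_ ?_
      · simp only [DX, if_neg hj1]
        have a2 := hw x (by linarith)
        have a3 := hse x hx j
        refine le_trans a2 ?_
        have hE : 0 ≤ x ^ j / Real.log x ^ (N + 1) := by positivity
        have := mul_le_mul_of_nonneg_left a3 hC2.le
        have := mul_nonneg (norm_nonneg (D j)) hE
        linarith
      · simp only [DX, if_neg hj1]
        have := mul_nonneg (norm_nonneg (D j)) (show 0 ≤ Real.log x - 1 by linarith)
        have : 0 ≤ (C2 * C1) * Real.log x := by positivity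
        linarith
  choose A hA hkey using key
  refine ⟨∑ j ∈ Finset.Icc 1 k, (k.choose j : ℝ) * A j + 1, ?_, 16, by norm_num, fun x hx => ?_⟩
  · have : 0 ≤ ∑ j ∈ Finset.Icc 1 k, (k.choose j : ℝ) * A j := Finset.sum_nonneg fun j _ => mul_nonneg (Nat.cast_nonneg _) (hA j).le
    linarith
  have hL := log_ge_two hx
  have hx0 : 0 < x := by linarith
  rw [sum_TT hadd]
  have emain : (k : ℂ) * (x : ℂ) ^ k * ((Real.log (Real.log x) : ℝ) : ℂ) +
          ((k : ℂ) * ((MM : ℂ) + H) - ∑ j ∈ Finset.Icc 2 k, (-1 : ℂ) ^ j * (Nat.choose k j : ℂ) * D j) * (x : ℂ) ^ k +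
          (k : ℂ) * (x : ℂ) ^ k *
            ((∑ j ∈ Finset.Icc 1 N,
              (-∫ t in Set.Ioi (1 : ℝ),
                  (t - (⌊t⌋₊ : ℝ)) * (Real.log t) ^ (j - 1) / t ^ 2) /
                (Real.log x) ^ j : ℝ) : ℂ) = 
      ∑ j ∈ Finset.Icc 1 k, (-1) ^ (j + 1) * (k.choose j : ℂ) * ((x:ℂ) ^ k * DX j x) := by
    have hI : ∑ j ∈ Finset.Icc 1 N, (-∫ t in Set.Ioi (1 : ℝ), (t - (⌊t⌋₊ : ℝ)) * (Real.log t) ^ (j - 1) / t ^ 2) / (Real.log x) ^ j = 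
        - ∑ j ∈ Finset.Icc 1 N, II j / Real.log x ^ j := by
      rw [← Finset.sum_neg_distrib]
      refine Finset.sum_congr rfl fun j _ => ?_
      rw [neg_div]
      rfl
    rw [hI]
    have hins : Finset.Icc 1 k = insert 1 (Finset.Icc 2 k) := by
      ext j; simp only [Finset.mem_insert, Finset.mem_Icc]; omega
    rw [hins, Finset.sum_insert (by simp)]
    have h2 : ∑ j ∈ Finset.Icc 2 k, (-1) ^ (j + 1) * (k.choose j : ℂ) * ((x:ℂ) ^ k * DX j x) = 
        - (∑ j ∈ Finset.Icc 2 k, (-1 : ℂ) ^ j * (Nat.choose k j : ℂ) * D j) * (x : ℂ) ^ k := by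
      rw [← Finset.sum_neg_distrib, Finset.sum_mul]
      refine Finset.sum_congr rfl fun j hj => ?_
      have : j ≠ 1 := by have := (Finset.mem_Icc.1 hj).1; omega
      simp only [DX, if_neg this]
      ring
    rw [h2]
    simp only [DX, if_true, PP, Nat.choose_one_right]
    push_cast
    ring
  have emain' := emain
  simp only [D] at emain'
  rw [emain', ← Finset.sum_sub_distrib]
  have hE : 0 ≤ x ^ k / Real.log x ^ (N + 1) := by positivity
  calc _ ≤ ∑ j ∈ Finset.Icc 1 k, (k.choose j : ℝ) * (A j * (x ^ k / Real.log x ^ (N + 1))) := by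
        refine norm_sum_le_of_le _ fun j hj => ?_
        rw [← mul_sub, norm_mul, norm_mul, norm_pow, norm_neg, norm_one, one_pow, one_mul, Complex.norm_natCast]
        have hj := Finset.mem_Icc.1 hj
        gcongr
        exact hkey j hj.1 hj.2 x hx
    _ = (∑ j ∈ Finset.Icc 1 k, (k.choose j : ℝ) * A j) * (x ^ k / Real.log x ^ (N + 1)) := by
        rw [Finset.sum_mul]
        exact Finset.sum_congr rfl fun j _ => by ring
    _ ≤ _ := by
        rw [mul_div_assoc]
        gcongr
        linarith
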